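/- For every even integer k ≥ 4 there exist constants c₁, c₂ > 0 such that the proportion of labelled C_k-free digraphs G on vertex set [n] satisfying c₁·n ≤ b(G) ≤ c₂·n tends to 1 as n → ∞; that is, almost every C_k-free digraph on n vertices has Θ(n) backwards arcs in a transitive-optimal ordering. -/

import Mathlib

open scoped Classical

/-- An arc set on `Fin n`: a digraph on vertex set `[n]` is identified with its
finite set of arcs. -/
abbrev ArcSet (n : ℕ) := Finset (Fin n × Fin n)

/-- A digraph is loopless. -/
def IsLoopless {n : ℕ} (E : ArcSet n) : Prop := ∀ v : Fin n, (v, v) ∉ E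

/-- An oriented graph: loopless and at most one of the arcs `(u,v)`, `(v,u)`
is present for each pair. -/
def IsOriented {n : ℕ} (E : ArcSet n) : Prop :=
  IsLoopless E ∧ ∀ u v : Fin n, (u, v) ∈ E → (v, u) ∉ E

/-- `E` contains a (not necessarily induced) copy of the directed cycle `C_k`. -/
def ContainsCycle {n : ℕ} (k : ℕ) (E : ArcSet n) : Prop :=
  ∃ f : ZMod k → Fin n, Function.Injective f ∧ ∀ i : ZMod k, (f i, f (i + 1)) ∈ E

/-- `E` is `C_k`-free. -/
def CkFree {n : ℕ} (k : ℕ) (E : ArcSet n) : Prop := ¬ ContainsCycle k E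

/-- The number of backwards arcs of `E` with respect to the ordering `σ`:
arcs `(u,v)` with `σ u > σ v`. -/
def backCount {n : ℕ} (E : ArcSet n) (σ : Equiv.Perm (Fin n)) : ℕ :=
  (E.filter fun e => σ e.2 < σ e.1).card

/-- `b(E)`: the minimum number of backwards arcs over all orderings, i.e. the
number of backwards arcs in a transitive-optimal ordering. -/
noncomputable def bMin {n : ℕ} (E : ArcSet n) : ℕ :=
  Finset.univ.inf' Finset.univ_nonempty (backCount E)

/-- The number of labelled `C_k`-free digraphs on `[n]`. -/
noncomputable def fnkD (n k : ℕ) : ℕ :=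
  (Finset.univ.filter fun E : ArcSet n => IsLoopless E ∧ CkFree k E).card

section Basics

variable {N : ℕ}

/-- The sub-digraph induced on `X`. -/
def rst (E : ArcSet N) (X : Finset (Fin N)) : ArcSet N :=
  E.filter fun e => e.1 ∈ X ∧ e.2 ∈ X

/-- The `C_k`-free digraphs on the vertex set `S`. -/
noncomputable def freeOn (k : ℕ) (S : Finset (Fin N)) : Finset (ArcSet N) :=
  S.offDiag.powerset.filter (CkFree k)

/-- `Pth E m x y A`: there is a directed path in `E` with `m` arcs from `x` to `y`
whose vertex set is `A`. -/
inductive Pth (E : ArcSet N) : ℕ → Fin N → Fin N → Finset (Fin N) → Prop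
  | nil (x : Fin N) : Pth E 0 x x {x}
  | cons {m : ℕ} {x y z : Fin N} {A : Finset (Fin N)} :
      (x, y) ∈ E → x ∉ A → Pth E m y z A → Pth E (m + 1) x z (insert x A)

theorem mem_rst {E : ArcSet N} {X : Finset (Fin N)} {a b : Fin N} :
    (a, b) ∈ rst E X ↔ (a, b) ∈ E ∧ a ∈ X ∧ b ∈ X := by
  simp [rst]

theorem rst_subset (E : ArcSet N) (X : Finset (Fin N)) : rst E X ⊆ E :=
  Finset.filter_subset _ _

theorem mem_freeOn {k : ℕ} {S : Finset (Fin N)} {E : ArcSet N} :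
    E ∈ freeOn k S ↔ E ⊆ S.offDiag ∧ CkFree k E := by
  simp [freeOn]

theorem CkFree.mono {k : ℕ} {E E' : ArcSet N} (h : CkFree k E) (hs : E' ⊆ E) :
    CkFree k E' := by
  rintro ⟨f, hf, h'⟩
  exact h ⟨f, hf, fun i => hs (h' i)⟩

theorem rst_mem_freeOn {k : ℕ} {S X : Finset (Fin N)} {E : ArcSet N}
    (h : E ∈ freeOn k S) : rst E X ∈ freeOn k X := by
  rw [mem_freeOn] at h ⊢
  refine ⟨?_, h.2.mono (rst_subset _ _)⟩
  rintro ⟨a, b⟩ hab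
  rw [mem_rst] at hab
  have := h.1 hab.1
  simp only [Finset.mem_offDiag] at this ⊢
  exact ⟨hab.2.1, hab.2.2, this.2.2⟩

theorem rst_rst {E : ArcSet N} {X Y : Finset (Fin N)} (h : Y ⊆ X) :
    rst (rst E X) Y = rst E Y := by
  ext ⟨a, b⟩
  simp only [mem_rst]
  constructor
  · rintro ⟨⟨h1, -⟩, h2⟩
    exact ⟨h1, h2⟩
  · rintro ⟨h1, h2, h3⟩
    exact ⟨⟨h1, h h2, h h3⟩, h2, h3⟩

theorem freeOn_ne_of_mem {k : ℕ} {S : Finset (Fin N)} {E : ArcSet N} (h : E ∈ freeOn k S)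
    {a b : Fin N} (hab : (a, b) ∈ E) : a ∈ S ∧ b ∈ S ∧ a ≠ b :=
  Finset.mem_offDiag.1 ((mem_freeOn.1 h).1 hab)

theorem empty_mem_freeOn {k : ℕ} (S : Finset (Fin N)) : (∅ : ArcSet N) ∈ freeOn k S := by
  rw [mem_freeOn]
  refine ⟨Finset.empty_subset _, ?_⟩
  rintro ⟨f, -, h⟩
  simpa using h 0

theorem one_le_card_freeOn {k : ℕ} (S : Finset (Fin N)) : 1 ≤ (freeOn k S).card :=
  Finset.card_pos.2 ⟨_, empty_mem_freeOn S⟩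

namespace Pth

variable {E E' : ArcSet N} {m n : ℕ} {x y z w : Fin N} {A B : Finset (Fin N)}

theorem mono (h : Pth E m x y A) (hE : E ⊆ E') : Pth E' m x y A := by
  induction h with
  | nil x => exact nil x
  | cons h1 h2 _ ih => exact cons (hE h1) h2 ih

theorem right_mem (h : Pth E m x y A) : y ∈ A := by
  induction h with
  | nil x => simp
  | cons h1 h2 _ ih => exact Finset.mem_insert_of_mem ih

theorem card_eq (h : Pth E m x y A) : A.card = m + 1 := by
  induction h with
  | nil x => simp
  | cons h1 h2 _ ih => rw [Finset.card_insert_of_notMem h2, ih]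

theorem append (h : Pth E m x y A) (h' : Pth E n z w B) (hyz : (y, z) ∈ E)
    (hd : Disjoint A B) : Pth E (m + n + 1) x w (A ∪ B) := by
  induction h with
  | nil x =>
    rw [Finset.disjoint_singleton_left] at hd
    have := cons hyz hd h'
    rw [Nat.zero_add]
    exact this
  | @cons m x y' z A h1 h2 _ ih =>
    rw [Finset.disjoint_insert_left] at hd
    have := cons (m := m + n + 1) h1 (A := A ∪ B) (by simp [h2, hd.1]) (ih hyz hd.2)
    rw [Finset.insert_union, show m + 1 + n + 1 = m + n + 1 + 1 by ring]
    exact this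

theorem snoc (h : Pth E m x y A) (hyz : (y, z) ∈ E) (hz : z ∉ A) :
    Pth E (m + 1) x z (insert z A) := by
  have := h.append (nil z) hyz (by simpa using hz)
  rwa [Finset.union_comm, ← Finset.insert_eq] at this

theorem subset_of (h : Pth E m x y A) {T : Finset (Fin N)} (hy : y ∈ T)
    (hT : ∀ a b, (a, b) ∈ E → a ∈ T) : A ⊆ T := by
  induction h with
  | nil x => simpa using hy
  | cons h1 h2 _ ih => exact Finset.insert_subset (hT _ _ h1) (ih hy)

theorem exists_fun (h : Pth E m x y A) :
    ∃ g : ℕ → Fin N, g 0 = x ∧ g m = y ∧ (∀ i ≤ m, g i ∈ A) ∧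
      (∀ i < m, (g i, g (i + 1)) ∈ E) ∧ (∀ i ≤ m, ∀ j ≤ m, g i = g j → i = j) := by
  induction h with
  | nil x => exact ⟨fun _ => x, rfl, rfl, by simp, by simp, by omega⟩
  | @cons m x y z A h1 h2 h3 ih =>
    obtain ⟨g, g0, gm, gA, gE, gi⟩ := ih
    refine ⟨fun i => if i = 0 then x else g (i - 1), by simp, by simp [gm], ?_, ?_, ?_⟩
    · rintro (_ | i) hi
      · simp
      · simpa using Or.inr (gA i (by omega))
    · rintro (_ | i) hi
      · simpa [g0] using h1
      · simpa using gE i (by omega)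
    · rintro (_ | i) hi (_ | j) hj hij
      · rfl
      · simp only [if_true, Nat.add_one_ne_zero, if_false, Nat.add_sub_cancel] at hij
        exact absurd (gA j (by omega)) (hij ▸ h2)
      · simp only [if_true, Nat.add_one_ne_zero, if_false, Nat.add_sub_cancel] at hij
        exact absurd (gA i (by omega)) (hij ▸ h2)
      · simp only [Nat.add_one_ne_zero, if_false, Nat.add_sub_cancel] at hij
        have := gi i (by omega) j (by omega) hij
        omega

theorem containsCycle (h : Pth E m x y A) (hyx : (y, x) ∈ E) (hm : 1 ≤ m) :
    ContainsCycle (m + 1) E := by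
  obtain ⟨g, g0, gm, gA, gE, gi⟩ := h.exists_fun
  refine ⟨fun i => g i.val, ?_, ?_⟩
  · intro i j hij
    have := ZMod.val_lt i
    have := ZMod.val_lt j
    exact ZMod.val_injective _ (gi _ (by omega) _ (by omega) hij)
  · intro i
    have hi := ZMod.val_lt i
    have : Fact (1 < m + 1) := ⟨by omega⟩
    by_cases h' : i.val = m
    · have : (i + 1).val = 0 := by
        rw [ZMod.val_add, h', ZMod.val_one]
        simp
      simp only [this, h', g0, gm, hyx]
    · have : (i + 1).val = i.val + 1 := by
        rw [ZMod.val_add, ZMod.val_one, Nat.mod_eq_of_lt (by omega)]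
      simp only [this]
      exact gE _ (by omega)

end Pth

theorem CkFree.no_closed {k : ℕ} {E : ArcSet N} (hE : CkFree k E) (hk : 2 ≤ k) {m : ℕ}
    (hm : m + 1 = k) {x y : Fin N} {A : Finset (Fin N)} (h : Pth E m x y A) :
    (y, x) ∉ E := by
  subst hm
  exact fun hyx => hE (h.containsCycle hyx (by omega))

/-- A cycle cannot cross a one-way cut. -/
theorem CkFree.of_cut {k : ℕ} [NeZero k] {E : ArcSet N} {X : Finset (Fin N)}
    (h : ∀ a b, (a, b) ∈ E → a ∉ X → b ∉ X)
    (h1 : CkFree k (E.filter fun e => e.1 ∈ X ∧ e.2 ∈ X))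
    (h2 : CkFree k (E.filter fun e => e.1 ∉ X ∧ e.2 ∉ X)) : CkFree k E := by
  rintro ⟨f, hf, hfE⟩
  by_cases hX : ∀ i, f i ∈ X
  · exact h1 ⟨f, hf, fun i => by simp [hfE, hX]⟩
  · push Not at hX
    obtain ⟨i, hi⟩ := hX
    have key : ∀ t : ℕ, f (i + t) ∉ X := by
      intro t
      induction t with
      | zero => simpa using hi
      | succ t ih =>
        have := h _ _ (hfE (i + t)) ih
        rwa [Nat.cast_succ, ← add_assoc]
    have hX : ∀ j, f j ∉ X := by
      intro j
      have := key (j - i).val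
      rwa [ZMod.natCast_zmod_val, add_sub_cancel] at this
    exact h2 ⟨f, hf, fun i => by simp [hfE, hX]⟩

/-- Gluing two digraphs along a one-way cut. -/
theorem glue_mem_freeOn {k : ℕ} [NeZero k] {X Y : Finset (Fin N)} (hXY : Disjoint X Y)
    {A B C : ArcSet N} (hA : A ∈ freeOn k X) (hB : B ∈ freeOn k Y) (hC : C ⊆ X ×ˢ Y) :
    A ∪ B ∪ C ∈ freeOn k (X ∪ Y) := by
  have hd : ∀ a, a ∈ X → a ∉ Y := fun a h1 h2 => Finset.disjoint_left.1 hXY h1 h2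
  have hA' := mem_freeOn.1 hA
  have hB' := mem_freeOn.1 hB
  rw [mem_freeOn]
  have e1 : ∀ a b, (a, b) ∈ A → a ∈ X ∧ b ∈ X ∧ a ≠ b := fun a b h => freeOn_ne_of_mem hA h
  have e2 : ∀ a b, (a, b) ∈ B → a ∈ Y ∧ b ∈ Y ∧ a ≠ b := fun a b h => freeOn_ne_of_mem hB h
  have e3 : ∀ a b, (a, b) ∈ C → a ∈ X ∧ b ∈ Y := fun a b h => Finset.mem_product.1 (hC h)
  constructor
  · rintro ⟨a, b⟩ h
    simp only [Finset.mem_union, Finset.mem_offDiag] at h ⊢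
    rcases h with (h | h) | h
    · have := e1 _ _ h; tauto
    · have := e2 _ _ h; tauto
    · have := e3 _ _ h
      refine ⟨Or.inl this.1, Or.inr this.2, ?_⟩
      rintro rfl
      exact hd _ this.1 this.2
  · apply CkFree.of_cut (X := X)
    · intro a b hab ha hb
      simp only [Finset.mem_union] at hab
      rcases hab with (h | h) | h
      · exact ha (e1 _ _ h).1
      · exact hd _ hb (e2 _ _ h).2.1
      · exact ha (e3 _ _ h).1
    · apply hA'.2.mono
      rintro ⟨a, b⟩ h
      simp only [Finset.mem_filter, Finset.mem_union] at h
      rcases h with ⟨(h | h) | h, h'⟩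
      · exact h
      · exact absurd (e2 _ _ h).1 (hd _ h'.1)
      · exact absurd (e3 _ _ h).2 (hd _ h'.2)
    · apply hB'.2.mono
      rintro ⟨a, b⟩ h
      simp only [Finset.mem_filter, Finset.mem_union] at h
      rcases h with ⟨(h | h) | h, h'⟩
      · exact absurd (e1 _ _ h).1 h'.1
      · exact h
      · exact absurd (e3 _ _ h).1 h'.1

/-- The digraphs in `freeOn k (X ∪ Y)` with no arc from `Y` to `X`. -/
noncomputable def zeroCut (k : ℕ) (X Y : Finset (Fin N)) : Finset (ArcSet N) :=
  (freeOn k (X ∪ Y)).filter fun E => ∀ a ∈ X, ∀ b ∈ Y, (b, a) ∉ E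

theorem card_mul_le_card_zeroCut {k : ℕ} [NeZero k] {X Y : Finset (Fin N)}
    (hXY : Disjoint X Y) :
    2 ^ (X.card * Y.card) * ((freeOn k X).card * (freeOn k Y).card) ≤ (zeroCut k X Y).card := by
  have hd : ∀ a, a ∈ X → a ∉ Y := fun a h1 h2 => Finset.disjoint_left.1 hXY h1 h2
  rw [← Finset.card_product X Y, ← Finset.card_powerset, ← Finset.card_product,
    ← Finset.card_product]
  apply Finset.card_le_card_of_injOn fun p => p.2.1 ∪ p.2.2 ∪ p.1
  · rintro ⟨C, A, B⟩ h
    simp only [Finset.coe_product, Set.mem_prod, Finset.mem_coe, Finset.mem_powerset] at h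
    obtain ⟨hC, hA, hB⟩ := h
    simp only [zeroCut, Finset.mem_coe, Finset.mem_filter]
    refine ⟨glue_mem_freeOn hXY hA hB hC, ?_⟩
    intro a ha b hb h
    simp only [Finset.mem_union] at h
    rcases h with (h | h) | h
    · exact hd _ (freeOn_ne_of_mem hA h).1 hb
    · exact hd _ ha (freeOn_ne_of_mem hB h).2.1
    · exact hd _ ha (Finset.mem_product.1 (hC h)).2
  · rintro ⟨C, A, B⟩ h ⟨C', A', B'⟩ h' heq
    simp only [Finset.coe_product, Set.mem_prod, Finset.mem_coe, Finset.mem_powerset] at h h'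
    obtain ⟨hC, hA, hB⟩ := h
    obtain ⟨hC', hA', hB'⟩ := h'
    have key : ∀ {C A B : ArcSet N}, C ⊆ X ×ˢ Y → A ∈ freeOn k X → B ∈ freeOn k Y →
        rst (A ∪ B ∪ C) X = A ∧ rst (A ∪ B ∪ C) Y = B ∧
        ((A ∪ B ∪ C).filter fun e => e.1 ∈ X ∧ e.2 ∈ Y) = C := by
      intro C A B hC hA hB
      have e1 : ∀ a b, (a, b) ∈ A → a ∈ X ∧ b ∈ X ∧ a ≠ b := fun a b h => freeOn_ne_of_mem hA h
      have e2 : ∀ a b, (a, b) ∈ B → a ∈ Y ∧ b ∈ Y ∧ a ≠ b := fun a b h => freeOn_ne_of_mem hB h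
      have e3 : ∀ a b, (a, b) ∈ C → a ∈ X ∧ b ∈ Y := fun a b h => Finset.mem_product.1 (hC h)
      refine ⟨?_, ?_, ?_⟩ <;> ext ⟨a, b⟩ <;>
        simp only [mem_rst, Finset.mem_union, Finset.mem_filter] <;>
        have h1 := e1 a b <;> have h2 := e2 a b <;> have h3 := e3 a b <;>
        have h4 := hd a <;> have h5 := hd b <;> tauto
    obtain ⟨k1, k2, k3⟩ := key hC hA hB
    obtain ⟨k1', k2', k3'⟩ := key hC' hA' hB'
    simp only at heq
    rw [heq] at k1 k2 k3
    rw [← k1, ← k2, ← k3, k1', k2', k3']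

theorem card_freeOn_glue {k : ℕ} [NeZero k] {X Y : Finset (Fin N)} (hXY : Disjoint X Y) :
    2 ^ (X.card * Y.card) * ((freeOn k X).card * (freeOn k Y).card) ≤
      (freeOn k (X ∪ Y)).card :=
  (card_mul_le_card_zeroCut hXY).trans (Finset.card_le_card (Finset.filter_subset _ _))

theorem two_pow_choose_le_card_freeOn {k : ℕ} [NeZero k] (S : Finset (Fin N)) :
    2 ^ (S.card.choose 2) ≤ (freeOn k S).card := by
  induction S using Finset.induction_on with
  | empty => simpa using one_le_card_freeOn (k := k) (∅ : Finset (Fin N))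
  | insert a S ha ih =>
    have := card_freeOn_glue (k := k) (X := {a}) (Y := S) (by simpa using ha)
    rw [Finset.card_insert_of_notMem ha, Finset.insert_eq, Nat.choose_succ_succ' S.card 1,
      Nat.choose_one_right, pow_add]
    refine le_trans ?_ this
    simp only [Finset.card_singleton, one_mul]
    have h1 := one_le_card_freeOn (k := k) ({a} : Finset (Fin N))
    calc 2 ^ S.card * 2 ^ (S.card.choose (1 + 1)) ≤ 2 ^ S.card * (freeOn k S).card :=
          Nat.mul_le_mul_left _ ih
      _ ≤ _ := Nat.mul_le_mul_left _ (Nat.le_mul_of_pos_left _ h1)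

end Basics

section Shattering

variable {N : ℕ}

/-- The set of pairs of `P` carrying exactly one arc. -/
noncomputable def xorPat (P E : ArcSet N) : ArcSet N :=
  P.filter fun e => Xor (e ∈ E) (e.swap ∈ E)

theorem mem_xorPat {P E : ArcSet N} {e : Fin N × Fin N} :
    e ∈ xorPat P E ↔ e ∈ P ∧ Xor (e ∈ E) (e.swap ∈ E) := by
  simp [xorPat]

/-- Every orientation of the pairs in `D` is realised by some member of `𝒢`. -/
def Flex (𝒢 : Finset (ArcSet N)) (D : ArcSet N) : Prop :=
  ∀ O ⊆ D, ∃ E ∈ 𝒢, (∀ e ∈ D, e ∉ O → e ∈ E) ∧ ∀ e ∈ O, e.swap ∈ E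

theorem Flex.mono {𝒢 ℋ : Finset (ArcSet N)} {D : ArcSet N} (h : Flex 𝒢 D) (hs : 𝒢 ⊆ ℋ) :
    Flex ℋ D := fun O hO => by
  obtain ⟨E, hE, h'⟩ := h O hO
  exact ⟨E, hs hE, h'⟩

theorem card_le_card_flex_of_xorPat_eq {P : ArcSet N} {𝒢 : Finset (ArcSet N)}
    (hag : ∀ E ∈ 𝒢, ∀ E' ∈ 𝒢, ∀ e, e ∉ P → e.swap ∉ P → e ∈ E → e ∈ E')
    {l : ArcSet N} (hl : ∀ E ∈ 𝒢, xorPat P E = l) :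
    𝒢.card ≤ (P.powerset.filter (Flex 𝒢)).card := by
  have hinj : Set.InjOn (fun E : ArcSet N => P.filter (· ∈ E)) 𝒢 := by
    intro E hE E' hE' heq
    have hP : ∀ e ∈ P, (e ∈ E ↔ e ∈ E') := by
      intro e he
      have := congrArg (e ∈ ·) heq
      simpa [he] using this
    have hP' : ∀ e ∈ P, (e.swap ∈ E ↔ e.swap ∈ E') := by
      intro e he
      have h1 : e ∈ xorPat P E ↔ e ∈ xorPat P E' := by rw [hl E hE, hl E' hE']
      rw [mem_xorPat, mem_xorPat] at h1
      have h2 := hP e he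
      unfold Xor at h1
      tauto
    ext e
    by_cases h1 : e ∈ P
    · exact hP e h1
    · by_cases h2 : e.swap ∈ P
      · simpa using hP' _ h2
      · exact ⟨hag E hE E' hE' e h1 h2, hag E' hE' E hE e h1 h2⟩
  rw [← Finset.card_image_of_injOn hinj]
  refine (Finset.card_le_card_shatterer _).trans (Finset.card_le_card ?_)
  intro D hD
  rw [Finset.mem_shatterer] at hD
  have hDP : D ⊆ P := by
    obtain ⟨u, hu, h⟩ := hD (Finset.Subset.refl D)
    obtain ⟨E, -, rfl⟩ := Finset.mem_image.1 hu
    rw [Finset.inter_eq_left] at h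
    exact h.trans (Finset.filter_subset _ _)
  rw [Finset.mem_filter, Finset.mem_powerset]
  refine ⟨hDP, fun O hO => ?_⟩
  obtain ⟨u, hu, h⟩ := hD (t := (D \ O) ∪ (O \ l))
    (Finset.union_subset Finset.sdiff_subset (Finset.sdiff_subset.trans hO))
  obtain ⟨E, hE, rfl⟩ := Finset.mem_image.1 hu
  have key : ∀ e ∈ D, (e ∈ E ↔ (e ∉ O ∨ e ∉ l)) := by
    intro e he
    have := congrArg (e ∈ ·) h
    simp only [Finset.mem_inter, he, true_and, Finset.mem_filter, hDP he, Finset.mem_union,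
      Finset.mem_sdiff, eq_iff_iff] at this
    tauto
  refine ⟨E, hE, fun e he heO => (key e he).2 (Or.inl heO), fun e he => ?_⟩
  have h1 := key e (hO he)
  have h2 : e ∈ l ↔ Xor (e ∈ E) (e.swap ∈ E) := by
    rw [← hl E hE]
    simp [xorPat, hDP (hO he)]
  simp only [Xor] at h2
  tauto

theorem card_le_mul_card_flex {P : ArcSet N} {𝒢 : Finset (ArcSet N)}
    (hag : ∀ E ∈ 𝒢, ∀ E' ∈ 𝒢, ∀ e, e ∉ P → e.swap ∉ P → e ∈ E → e ∈ E')
    {B : Finset (ArcSet N)} (hB : ∀ E ∈ 𝒢, xorPat P E ∈ B) :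
    𝒢.card ≤ B.card * (P.powerset.filter (Flex 𝒢)).card := by
  rw [Finset.card_eq_sum_card_fiberwise (f := xorPat P) (t := B) hB, ← smul_eq_mul]
  refine Finset.sum_le_card_nsmul _ _ _ fun l _ => ?_
  have hs : 𝒢.filter (fun E => xorPat P E = l) ⊆ 𝒢 := Finset.filter_subset _ _
  refine (card_le_card_flex_of_xorPat_eq (P := P) (l := l) ?_ ?_).trans
    (Finset.card_le_card ?_)
  · exact fun E hE E' hE' => hag E (hs hE) E' (hs hE')
  · exact fun E hE => (Finset.mem_filter.1 hE).2
  · intro D hD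
    rw [Finset.mem_filter] at hD ⊢
    exact ⟨hD.1, hD.2.mono hs⟩

end Shattering

section Cliques

variable {N : ℕ}

/-- No two vertices of `T` are joined by a directed path with `k - 2` arcs. -/
def NoLink (k : ℕ) (E : ArcSet N) (T : Finset (Fin N)) : Prop :=
  ∀ u ∈ T, ∀ v ∈ T, ∀ A, ¬ Pth E (k - 2) u v A

/-- The number of subsets of `S` with no two vertices joined by a path with `k - 2` arcs. -/
noncomputable def kap (k : ℕ) (S : Finset (Fin N)) (E : ArcSet N) : ℕ :=
  (S.powerset.filter (NoLink k E)).card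

theorem NoLink.subset {k : ℕ} {E : ArcSet N} {T T' : Finset (Fin N)} (h : NoLink k E T)
    (hs : T' ⊆ T) : NoLink k E T' := fun u hu v hv => h u (hs hu) v (hs hv)

theorem Pth.ne {E : ArcSet N} {m : ℕ} {x y : Fin N} {A : Finset (Fin N)}
    (h : Pth E m x y A) (hm : 1 ≤ m) : x ≠ y := by
  cases h with
  | nil => omega
  | cons h1 h2 h3 =>
    rintro rfl
    exact h2 h3.right_mem

theorem Pth.exists_arc_right {E : ArcSet N} {m : ℕ} {x y : Fin N} {A : Finset (Fin N)}
    (h : Pth E m x y A) (hm : 1 ≤ m) : ∃ z, (z, y) ∈ E := by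
  induction h with
  | nil => omega
  | @cons m x y z A h1 h2 h3 ih =>
    rcases Nat.eq_zero_or_pos m with rfl | hm
    · cases h3; exact ⟨_, h1⟩
    · exact ih hm

theorem Pth.subset {E : ArcSet N} {m : ℕ} {x y : Fin N} {A S : Finset (Fin N)}
    (h : Pth E m x y A) (hm : 1 ≤ m) (hE : E ⊆ S.offDiag) : A ⊆ S := by
  obtain ⟨z, hz⟩ := h.exists_arc_right hm
  exact h.subset_of (Finset.mem_offDiag.1 (hE hz)).2.1
    fun a b hab => (Finset.mem_offDiag.1 (hE hab)).1

theorem one_le_kap (k : ℕ) (S : Finset (Fin N)) (E : ArcSet N) : 1 ≤ kap k S E :=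
  Finset.card_pos.2 ⟨∅, by simp [NoLink]⟩

theorem Pth.notMem_of_cut {E : ArcSet N} {m : ℕ} {x y : Fin N} {A X : Finset (Fin N)}
    (h : Pth E m x y A) (hX : ∀ a b, (a, b) ∈ E → a ∉ X → b ∉ X) (hx : x ∉ X) : y ∉ X := by
  induction h with
  | nil x => exact hx
  | cons h1 _ _ ih => exact ih (hX _ _ h1 hx)

/-- The vertices joined to `v` by exactly one arc. -/
noncomputable def oneNbr (E : ArcSet N) (v : Fin N) : Finset (Fin N) :=
  Finset.univ.filter fun u => Xor ((v, u) ∈ E) ((u, v) ∈ E)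

theorem mem_oneNbr {E : ArcSet N} {u v : Fin N} :
    u ∈ oneNbr E v ↔ Xor ((v, u) ∈ E) ((u, v) ∈ E) := by
  simp [oneNbr]

/-- Extension bound: the number of ways to add a vertex with a prescribed set of
single-arc patterns. -/
theorem card_extend_le {k : ℕ} (hk : 3 ≤ k) {S : Finset (Fin N)} {v : Fin N} (hv : v ∉ S)
    {H : ArcSet N} (B : Finset (Finset (Fin N))) :
    ((freeOn k (insert v S)).filter fun E => rst E S = H ∧ oneNbr E v ∩ S ∈ B).card ≤
      B.card * kap k S H := by
  set 𝒢 := (freeOn k (insert v S)).filter fun E => rst E S = H ∧ oneNbr E v ∩ S ∈ B with h𝒢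
  set P : ArcSet N := ({v} : Finset (Fin N)) ×ˢ S with hP
  have hmem : ∀ a b, (a, b) ∈ P ↔ a = v ∧ b ∈ S := by
    intro a b; simp [hP, and_comm, eq_comm]
  have h𝒢m : ∀ E ∈ 𝒢, E ∈ freeOn k (insert v S) ∧ rst E S = H ∧ oneNbr E v ∩ S ∈ B := by
    intro E hE
    exact Finset.mem_filter.1 hE
  have h1 := card_le_mul_card_flex (P := P) (𝒢 := 𝒢)
    (B := B.image fun T => ({v} : Finset (Fin N)) ×ˢ T) ?_ ?_
  · refine h1.trans (Nat.mul_le_mul Finset.card_image_le ?_)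
    apply Finset.card_le_card_of_injOn fun D => D.image Prod.snd
    · intro D hD
      simp only [Finset.mem_coe, Finset.mem_filter, Finset.mem_powerset] at hD ⊢
      refine ⟨?_, ?_⟩
      · intro b hb
        obtain ⟨⟨a, b⟩, hab, rfl⟩ := Finset.mem_image.1 hb
        exact ((hmem _ _).1 (hD.1 hab)).2
      · intro u hu w hw A hA
        have hvD : ∀ u, u ∈ D.image Prod.snd → (v, u) ∈ D := by
          intro u hu
          obtain ⟨⟨a, b⟩, hab, rfl⟩ := Finset.mem_image.1 hu
          have := ((hmem _ _).1 (hD.1 hab)).1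
          subst this
          exact hab
        have hne := hA.ne (by omega)
        obtain ⟨E, hE, e1, e2⟩ := hD.2 {(v, w)} (by simpa using hvD _ hw)
        have a1 := e1 _ (hvD _ hu) (by simpa using hne)
        have a2 := e2 (v, w) (by simp)
        obtain ⟨hE1, hE2, -⟩ := h𝒢m E hE
        have hHE : H ⊆ E := hE2 ▸ rst_subset _ _
        have hHS : H ⊆ S.offDiag := by
          have := rst_mem_freeOn (X := S) hE1
          rw [hE2] at this
          exact (mem_freeOn.1 this).1
        have hvA : v ∉ A := fun h => hv (hA.subset (by omega) hHS h)
        have hp := Pth.cons a1 hvA (hA.mono hHE)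
        exact (mem_freeOn.1 hE1).2.no_closed (by omega) (by omega) hp a2
    · intro D hD D' hD' h
      simp only [Finset.mem_coe, Finset.mem_filter, Finset.mem_powerset] at hD hD'
      have key : ∀ D : ArcSet N, D ⊆ P → D = ({v} : Finset (Fin N)) ×ˢ D.image Prod.snd := by
        intro D hD
        ext ⟨a, b⟩
        simp only [Finset.mem_product, Finset.mem_singleton, Finset.mem_image, Prod.exists,
          exists_eq_right]
        constructor
        · intro h
          exact ⟨((hmem _ _).1 (hD h)).1, a, h⟩
        · rintro ⟨rfl, c, h⟩
          have := ((hmem _ _).1 (hD h)).1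
          rwa [this] at h
      rw [key D hD.1, key D' hD'.1]
      simp only at h
      rw [h]
  · rintro E hE E' hE' ⟨a, b⟩ h1 h2 h3
    obtain ⟨hE1, hE2, -⟩ := h𝒢m E hE
    obtain ⟨hE1', hE2', -⟩ := h𝒢m E' hE'
    have := freeOn_ne_of_mem hE1 h3
    simp only [hmem, Finset.mem_insert, Prod.swap_prod_mk] at *
    have hab : (a, b) ∈ rst E S := by
      rw [mem_rst]
      refine ⟨h3, ?_, ?_⟩ <;> grind
    rw [hE2, ← hE2', mem_rst] at hab
    exact hab.1
  · intro E hE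
    obtain ⟨hE1, hE2, hE3⟩ := h𝒢m E hE
    rw [Finset.mem_image]
    refine ⟨_, hE3, ?_⟩
    ext ⟨a, b⟩
    simp only [mem_xorPat, hmem, Finset.mem_product, Finset.mem_singleton, Finset.mem_inter,
      mem_oneNbr, Prod.swap_prod_mk]
    constructor
    · rintro ⟨rfl, h1, h2⟩; exact ⟨⟨rfl, h2⟩, h1⟩
    · rintro ⟨⟨rfl, h1⟩, h2⟩; exact ⟨rfl, h2, h1⟩

/-- Extension by a set `Z` of vertices with prescribed patterns to the rest. -/
theorem card_extend_set_le {k : ℕ} (hk : 3 ≤ k) {S Z : Finset (Fin N)} (hd : Disjoint S Z)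
    {H : ArcSet N} (B : Finset (Finset (Fin N))) :
    ((freeOn k (S ∪ Z)).filter fun E => rst E S = H ∧ ∀ z ∈ Z, oneNbr E z ∩ S ∈ B).card ≤
      2 ^ (Z.card ^ 2) * (B.card * kap k S H) ^ Z.card := by
  have hdz : ∀ z ∈ Z, z ∉ S := fun z hz hz' => Finset.disjoint_left.1 hd hz' hz
  set R : Fin N → Finset (ArcSet N) := fun z =>
    (freeOn k (insert z S)).filter fun E => rst E S = H ∧ oneNbr E z ∩ S ∈ B with hR
  have h1 : (Z.pi fun z => R z).card ≤ (B.card * kap k S H) ^ Z.card := by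
    rw [Finset.card_pi]
    refine Finset.prod_le_pow_card _ _ _ fun z hz => ?_
    exact card_extend_le hk (hdz z hz) B
  have h2 : (Z.offDiag.powerset).card ≤ 2 ^ (Z.card ^ 2) := by
    rw [Finset.card_powerset, Finset.offDiag_card]
    exact Nat.pow_le_pow_right (by norm_num) (by rw [sq]; omega)
  refine le_trans ?_ (Nat.mul_le_mul h2 h1)
  rw [← Finset.card_product]
  apply Finset.card_le_card_of_injOn fun E => (rst E Z, fun z _ => rst E (insert z S))
  · intro E hE
    simp only [Finset.mem_coe, Finset.mem_filter, Finset.mem_product, Finset.mem_pi,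
      Finset.mem_powerset] at hE ⊢
    refine ⟨(mem_freeOn.1 (rst_mem_freeOn hE.1)).1, fun z hz => ?_⟩
    simp only [hR, Finset.mem_filter]
    refine ⟨rst_mem_freeOn hE.1, ?_, ?_⟩
    · rw [rst_rst (Finset.subset_insert _ _), hE.2.1]
    · convert hE.2.2 z hz using 1
      ext u
      simp only [Finset.mem_inter, mem_oneNbr, mem_rst, Finset.mem_insert]
      constructor
      · rintro ⟨h1, h2⟩
        simpa [h2] using h1
      · rintro ⟨h1, h2⟩
        simpa [h2] using h1
  · intro E hE E' hE' heq
    simp only [Finset.mem_coe, Finset.mem_filter] at hE hE'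
    simp only [Prod.mk.injEq] at heq
    have key : ∀ E E' : ArcSet N, E ∈ freeOn k (S ∪ Z) → E' ∈ freeOn k (S ∪ Z) →
        rst E S = H → rst E' S = H → rst E Z = rst E' Z →
        (fun z (_ : z ∈ Z) => rst E (insert z S)) = (fun z _ => rst E' (insert z S)) →
        E ⊆ E' := by
      intro E E' hE hE' h1 h1' h2 h3
      rintro ⟨a, b⟩ hab
      have := freeOn_ne_of_mem hE hab
      simp only [Finset.mem_union] at this
      have h3' : ∀ z ∈ Z, rst E (insert z S) = rst E' (insert z S) := fun z hz =>
        congrFun (congrFun h3 z) hz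
      obtain ⟨ha | ha, hb | hb, -⟩ := this
      · have : (a, b) ∈ rst E S := mem_rst.2 ⟨hab, ha, hb⟩
        rw [h1, ← h1'] at this
        exact (mem_rst.1 this).1
      · have : (a, b) ∈ rst E (insert b S) := mem_rst.2 ⟨hab, by simp [ha], by simp⟩
        rw [h3' b hb] at this
        exact (mem_rst.1 this).1
      · have : (a, b) ∈ rst E (insert a S) := mem_rst.2 ⟨hab, by simp, by simp [hb]⟩
        rw [h3' a ha] at this
        exact (mem_rst.1 this).1
      · have : (a, b) ∈ rst E Z := mem_rst.2 ⟨hab, ha, hb⟩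
        rw [h2] at this
        exact (mem_rst.1 this).1
    exact Finset.Subset.antisymm (key E E' hE.1 hE'.1 hE.2.1 hE'.2.1 heq.1 heq.2)
      (key E' E hE'.1 hE.1 hE'.2.1 hE.2.1 heq.1.symm heq.2.symm)

/-- The number of one-way cuts of `E` is at most the number of its unlinked sets. -/
theorem card_cuts_le_kap {k : ℕ} (hk : 3 ≤ k) {S : Finset (Fin N)} {E : ArcSet N}
    (hE : E ⊆ S.offDiag) :
    (S.powerset.filter fun X => ∀ a ∈ X, ∀ b ∈ S \ X, (b, a) ∉ E).card ≤ kap k S E := by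
  refine (Finset.card_le_card_shatterer _).trans (Finset.card_le_card ?_)
  intro D hD
  rw [Finset.mem_shatterer] at hD
  have hDS : D ⊆ S := by
    obtain ⟨u, hu, h⟩ := hD (Finset.Subset.refl D)
    rw [Finset.inter_eq_left] at h
    exact h.trans (Finset.mem_powerset.1 (Finset.mem_filter.1 hu).1)
  rw [Finset.mem_filter, Finset.mem_powerset]
  refine ⟨hDS, fun u hu v hv A hA => ?_⟩
  obtain ⟨X, hX, h⟩ := hD (t := {v}) (by simpa using hv)
  simp only [Finset.mem_filter, Finset.mem_powerset] at hX
  have hmem : ∀ a ∈ D, (a ∈ X ↔ a = v) := by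
    intro a ha
    have := congrArg (a ∈ ·) h
    simpa [ha] using this
  refine hA.notMem_of_cut (X := X) ?_ ?_ ((hmem v hv).2 rfl)
  · intro a b hab ha hb
    have := Finset.mem_offDiag.1 (hE hab)
    exact hX.2 b hb a (Finset.mem_sdiff.2 ⟨this.1, ha⟩) hab
  · rw [hmem u hu]
    exact hA.ne (by omega)

end Cliques

section Cuts

variable {N : ℕ}

/-- Summing over one-way cuts. -/
theorem sum_glue_le_sum_kap {k : ℕ} [NeZero k] (hk : 3 ≤ k) (S : Finset (Fin N))
    (𝒳 : Finset (Finset (Fin N))) (h𝒳 : 𝒳 ⊆ S.powerset) :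
    ∑ X ∈ 𝒳, 2 ^ (X.card * (S \ X).card) *
        ((freeOn k X).card * (freeOn k (S \ X)).card) ≤ ∑ E ∈ freeOn k S, kap k S E := by
  calc _ ≤ ∑ X ∈ 𝒳, ((freeOn k S).filter fun E => ∀ a ∈ X, ∀ b ∈ S \ X, (b, a) ∉ E).card := by
        refine Finset.sum_le_sum fun X hX => ?_
        have hXS := Finset.mem_powerset.1 (h𝒳 hX)
        have := card_mul_le_card_zeroCut (k := k) (X := X) (Y := S \ X) Finset.disjoint_sdiff
        rwa [zeroCut, Finset.union_sdiff_of_subset hXS] at this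
    _ = ∑ E ∈ freeOn k S, (𝒳.filter fun X => ∀ a ∈ X, ∀ b ∈ S \ X, (b, a) ∉ E).card :=
        Finset.sum_card_bipartiteAbove_eq_sum_card_bipartiteBelow _
    _ ≤ _ := by
        refine Finset.sum_le_sum fun E hE => ?_
        refine le_trans (Finset.card_le_card ?_) (card_cuts_le_kap hk (mem_freeOn.1 hE).1)
        exact Finset.filter_subset_filter _ h𝒳

end Cuts

section Levels

theorem exists_indep_of_outdegree_le {α : Type*} [DecidableEq α] (m : ℕ)
    (P : α → Finset α) (T : Finset α) (hP : ∀ w ∈ T, (P w).card ≤ m) :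
    ∃ W ⊆ T, (∀ w ∈ W, ∀ w' ∈ W, w ≠ w' → w' ∉ P w) ∧ T.card ≤ (2 * m + 1) * W.card := by
  induction h : T.card using Nat.strong_induction_on generalizing T with
  | _ n ih =>
    rcases T.eq_empty_or_nonempty with rfl | hne
    · exact ⟨∅, by simp, by simp, by simp [← h]⟩
    -- a vertex of small in-degree
    have hv : ∃ v ∈ T, (T.filter fun w => v ∈ P w).card ≤ m := by
      by_contra! hcon
      have h1 : ∑ v ∈ T, (T.filter fun w => v ∈ P w).card
          = ∑ w ∈ T, (T.filter fun v => v ∈ P w).card :=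
        Finset.sum_card_bipartiteAbove_eq_sum_card_bipartiteBelow _
      have h2 : ∑ w ∈ T, (T.filter fun v => v ∈ P w).card ≤ T.card * m := by
        rw [← smul_eq_mul]
        refine Finset.sum_le_card_nsmul _ _ _ fun w hw => le_trans ?_ (hP w hw)
        exact Finset.card_le_card fun v hv => (Finset.mem_filter.1 hv).2
      have h3 : T.card * (m + 1) ≤ ∑ v ∈ T, (T.filter fun w => v ∈ P w).card := by
        rw [← smul_eq_mul]
        exact Finset.card_nsmul_le_sum _ _ _ fun v hv => hcon v hv
      have := Finset.card_pos.2 hne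
      nlinarith
    obtain ⟨v, hvT, hv⟩ := hv
    set R := insert v (P v ∪ T.filter fun w => v ∈ P w) with hR
    have hRc : R.card ≤ 2 * m + 1 := by
      have h1 := Finset.card_insert_le v (P v ∪ T.filter fun w => v ∈ P w)
      have h2 := Finset.card_union_le (P v) (T.filter fun w => v ∈ P w)
      have h3 := hP v hvT
      rw [← hR] at h1
      omega
    have hlt : (T \ R).card < n := by
      rw [← h]
      apply Finset.card_lt_card
      refine ⟨Finset.sdiff_subset, fun hs => ?_⟩
      have := hs hvT
      simp [hR] at this
    obtain ⟨W, hW1, hW2, hW3⟩ := ih _ hlt (T \ R)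
      (fun w hw => hP w (Finset.mem_sdiff.1 hw).1) rfl
    have hvW : v ∉ W := fun h => by
      have := hW1 h
      simp [hR] at this
    refine ⟨insert v W, Finset.insert_subset hvT (hW1.trans Finset.sdiff_subset), ?_, ?_⟩
    · intro w hw w' hw' hne hP'
      rw [Finset.mem_insert] at hw hw'
      rcases hw with rfl | hw <;> rcases hw' with rfl | hw'
      · exact hne rfl
      · have := (Finset.mem_sdiff.1 (hW1 hw')).2
        simp [hR, hP'] at this
      · have := Finset.mem_sdiff.1 (hW1 hw)
        simp [hR, hP', this.1] at this
      · exact hW2 w hw w' hw' hne hP'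
    · rw [Finset.card_insert_of_notMem hvW, mul_add, mul_one]
      have := Finset.le_card_sdiff R T
      omega

theorem exists_level_indep {α : Type*} [DecidableEq α] (m l : ℕ)
    (L : α → ℕ) (P : α → Finset α) (T : Finset α) (hL : ∀ w ∈ T, L w < l)
    (hP : ∀ w ∈ T, (P w).card ≤ m) :
    ∃ W ⊆ T, (∀ w ∈ W, ∀ w' ∈ W, L w = L w') ∧
      (∀ w ∈ W, ∀ w' ∈ W, w ≠ w' → w' ∉ P w) ∧ T.card ≤ l * (2 * m + 1) * W.card := by
  rcases T.eq_empty_or_nonempty with rfl | hne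
  · exact ⟨∅, by simp, by simp, by simp, by simp⟩
  have : ∃ t ∈ Finset.range l, T.card ≤ l * (T.filter fun w => L w = t).card := by
    by_contra! hcon
    have h1 : T.card = ∑ t ∈ Finset.range l, (T.filter fun w => L w = t).card :=
      Finset.card_eq_sum_card_fiberwise fun w hw => by simpa using hL w hw
    obtain ⟨w, hw⟩ := hne
    have hl : 0 < l := lt_of_le_of_lt (Nat.zero_le _) (hL w hw)
    have h2 : ∑ t ∈ Finset.range l, l * (T.filter fun w => L w = t).card
        < ∑ t ∈ Finset.range l, T.card :=
      Finset.sum_lt_sum_of_nonempty (by simpa using hl.ne') hcon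
    rw [← Finset.mul_sum, ← h1] at h2
    simp at h2
  obtain ⟨t, -, ht⟩ := this
  obtain ⟨W, h1, h2, h3⟩ := exists_indep_of_outdegree_le m P (T.filter fun w => L w = t)
    fun w hw => hP w (Finset.mem_filter.1 hw).1
  refine ⟨W, h1.trans (Finset.filter_subset _ _), ?_, h2, ?_⟩
  · intro w hw w' hw'
    rw [(Finset.mem_filter.1 (h1 hw)).2, (Finset.mem_filter.1 (h1 hw')).2]
  · calc T.card ≤ l * (T.filter fun w => L w = t).card := ht
      _ ≤ l * ((2 * m + 1) * W.card) := Nat.mul_le_mul_left _ h3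
      _ = _ := by ring

variable {N : ℕ}

/-- No arcs inside `W`. -/
def Indep (E : ArcSet N) (W : Finset (Fin N)) : Prop :=
  ∀ a ∈ W, ∀ b ∈ W, (a, b) ∉ E

/-- No directed path with two arcs between distinct vertices of `W`. -/
def NoCherry (E : ArcSet N) (W : Finset (Fin N)) : Prop :=
  ∀ a ∈ W, ∀ b ∈ W, a ≠ b → ∀ z, (a, z) ∈ E → (z, b) ∉ E

/-- A common form of the two extractions: from a set `T` such that no path with `r * l` arcs
joins two of its elements, select a large subset all of whose members are ends of paths of the
same length, each path avoiding the other selected vertices. -/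
theorem exists_path_level {E : ArcSet N} {T : Finset (Fin N)} (r l : ℕ) (hl : 1 ≤ l)
    (h : ∀ u ∈ T, ∀ v ∈ T, ∀ A, ¬ Pth E (r * l) u v A) :
    ∃ W ⊆ T, ∃ P : Fin N → Finset (Fin N), T.card ≤ l * (2 * (r * l) + 1) * W.card ∧
      (∀ w ∈ W, (P w).card ≤ r * l) ∧ (∀ w ∈ W, ∀ w' ∈ W, w ≠ w' → w' ∉ P w) ∧
      ∃ t, (∀ w ∈ W, ∃ x ∈ T, Pth E (r * t) x w (P w)) ∧
        ∀ w ∈ W, ∀ x ∈ T, ∀ A, ¬ Pth E (r * (t + 1)) x w A := by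
  have key : ∀ w ∈ T, ∃ t < l, (∃ x ∈ T, ∃ A, Pth E (r * t) x w A) ∧
      ∀ x ∈ T, ∀ A, ¬ Pth E (r * (t + 1)) x w A := by
    intro w hw
    have h0 : ∃ t, t < l ∧ ∃ x ∈ T, ∃ A, Pth E (r * t) x w A :=
      ⟨0, hl, w, hw, {w}, Pth.nil w⟩
    set Q : ℕ → Prop := fun t => t < l ∧ ∃ x ∈ T, ∃ A, Pth E (r * t) x w A
    have h1 := Nat.findGreatest_spec (P := Q) (m := 0) (n := l) (Nat.zero_le _)
      ⟨hl, w, hw, {w}, Pth.nil w⟩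
    refine ⟨Nat.findGreatest Q l, h1.1, h1.2, fun x hx A hA => ?_⟩
    rcases Nat.lt_or_ge (Nat.findGreatest Q l + 1) l with h2 | h2
    · have := Nat.le_findGreatest (P := Q) (n := l) h2.le ⟨h2, x, hx, A, hA⟩
      omega
    · have h3 : Nat.findGreatest Q l + 1 = l := by have := h1.1; omega
      rw [h3] at hA
      exact h x hx w hw A hA
  choose! L hL hL1 hL2 using key
  choose! x hx P hP using hL1
  have hPc : ∀ w ∈ T, (P w).card ≤ r * l := by
    intro w hw
    have h1 := (hP w hw).card_eq
    rcases Nat.eq_zero_or_pos r with rfl | hr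
    · exact absurd (Pth.nil w) (by simpa using h w hw w hw {w})
    have : r * L w + r ≤ r * l := by
      rw [← Nat.mul_succ]
      exact Nat.mul_le_mul_left _ (hL w hw)
    omega
  obtain ⟨W, h1, h2, h3, h4⟩ := exists_level_indep (r * l) l L P T hL hPc
  refine ⟨W, h1, P, h4, fun w hw => hPc w (h1 hw), h3, ?_⟩
  rcases W.eq_empty_or_nonempty with rfl | ⟨w0, hw0⟩
  · exact ⟨0, by simp, by simp⟩
  · refine ⟨L w0, fun w hw => ⟨x w, hx w (h1 hw), ?_⟩, fun w hw => ?_⟩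
    · rw [h2 w0 hw0 w hw]
      exact hP w (h1 hw)
    · rw [h2 w0 hw0 w hw]
      exact hL2 w (h1 hw)

/-- An unlinked set contains a large independent set. -/
theorem NoLink.exists_indep {k : ℕ} (hk : 3 ≤ k) {E : ArcSet N} (hE : IsLoopless E)
    {T : Finset (Fin N)} (h : NoLink k E T) :
    ∃ W ⊆ T, Indep E W ∧ T.card ≤ k * (2 * k + 1) * W.card := by
  have h' : ∀ u ∈ T, ∀ v ∈ T, ∀ A, ¬ Pth E (1 * (k - 2)) u v A := by
    rw [one_mul]
    exact h
  obtain ⟨W, hW, P, hc, -, hP, t, h1, h2⟩ := exists_path_level 1 (k - 2) (by omega) h'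
  refine ⟨W, hW, ?_, hc.trans ?_⟩
  · intro a ha b hb hab
    have hne : a ≠ b := by
      rintro rfl
      exact hE _ hab
    obtain ⟨x, hx, hp⟩ := h1 a ha
    have := hp.snoc hab (hP a ha b hb hne)
    exact h2 b hb x hx _ (by simpa using this)
  · apply Nat.mul_le_mul_right
    exact Nat.mul_le_mul (by omega) (by omega)

/-- An independent unlinked set contains a large subset which becomes pure after the deletion
of few arcs. -/
theorem NoLink.exists_noCherry {k : ℕ} (hk : 4 ≤ k) (hke : Even k) {E : ArcSet N}
    {T : Finset (Fin N)} (h : NoLink k E T) (hT : Indep E T) :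
    ∃ W ⊆ T, T.card ≤ k * (2 * k + 1) * W.card ∧
      ∃ P : Fin N → Finset (Fin N), (∀ w ∈ W, (P w).card ≤ k) ∧
        ∀ a ∈ W, ∀ b ∈ W, a ≠ b → ∀ z ∉ P a, (a, z) ∈ E → (z, b) ∉ E := by
  obtain ⟨τ, hτ⟩ := hke
  have hτ' : k - 2 = 2 * (τ - 1) := by omega
  have h' : ∀ u ∈ T, ∀ v ∈ T, ∀ A, ¬ Pth E (2 * (τ - 1)) u v A := by
    rw [← hτ']
    exact h
  obtain ⟨W, hW, P, hc, hPc, hP, t, h1, h2⟩ := exists_path_level 2 (τ - 1) (by omega) h'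
  refine ⟨W, hW, hc.trans ?_, P, fun w hw => (hPc w hw).trans (by omega), ?_⟩
  · apply Nat.mul_le_mul_right
    exact Nat.mul_le_mul (by omega) (by omega)
  · intro a ha b hb hne z hz haz hzb
    obtain ⟨x, hx, hp⟩ := h1 a ha
    have hzb' : z ≠ b := by
      rintro rfl
      exact hT _ (hW ha) _ (hW hb) haz
    have hp' := (hp.snoc haz hz).snoc hzb (by
      simp only [Finset.mem_insert, not_or]
      exact ⟨hzb'.symm, hP a ha b hb hne⟩)
    exact h2 b hb x hx _ (by rwa [mul_add])

end Levels

section Typed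

variable {α τ : Type*} [Fintype α]

/-- Functions with values in `𝒯` on `V`, and constant `d` outside. -/
noncomputable def typings (𝒯 : Finset τ) (d : τ) (V : Finset α) : Finset (α → τ) :=
  Fintype.piFinset fun z => if z ∈ V then 𝒯 else {d}

/-- Typings together with a subset of `V` all of whose links join compatible types. -/
noncomputable def typedSets (𝒯 : Finset τ) (d : τ) (dj : τ → τ → Prop) (link : α → α → Prop)
    (V : Finset α) : Finset ((α → τ) × Finset α) :=
  (typings 𝒯 d V ×ˢ V.powerset).filter fun p =>
    ∀ z ∈ p.2, ∀ z' ∈ p.2, link z z' → dj (p.1 z) (p.1 z')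

theorem card_typings (𝒯 : Finset τ) (d : τ) (V : Finset α) :
    (typings 𝒯 d V).card = 𝒯.card ^ V.card := by
  rw [typings, Fintype.card_piFinset]
  have : ∀ z : α, (if z ∈ V then 𝒯 else {d}).card = if z ∈ V then 𝒯.card else 1 := by
    intro z; split_ifs <;> simp
  simp only [this, Finset.prod_ite_mem, Finset.univ_inter, Finset.prod_const]

theorem mem_typings {𝒯 : Finset τ} {d : τ} {V : Finset α} {t : α → τ} :
    t ∈ typings 𝒯 d V ↔ ∀ z, (z ∈ V → t z ∈ 𝒯) ∧ (z ∉ V → t z = d) := by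
  simp only [typings, Fintype.mem_piFinset]
  refine forall_congr' fun z => ?_
  split_ifs with h <;> simp [h]

theorem card_typedSets_le (𝒯 : Finset τ) (d : τ) (dj : τ → τ → Prop) (link : α → α → Prop)
    (hirr : ∀ z, ¬ link z z) (n : ℕ)
    (hn : 2 * n ^ 2 * ((𝒯 ×ˢ 𝒯).filter fun p => dj p.1 p.2).card ≤ 𝒯.card ^ 2) (V : Finset α)
    (hV : V.card ≤ n) :
    (typedSets 𝒯 d dj link V).card ≤ 2 * 𝒯.card ^ V.card *
      (V.powerset.filter fun D => ∀ z ∈ D, ∀ z' ∈ D, ¬ link z z').card := by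
  set q := ((𝒯 ×ˢ 𝒯).filter fun p => dj p.1 p.2).card with hq
  induction h : V.card using Nat.strong_induction_on generalizing V with
  | _ m ih =>
    set K := fun V : Finset α =>
      (V.powerset.filter fun D => ∀ z ∈ D, ∀ z' ∈ D, ¬ link z z').card with hK
    have hKm : ∀ V' ⊆ V, K V' ≤ K V := fun V' hV' => Finset.card_le_card
      (Finset.filter_subset_filter _ (Finset.powerset_mono.2 hV'))
    change _ ≤ 2 * 𝒯.card ^ m * K V
    set good := (typings 𝒯 d V) ×ˢ
      (V.powerset.filter fun D => ∀ z ∈ D, ∀ z' ∈ D, ¬ link z z') with hgood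
    set bad : α × α → Finset ((α → τ) × Finset α) := fun e =>
      (typedSets 𝒯 d dj link V).filter fun p => e.1 ∈ p.2 ∧ e.2 ∈ p.2 ∧ dj (p.1 e.1) (p.1 e.2)
      with hbad
    have hcover : typedSets 𝒯 d dj link V ⊆ good ∪ V.offDiag.biUnion bad := by
      intro p hp
      have hp' := hp
      simp only [typedSets, Finset.mem_filter, Finset.mem_product, Finset.mem_powerset] at hp
      rw [Finset.mem_union]
      by_cases hc : ∀ z ∈ p.2, ∀ z' ∈ p.2, ¬ link z z'
      · left
        simp only [hgood, Finset.mem_product, Finset.mem_filter, Finset.mem_powerset]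
        exact ⟨hp.1.1, hp.1.2, hc⟩
      · right
        push Not at hc
        obtain ⟨z, hz, z', hz', hl⟩ := hc
        rw [Finset.mem_biUnion]
        refine ⟨(z, z'), ?_, ?_⟩
        · rw [Finset.mem_offDiag]
          refine ⟨hp.1.2 hz, hp.1.2 hz', fun heq => hirr z ?_⟩
          rwa [← show z = z' from heq] at hl
        · simp only [hbad, Finset.mem_filter]
          exact ⟨hp', hz, hz', hp.2 z hz z' hz' hl⟩
    have hgc : good.card = 𝒯.card ^ m * K V := by
      rw [hgood, Finset.card_product, card_typings, h]
    have hbc : ∀ e ∈ V.offDiag, (bad e).card * (2 * n ^ 2) ≤ 2 * 𝒯.card ^ m * K V := by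
      rintro ⟨z, z'⟩ he
      rw [Finset.mem_offDiag] at he
      obtain ⟨hz, hz', hne⟩ := he
      have hsub : ({z, z'} : Finset α) ⊆ V := by
        intro a ha
        simp only [Finset.mem_insert, Finset.mem_singleton] at ha
        rcases ha with rfl | rfl <;> assumption
      have hcd : (V \ {z, z'}).card + 2 = m := by
        have h1 := Finset.card_sdiff_of_subset hsub
        have h2 := Finset.card_le_card hsub
        rw [Finset.card_pair hne] at h1 h2
        omega
      have hr := ih (V \ {z, z'}).card (by omega) (V \ {z, z'}) (by omega) rfl
      have hinj : (bad (z, z')).card ≤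
          ((((𝒯 ×ˢ 𝒯).filter fun p => dj p.1 p.2)) ×ˢ
            typedSets 𝒯 d dj link (V \ {z, z'})).card := by
        apply Finset.card_le_card_of_injOn fun p => ((p.1 z, p.1 z'),
          (fun a => if a = z ∨ a = z' then d else p.1 a, p.2 \ {z, z'}))
        · rintro ⟨t, D⟩ hp
          simp only [hbad, typedSets, Finset.mem_coe, Finset.mem_filter, Finset.mem_product,
            Finset.mem_powerset, mem_typings] at hp ⊢
          obtain ⟨⟨⟨ht, hD⟩, hl⟩, hzD, hzD', hdj⟩ := hp
          refine ⟨⟨⟨(ht z).1 hz, (ht z').1 hz'⟩, hdj⟩, ⟨?_, ?_⟩, ?_⟩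
          · intro a
            have := ht a
            simp only [Finset.mem_sdiff, Finset.mem_insert, Finset.mem_singleton]
            by_cases haz : a = z ∨ a = z'
            · simp [haz]
            · simpa [haz] using this
          · exact Finset.sdiff_subset_sdiff hD (Finset.Subset.refl _)
          · intro a ha b hb hab
            simp only [Finset.mem_sdiff, Finset.mem_insert, Finset.mem_singleton] at ha hb
            simpa [ha.2, hb.2] using hl a ha.1 b hb.1 hab
        · rintro ⟨t, D⟩ hp ⟨t', D'⟩ hp' heq
          simp only [hbad, Finset.coe_filter, Set.mem_ofPred_eq] at hp hp'
          simp only [Prod.mk.injEq] at heq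
          obtain ⟨⟨e1, e2⟩, e3, e4⟩ := heq
          refine Prod.ext ?_ ?_
          · funext a
            have := congrFun e3 a
            by_cases h1 : a = z
            · rw [h1]; exact e1
            by_cases h2 : a = z'
            · rw [h2]; exact e2
            simpa [h1, h2] using this
          · ext a
            have := congrArg (a ∈ ·) e4
            by_cases h1 : a = z
            · subst h1; simp [hp.2.1, hp'.2.1]
            by_cases h2 : a = z'
            · subst h2; simp [hp.2.2.1, hp'.2.2.1]
            simpa [h1, h2] using this
      rw [Finset.card_product, ← hq] at hinj
      calc (bad (z, z')).card * (2 * n ^ 2)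
          ≤ (q * (2 * 𝒯.card ^ (V \ {z, z'}).card * K (V \ {z, z'}))) * (2 * n ^ 2) := by
            refine Nat.mul_le_mul_right _ (hinj.trans (Nat.mul_le_mul_left _ hr))
        _ = (2 * n ^ 2 * q) * (2 * 𝒯.card ^ (V \ {z, z'}).card * K (V \ {z, z'})) := by ring
        _ ≤ 𝒯.card ^ 2 * (2 * 𝒯.card ^ (V \ {z, z'}).card * K V) := by
            refine Nat.mul_le_mul hn (Nat.mul_le_mul_left _ (hKm _ Finset.sdiff_subset))
        _ = 2 * 𝒯.card ^ m * K V := by rw [← hcd]; ring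
    have h1 : (typedSets 𝒯 d dj link V).card ≤ 𝒯.card ^ m * K V +
        ∑ e ∈ V.offDiag, (bad e).card := by
      rw [← hgc]
      refine (Finset.card_le_card hcover).trans ((Finset.card_union_le _ _).trans ?_)
      exact Nat.add_le_add_left Finset.card_biUnion_le _
    have h2 : (∑ e ∈ V.offDiag, (bad e).card) * (2 * n ^ 2) ≤
        n ^ 2 * (2 * 𝒯.card ^ m * K V) := by
      rw [Finset.sum_mul]
      refine (Finset.sum_le_card_nsmul _ _ _ hbc).trans ?_
      rw [smul_eq_mul]
      apply Nat.mul_le_mul_right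
      rw [Finset.offDiag_card, sq]
      exact (Nat.sub_le _ _).trans (Nat.mul_le_mul hV hV)
    rcases Nat.eq_zero_or_pos n with hn0 | hn0
    · have : V = ∅ := by
        rw [← Finset.card_eq_zero]; omega
      subst this
      simp only [Finset.offDiag_empty, Finset.sum_empty] at h1
      linarith
    · have h3 : (∑ e ∈ V.offDiag, (bad e).card) ≤ 𝒯.card ^ m * K V := by
        have : 0 < n ^ 2 := by positivity
        nlinarith
      linarith

end Typed

section Cherries

variable {N : ℕ}

/-- Possible pairs (neighbours in `W`, twofold neighbours in `W`). -/
noncomputable def cherryTypes (W : Finset (Fin N)) : Finset (Finset (Fin N) × Finset (Fin N)) :=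
  W.powerset.image (fun U => (U, ∅)) ∪ W.image fun w => ({w}, {w})

theorem card_cherryTypes (W : Finset (Fin N)) :
    (cherryTypes W).card = 2 ^ W.card + W.card := by
  rw [cherryTypes, Finset.card_union_of_disjoint, Finset.card_image_of_injective,
    Finset.card_image_of_injective, Finset.card_powerset]
  · intro a b h
    simpa using h
  · intro a b h
    simpa using h
  · rw [Finset.disjoint_left]
    intro a h1 h2
    simp only [Finset.mem_image] at h1 h2
    obtain ⟨U, -, rfl⟩ := h1
    obtain ⟨w, -, h⟩ := h2
    simp at h

/-- The sets of single neighbours are disjoint. -/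
def DisjTypes (t t' : Finset (Fin N) × Finset (Fin N)) : Prop :=
  Disjoint (t.1 \ t.2) (t'.1 \ t'.2)

theorem card_disjoint_pairs (W : Finset (Fin N)) :
    ((W.powerset ×ˢ W.powerset).filter fun p => Disjoint p.1 p.2).card = 3 ^ W.card := by
  have h := Finset.sum_pow_mul_eq_add_pow (1 : ℕ) 2 W
  rw [show (1 + 2 : ℕ) = 3 by norm_num] at h
  rw [← h, Finset.card_filter, Finset.sum_product]
  refine Finset.sum_congr rfl fun A hA => ?_
  rw [← Finset.card_filter, one_pow, one_mul,
    ← Finset.card_sdiff_of_subset (Finset.mem_powerset.1 hA), ← Finset.card_powerset]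
  congr 1
  ext B
  simp only [Finset.mem_filter, Finset.mem_powerset, Finset.subset_sdiff, disjoint_comm]

theorem card_disjTypes_le (W : Finset (Fin N)) :
    ((cherryTypes W ×ˢ cherryTypes W).filter fun p => DisjTypes p.1 p.2).card ≤
      3 ^ W.card + 2 * W.card * (cherryTypes W).card := by
  set A := W.powerset.image (fun U => (U, (∅ : Finset (Fin N)))) with hA
  set B := W.image fun w => (({w}, {w}) : Finset (Fin N) × Finset (Fin N)) with hB
  have hT : cherryTypes W = A ∪ B := rfl
  have hBc : B.card ≤ W.card := Finset.card_image_le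
  have hcover : ((cherryTypes W ×ˢ cherryTypes W).filter fun p => DisjTypes p.1 p.2) ⊆
      ((A ×ˢ A).filter fun p => DisjTypes p.1 p.2) ∪
        (B ×ˢ cherryTypes W ∪ cherryTypes W ×ˢ B) := by
    intro p
    simp only [Finset.mem_filter, Finset.mem_union, Finset.mem_product, hT]
    tauto
  have h1 : ((A ×ˢ A).filter fun p => DisjTypes p.1 p.2).card ≤ 3 ^ W.card := by
    rw [← card_disjoint_pairs]
    apply Finset.card_le_card_of_injOn fun p => (p.1.1, p.2.1)
    · rintro ⟨⟨a, a'⟩, ⟨b, b'⟩⟩ h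
      simp only [hA, Finset.coe_filter, Finset.mem_product, Finset.mem_image, Prod.mk.injEq,
        Set.mem_ofPred_eq, Finset.mem_powerset, DisjTypes] at h ⊢
      obtain ⟨⟨⟨x, hx, rfl, rfl⟩, ⟨y, hy, rfl, rfl⟩⟩, h⟩ := h
      simp only [Finset.sdiff_empty] at h
      exact ⟨⟨hx, hy⟩, h⟩
    · rintro ⟨⟨a, a'⟩, ⟨b, b'⟩⟩ h ⟨⟨c, c'⟩, ⟨e, e'⟩⟩ h' heq
      simp only [hA, Finset.coe_filter, Finset.mem_product, Finset.mem_image, Prod.mk.injEq,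
        Set.mem_ofPred_eq] at h h' heq
      obtain ⟨⟨⟨x, hx, rfl, rfl⟩, ⟨y, hy, rfl, rfl⟩⟩, -⟩ := h
      obtain ⟨⟨⟨x', hx', rfl, rfl⟩, ⟨y', hy', rfl, rfl⟩⟩, -⟩ := h'
      simp [heq.1, heq.2]
  have h2 := Finset.card_le_card hcover
  have h3 := Finset.card_union_le ((A ×ˢ A).filter fun p => DisjTypes p.1 p.2)
    (B ×ˢ cherryTypes W ∪ cherryTypes W ×ˢ B)
  have h4 := Finset.card_union_le (B ×ˢ cherryTypes W) (cherryTypes W ×ˢ B)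
  rw [Finset.card_product, Finset.card_product] at h4
  have h5 := Nat.mul_le_mul_right (cherryTypes W).card hBc
  nlinarith

/-- The type of `z` with respect to `W`. -/
noncomputable def cherryType (W V : Finset (Fin N)) (E : ArcSet N) (z : Fin N) :
    Finset (Fin N) × Finset (Fin N) :=
  if z ∈ V then (W.filter fun a => (a, z) ∈ E ∨ (z, a) ∈ E,
    W.filter fun a => (a, z) ∈ E ∧ (z, a) ∈ E) else (∅, ∅)

theorem cherryType_mem {W V : Finset (Fin N)} {E : ArcSet N} (h : NoCherry E W) :
    cherryType W V E ∈ typings (cherryTypes W) (∅, ∅) V := by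
  rw [mem_typings]
  intro z
  refine ⟨fun hz => ?_, fun hz => by simp [cherryType, hz]⟩
  simp only [cherryType, hz, if_true, cherryTypes, Finset.mem_union, Finset.mem_image,
    Finset.mem_powerset, Prod.mk.injEq]
  by_cases hI : ∃ w ∈ W, (w, z) ∈ E ∧ (z, w) ∈ E
  · right
    obtain ⟨w, hw, h1, h2⟩ := hI
    have key : ∀ a ∈ W, ((a, z) ∈ E ∨ (z, a) ∈ E) → a = w := by
      rintro a ha (h3 | h3)
      · by_contra hne
        exact h a ha w hw hne z h3 h2
      · by_contra hne
        exact h w hw a ha (Ne.symm hne) z h1 h3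
    refine ⟨w, hw, ?_, ?_⟩
    · ext a
      simp only [Finset.mem_singleton, Finset.mem_filter]
      constructor
      · rintro rfl; exact ⟨hw, Or.inl h1⟩
      · rintro ⟨ha, h'⟩; exact key a ha h'
    · ext a
      simp only [Finset.mem_singleton, Finset.mem_filter]
      constructor
      · rintro rfl; exact ⟨hw, h1, h2⟩
      · rintro ⟨ha, h'⟩; exact key a ha (Or.inl h'.1)
  · left
    refine ⟨_, Finset.filter_subset _ _, rfl, ?_⟩
    symm
    rw [Finset.filter_eq_empty_iff]
    intro a ha h'
    exact hI ⟨a, ha, h'⟩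

/-- The digraphs in which `W` is independent and cherry-free. -/
noncomputable def cherryFree (k : ℕ) (S W : Finset (Fin N)) : Finset (ArcSet N) :=
  (freeOn k S).filter fun E => Indep E W ∧ NoCherry E W

theorem card_cherryFree_fiber_le {k : ℕ} (hk : 3 ≤ k) {S W : Finset (Fin N)}
    (H : ArcSet N) (t : Fin N → Finset (Fin N) × Finset (Fin N)) :
    ((cherryFree k S W).filter fun E => rst E (S \ W) = H ∧ cherryType W (S \ W) E = t).card ≤
      ((S \ W).powerset.filter fun D => ∀ z ∈ D, ∀ z' ∈ D,
        (∃ A, Pth H (k - 2) z z' A) → DisjTypes (t z) (t z')).card := by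
  set V := S \ W with hV
  set 𝒢 := (cherryFree k S W).filter fun E => rst E V = H ∧ cherryType W V E = t with h𝒢
  have hm : ∀ E ∈ 𝒢, E ∈ freeOn k S ∧ Indep E W ∧ NoCherry E W ∧ rst E V = H ∧
      ∀ z ∈ V, ((∀ a ∈ W, (a ∈ (t z).1 ↔ (a, z) ∈ E ∨ (z, a) ∈ E)) ∧
        (∀ a ∈ W, (a ∈ (t z).2 ↔ (a, z) ∈ E ∧ (z, a) ∈ E)) ∧ (t z).1 ⊆ W) := by
    intro E hE
    simp only [h𝒢, cherryFree, Finset.mem_filter] at hE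
    obtain ⟨⟨h1, h2, h3⟩, h4, rfl⟩ := hE
    refine ⟨h1, h2, h3, h4, fun z hz => ?_⟩
    simp only [cherryType, hz, if_true, Finset.mem_filter]
    exact ⟨fun a ha => by simp [ha], fun a ha => by simp [ha], Finset.filter_subset _ _⟩
  set side : ArcSet N → Finset (Fin N) := fun E => V.filter fun z => ∃ w ∈ W, (z, w) ∈ E
  -- away from two-way arcs, the side of `z` determines its arcs
  have hside : ∀ E ∈ 𝒢, ∀ z ∈ V, ∀ w ∈ W, w ∈ (t z).1 → w ∉ (t z).2 →
      ((z ∈ side E → (z, w) ∈ E ∧ (w, z) ∉ E) ∧ (z ∉ side E → (w, z) ∈ E ∧ (z, w) ∉ E)) := by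
    intro E hE z hz w hw h1 h2
    obtain ⟨-, -, hP, -, ht⟩ := hm E hE
    obtain ⟨t1, t2, -⟩ := ht z hz
    rw [t1 w hw] at h1
    rw [t2 w hw] at h2
    simp only [side, Finset.mem_filter, hz, true_and]
    refine ⟨?_, fun h => ?_⟩
    · rintro ⟨w', hw', h'⟩
      have : (w, z) ∉ E := by
        intro h3
        by_cases hne : w = w'
        · subst hne; exact h2 ⟨h3, h'⟩
        · exact hP w hw w' hw' hne z h3 h'
      tauto
    · have : (z, w) ∉ E := fun h3 => h ⟨w, hw, h3⟩
      tauto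
  have harc : ∀ E ∈ 𝒢, ∀ E' ∈ 𝒢, side E = side E' → E ⊆ E' := by
    rintro E hE E' hE' hs ⟨a, b⟩ hab
    obtain ⟨h1, h2, h3, h4, h5⟩ := hm E hE
    obtain ⟨h1', h2', h3', h4', h5'⟩ := hm E' hE'
    have hS := freeOn_ne_of_mem h1 hab
    have hcross : ∀ z ∈ V, ∀ w ∈ W, ((z, w) ∈ E → (z, w) ∈ E') ∧ ((w, z) ∈ E → (w, z) ∈ E') := by
      intro z hz w hw
      have t1 := (h5 z hz).1 w hw
      have t2 := (h5 z hz).2.1 w hw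
      have t1' := (h5' z hz).1 w hw
      have t2' := (h5' z hz).2.1 w hw
      have s1 := hside E hE z hz w hw
      have s2 := hside E' hE' z hz w hw
      rw [← hs] at s2
      by_cases w1 : w ∈ (t z).1
      · by_cases w2 : w ∈ (t z).2
        · have := t2'.1 w2
          exact ⟨fun _ => this.2, fun _ => this.1⟩
        · have r1 := s1 w1 w2
          have r2 := s2 w1 w2
          by_cases hzs : z ∈ side E
          · exact ⟨fun _ => (r2.1 hzs).1, fun h => absurd h (r1.1 hzs).2⟩
          · exact ⟨fun h => absurd h (r1.2 hzs).2, fun _ => (r2.2 hzs).1⟩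
      · exact ⟨fun h => absurd (t1.2 (Or.inr h)) w1, fun h => absurd (t1.2 (Or.inl h)) w1⟩
    by_cases ha : a ∈ W <;> by_cases hb : b ∈ W
    · exact absurd hab (h2 a ha b hb)
    · exact (hcross b (Finset.mem_sdiff.2 ⟨hS.2.1, hb⟩) a ha).2 hab
    · exact (hcross a (Finset.mem_sdiff.2 ⟨hS.1, ha⟩) b hb).1 hab
    · have : (a, b) ∈ rst E V := mem_rst.2
        ⟨hab, Finset.mem_sdiff.2 ⟨hS.1, ha⟩, Finset.mem_sdiff.2 ⟨hS.2.1, hb⟩⟩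
      rw [h4, ← h4'] at this
      exact (mem_rst.1 this).1
  have hinj : Set.InjOn side 𝒢 := fun E hE E' hE' h =>
    Finset.Subset.antisymm (harc E hE E' hE' h) (harc E' hE' E hE h.symm)
  rw [← Finset.card_image_of_injOn hinj]
  refine (Finset.card_le_card_shatterer _).trans (Finset.card_le_card ?_)
  intro D hD
  rw [Finset.mem_shatterer] at hD
  have hDV : D ⊆ V := by
    obtain ⟨u, hu, h⟩ := hD (Finset.Subset.refl D)
    obtain ⟨E, -, rfl⟩ := Finset.mem_image.1 hu
    rw [Finset.inter_eq_left] at h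
    exact h.trans (Finset.filter_subset _ _)
  rw [Finset.mem_filter, Finset.mem_powerset]
  refine ⟨hDV, ?_⟩
  rintro z hz z' hz' ⟨A, hA⟩
  rw [DisjTypes, Finset.disjoint_left]
  intro w h1 h2
  rw [Finset.mem_sdiff] at h1 h2
  obtain ⟨u, hu, h⟩ := hD (t := {z'}) (by simpa using hz')
  obtain ⟨E, hE, rfl⟩ := Finset.mem_image.1 hu
  have hmem : ∀ a ∈ D, (a ∈ side E ↔ a = z') := by
    intro a ha
    have := congrArg (a ∈ ·) h
    simpa [ha] using this
  obtain ⟨hE1, -, -, hE4, hE5⟩ := hm E hE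
  have hw : w ∈ W := (hE5 z (hDV hz)).2.2 h1.1
  have hne := hA.ne (by omega)
  have a1 := (hside E hE z (hDV hz) w hw h1.1 h1.2).2 (by rw [hmem z hz]; exact hne)
  have a2 := (hside E hE z' (hDV hz') w hw h2.1 h2.2).1 ((hmem z' hz').2 rfl)
  have hHV : H ⊆ V.offDiag := by
    have := rst_mem_freeOn (X := V) hE1
    rw [hE4] at this
    exact (mem_freeOn.1 this).1
  have hwA : w ∉ A := fun h => by
    have := hA.subset (by omega) hHV h
    simp [hV, hw] at this
  have hp := Pth.cons a1.1 hwA (hA.mono (hE4 ▸ rst_subset E V))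
  exact (mem_freeOn.1 hE1).2.no_closed (by omega) (by omega) hp a2.1

theorem card_cherryFree_le {k : ℕ} (hk : 3 ≤ k) {S W : Finset (Fin N)}
    (hn : 2 * S.card ^ 2 * (3 ^ W.card + 2 * W.card * (2 ^ W.card + W.card)) ≤
      (2 ^ W.card + W.card) ^ 2) :
    (cherryFree k S W).card ≤ 2 * (2 ^ W.card + W.card) ^ (S \ W).card *
      ∑ H ∈ freeOn k (S \ W), kap k (S \ W) H := by
  set V := S \ W with hV
  have h1 : (cherryFree k S W).card = ∑ p ∈ freeOn k V ×ˢ typings (cherryTypes W) (∅, ∅) V,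
      ((cherryFree k S W).filter fun E => (rst E V, cherryType W V E) = p).card := by
    refine Finset.card_eq_sum_card_fiberwise fun E hE => ?_
    simp only [cherryFree, Finset.coe_filter, Set.mem_ofPred_eq] at hE
    rw [Finset.mem_coe, Finset.mem_product]
    exact ⟨rst_mem_freeOn hE.1, cherryType_mem hE.2.2⟩
  rw [h1, Finset.sum_product, Finset.mul_sum]
  refine Finset.sum_le_sum fun H _ => ?_
  have h2 := card_typedSets_le (cherryTypes W) (∅, ∅) DisjTypes
    (fun z z' => ∃ A, Pth H (k - 2) z z' A)
    (fun z => by rintro ⟨A, hA⟩; exact hA.ne (by omega) rfl) S.card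
    (by
      refine le_trans (Nat.mul_le_mul_left _ (card_disjTypes_le W)) ?_
      rw [card_cherryTypes]
      exact hn) V (Finset.card_le_card Finset.sdiff_subset)
  rw [card_cherryTypes] at h2
  refine le_trans ?_ (h2.trans (Nat.mul_le_mul_left _ (Finset.card_le_card ?_)))
  · rw [typedSets, Finset.card_filter, Finset.sum_product]
    refine Finset.sum_le_sum fun t _ => ?_
    simp only [Prod.mk.injEq]
    refine (card_cherryFree_fiber_le hk H t).trans (le_of_eq ?_)
    convert Finset.card_filter _ _
  · intro D hD
    simp only [Finset.mem_filter] at hD ⊢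
    refine ⟨hD.1, fun u hu v hv A hA => hD.2 u hu v hv ⟨A, hA⟩⟩

end Cherries

section Numeric

theorem pow_add_le_four_mul {b w m : ℕ} (hb : 0 < b) (h : w * m ≤ b) :
    (b + w) ^ m ≤ 4 * b ^ m := by
  have hb' : (0 : ℝ) < b := by exact_mod_cast hb
  have h1 : (1 + (w : ℝ) / b) ^ m ≤ 4 := by
    calc (1 + (w : ℝ) / b) ^ m ≤ (Real.exp (w / b)) ^ m := by
          gcongr
          rw [add_comm]
          exact Real.add_one_le_exp _
      _ = Real.exp (m * (w / b)) := by rw [← Real.exp_nat_mul]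
      _ ≤ Real.exp 1 := by
          apply Real.exp_le_exp.2
          rw [← mul_div_assoc, div_le_one hb']
          rw [mul_comm]
          exact_mod_cast h
      _ ≤ 4 := by have := Real.exp_one_lt_d9; linarith
  have h2 : ((b : ℝ) + w) ^ m ≤ 4 * (b : ℝ) ^ m := by
    have : (b : ℝ) + w = (1 + w / b) * b := by field_simp
    rw [this, mul_pow]
    gcongr
  exact_mod_cast h2

theorem mul_two_pow_le_three_pow (w : ℕ) : w * 2 ^ w ≤ 3 ^ w := by
  induction w with
  | zero => simp
  | succ w ih =>
    rcases Nat.lt_or_ge w 2 with h | h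
    · interval_cases w <;> norm_num
    · have : (w + 1) * 2 ≤ 3 * w := by omega
      calc (w + 1) * 2 ^ (w + 1) = ((w + 1) * 2) * 2 ^ w := by ring
        _ ≤ (3 * w) * 2 ^ w := Nat.mul_le_mul_right _ this
        _ = 3 * (w * 2 ^ w) := by ring
        _ ≤ 3 * 3 ^ w := Nat.mul_le_mul_left _ ih
        _ = _ := by ring

theorem two_mul_le_two_pow (a : ℕ) : 2 * a ≤ 2 ^ a := by
  induction a with
  | zero => simp
  | succ a ih =>
    rcases Nat.eq_zero_or_pos a with rfl | h
    · norm_num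
    · rw [pow_succ]; omega

theorem types_numeric {n L w : ℕ} (hL : n + 2 ≤ 2 ^ L) (hw : 12 * L ≤ w) :
    2 * n ^ 2 * (3 ^ w + 2 * w * (2 ^ w + w)) ≤ (2 ^ w + w) ^ 2 ∧ w * n ≤ 2 ^ w := by
  rcases Nat.eq_zero_or_pos n with rfl | hn
  · simp
  have hL2 : 2 ≤ L := by
    by_contra! h
    have : 2 ^ L ≤ 2 ^ 1 := Nat.pow_le_pow_right (by norm_num) (by omega)
    omega
  constructor
  · have h1 : 3 ^ w + 2 * w * (2 ^ w + w) ≤ 5 * 3 ^ w := by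
      have e1 := mul_two_pow_le_three_pow w
      have e2 : w * w ≤ w * 2 ^ w := Nat.mul_le_mul_left _ Nat.lt_two_pow_self.le
      nlinarith
    have h2 : n ^ 2 ≤ 4 ^ L := by
      calc n ^ 2 ≤ (2 ^ L) ^ 2 := Nat.pow_le_pow_left (by omega) 2
        _ = 4 ^ L := by rw [← pow_mul, mul_comm, pow_mul]; norm_num
    have h3 : 16 ^ L * 3 ^ w ≤ 4 ^ w := by
      obtain ⟨d, rfl⟩ := Nat.exists_eq_add_of_le hw
      rw [pow_add, pow_add, ← mul_assoc]
      refine Nat.mul_le_mul ?_ (Nat.pow_le_pow_left (by norm_num) d)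
      rw [pow_mul, pow_mul, ← mul_pow]
      exact Nat.pow_le_pow_left (by norm_num) L
    have h4 : 10 * 4 ^ L ≤ 16 ^ L := by
      have : 4 ^ 2 ≤ 4 ^ L := Nat.pow_le_pow_right (by norm_num) hL2
      have e : 16 ^ L = 4 ^ L * 4 ^ L := by rw [← mul_pow]; norm_num
      rw [e]; nlinarith
    calc 2 * n ^ 2 * (3 ^ w + 2 * w * (2 ^ w + w)) ≤ 2 * 4 ^ L * (5 * 3 ^ w) := by gcongr
      _ = (10 * 4 ^ L) * 3 ^ w := by ring
      _ ≤ 16 ^ L * 3 ^ w := Nat.mul_le_mul_right _ h4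
      _ ≤ 4 ^ w := h3
      _ = (2 ^ w) ^ 2 := by rw [← pow_mul, mul_comm, pow_mul]; norm_num
      _ ≤ _ := Nat.pow_le_pow_left (by omega) 2
  · have h1 := two_mul_le_two_pow (w - L)
    calc w * n ≤ 2 ^ (w - L) * 2 ^ L := Nat.mul_le_mul (by omega) (by omega)
      _ = 2 ^ w := by rw [← pow_add]; congr 1; omega

theorem card_small_subsets_le {α : Type*} [DecidableEq α] (A : Finset α) (m : ℕ) :
    (A.powerset.filter fun T => T.card ≤ m).card ≤ (A.card + 1) ^ m := by
  induction m with
  | zero =>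
    rw [pow_zero, Finset.card_le_one]
    intro a ha b hb
    simp only [Finset.mem_filter, Nat.le_zero, Finset.card_eq_zero] at ha hb
    rw [ha.2, hb.2]
  | succ m ih =>
    set Q := A.powerset.filter fun T => T.card ≤ m with hQ
    have hsub : (A.powerset.filter fun T => T.card ≤ m + 1) ⊆
        Q ∪ (A ×ˢ Q).image fun p => insert p.1 p.2 := by
      intro T hT
      simp only [Finset.mem_filter, Finset.mem_powerset] at hT
      rcases T.eq_empty_or_nonempty with rfl | ⟨a, ha⟩
      · simp [hQ]
      · rw [Finset.mem_union]
        right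
        rw [Finset.mem_image]
        refine ⟨(a, T.erase a), ?_, Finset.insert_erase ha⟩
        simp only [hQ, Finset.mem_product, Finset.mem_filter, Finset.mem_powerset]
        refine ⟨hT.1 ha, (Finset.erase_subset _ _).trans hT.1, ?_⟩
        rw [Finset.card_erase_of_mem ha]
        omega
    refine (Finset.card_le_card hsub).trans ((Finset.card_union_le _ _).trans ?_)
    have h1 : ((A ×ˢ Q).image fun p => insert p.1 p.2).card ≤ A.card * Q.card :=
      Finset.card_image_le.trans (Finset.card_product _ _).le
    rw [pow_succ]
    nlinarith

end Numeric

section Moments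

variable {N : ℕ}

theorem kap_le_pow {k : ℕ} {S : Finset (Fin N)} {E : ArcSet N} {m : ℕ}
    (h : ∀ T ⊆ S, NoLink k E T → T.card ≤ m) : kap k S E ≤ (S.card + 1) ^ m := by
  refine le_trans (Finset.card_le_card ?_) (card_small_subsets_le S m)
  intro T hT
  simp only [Finset.mem_filter, Finset.mem_powerset] at hT ⊢
  exact ⟨hT.1, h T hT.1 hT.2⟩

/-- Digraphs with an unlinked set of size at least `m`. -/
noncomputable def bigUnlinked (k : ℕ) (S : Finset (Fin N)) (m : ℕ) : Finset (ArcSet N) :=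
  (freeOn k S).filter fun E => ∃ T ⊆ S, NoLink k E T ∧ m ≤ T.card

theorem bigUnlinked_subset {k : ℕ} (hk : 4 ≤ k) (hke : Even k) (S : Finset (Fin N)) (w : ℕ) :
    bigUnlinked k S ((k * (2 * k + 1)) ^ 2 * w) ⊆ (S.powersetCard w).biUnion fun W =>
      (S.offDiag.powerset.filter fun X => X.card ≤ k * w).biUnion fun X =>
        (cherryFree k S W).image fun E => E ∪ X := by
  intro E hE
  simp only [bigUnlinked, Finset.mem_filter] at hE
  obtain ⟨hE, T, hTS, hT, hTc⟩ := hE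
  have hloop : IsLoopless E := fun v hv => (freeOn_ne_of_mem hE hv).2.2 rfl
  obtain ⟨I, hIT, hI, hIc⟩ := hT.exists_indep (by omega) hloop
  obtain ⟨W, hWI, hWc, P, hPc, hP⟩ := (hT.subset hIT).exists_noCherry hk hke hI
  set a := k * (2 * k + 1) with ha
  have hpos : 0 < a ^ 2 := by positivity
  have hwW : w ≤ W.card := by
    have : a ^ 2 * w ≤ a ^ 2 * W.card := by
      calc a ^ 2 * w ≤ T.card := hTc
        _ ≤ a * I.card := hIc
        _ ≤ a * (a * W.card) := Nat.mul_le_mul_left _ hWc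
        _ = _ := by ring
    exact Nat.le_of_mul_le_mul_left this hpos
  obtain ⟨W', hW', hW'c⟩ := Finset.exists_subset_card_eq hwW
  set X : ArcSet N := E.filter fun e => e.1 ∈ W' ∧ e.2 ∈ P e.1 with hX
  have hXE : X ⊆ E := Finset.filter_subset _ _
  have hXc : X.card ≤ k * w := by
    calc X.card ≤ (W'.biUnion fun a => (P a).image fun z => (a, z)).card := by
          apply Finset.card_le_card
          rintro ⟨u, z⟩ h
          simp only [hX, Finset.mem_filter] at h
          simp only [Finset.mem_biUnion, Finset.mem_image, Prod.mk.injEq]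
          exact ⟨u, h.2.1, z, h.2.2, rfl, rfl⟩
      _ ≤ ∑ a ∈ W', ((P a).image fun z => (a, z)).card := Finset.card_biUnion_le
      _ ≤ W'.card • k := Finset.sum_le_card_nsmul _ _ _ fun u hu =>
          Finset.card_image_le.trans (hPc u (hW' hu))
      _ = k * w := by rw [hW'c, smul_eq_mul, mul_comm]
  rw [Finset.mem_biUnion]
  refine ⟨W', Finset.mem_powersetCard.2 ⟨hW'.trans (hWI.trans (hIT.trans hTS)), hW'c⟩, ?_⟩
  rw [Finset.mem_biUnion]
  refine ⟨X, ?_, ?_⟩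
  · rw [Finset.mem_filter, Finset.mem_powerset]
    exact ⟨hXE.trans (mem_freeOn.1 hE).1, hXc⟩
  · rw [Finset.mem_image]
    refine ⟨E \ X, ?_, Finset.sdiff_union_of_subset hXE⟩
    simp only [cherryFree, Finset.mem_filter, mem_freeOn]
    refine ⟨⟨Finset.sdiff_subset.trans (mem_freeOn.1 hE).1,
      (mem_freeOn.1 hE).2.mono Finset.sdiff_subset⟩, ?_, ?_⟩
    · intro u hu v hv huv
      exact hI u (hWI (hW' hu)) v (hWI (hW' hv)) (Finset.mem_sdiff.1 huv).1
    · intro u hu v hv hne z huz hzv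
      rw [Finset.mem_sdiff] at huz hzv
      refine hP u (hW' hu) v (hW' hv) hne z (fun hz => huz.2 ?_) huz.1 hzv.1
      simp only [hX, Finset.mem_filter]
      exact ⟨huz.1, hu, hz⟩

theorem card_bigUnlinked_le {k : ℕ} (hk : 4 ≤ k) (hke : Even k) {S : Finset (Fin N)} {w L M : ℕ}
    (hL : S.card + 2 ≤ 2 ^ L) (hw : 12 * L ≤ w)
    (hM : ∀ W ⊆ S, W.card = w →
      ∑ H ∈ freeOn k (S \ W), kap k (S \ W) H ≤ (freeOn k (S \ W)).card * M) :
    (bigUnlinked k S ((k * (2 * k + 1)) ^ 2 * w)).card * 2 ^ (w.choose 2) ≤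
      (freeOn k S).card * (2 ^ (L * (2 * k + 1) * w + 3) * M) := by
  have hne : NeZero k := ⟨by omega⟩
  obtain ⟨hnum1, hnum2⟩ := types_numeric hL hw
  set f := (freeOn k S).card with hf
  have hpure : ∀ W ⊆ S, W.card = w →
      (cherryFree k S W).card * 2 ^ (w.choose 2) ≤ 8 * (f * M) := by
    intro W hW hWc
    have h1 := card_cherryFree_le (k := k) (by omega) (S := S) (W := W) (by rw [hWc]; exact hnum1)
    rw [hWc] at h1
    have hn' : (S \ W).card ≤ S.card := Finset.card_le_card Finset.sdiff_subset
    have h2 := pow_add_le_four_mul (b := 2 ^ w) (w := w) (m := (S \ W).card) (by positivity)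
      ((Nat.mul_le_mul_left _ hn').trans hnum2)
    have h3 := card_freeOn_glue (k := k) (X := W) (Y := S \ W) Finset.disjoint_sdiff
    rw [Finset.union_sdiff_of_subset hW, hWc] at h3
    have h4 := two_pow_choose_le_card_freeOn (k := k) W
    rw [hWc] at h4
    set n' := (S \ W).card
    set g := (freeOn k (S \ W)).card
    calc (cherryFree k S W).card * 2 ^ (w.choose 2)
        ≤ (2 * (4 * (2 ^ w) ^ n') * (g * M)) * 2 ^ (w.choose 2) := by
          refine Nat.mul_le_mul_right _ (h1.trans ?_)
          exact Nat.mul_le_mul (Nat.mul_le_mul_left _ h2) (hM W hW hWc)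
      _ = 8 * ((2 ^ (w * n') * (2 ^ (w.choose 2) * g)) * M) := by rw [pow_mul]; ring
      _ ≤ 8 * ((2 ^ (w * n') * ((freeOn k W).card * g)) * M) := by gcongr
      _ ≤ 8 * (f * M) := by gcongr
  have hcard : (bigUnlinked k S ((k * (2 * k + 1)) ^ 2 * w)).card * 2 ^ (w.choose 2) ≤
      (S.powersetCard w).card * ((S.offDiag.powerset.filter fun X => X.card ≤ k * w).card *
        (8 * (f * M))) := by
    refine (Nat.mul_le_mul_right _ (Finset.card_le_card
      (bigUnlinked_subset hk hke S w))).trans ?_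
    refine (Nat.mul_le_mul_right _ Finset.card_biUnion_le).trans ?_
    rw [Finset.sum_mul]
    refine (Finset.sum_le_card_nsmul _ _ ((S.offDiag.powerset.filter fun X =>
      X.card ≤ k * w).card * (8 * (f * M))) ?_).trans (by rw [smul_eq_mul])
    intro W hW
    rw [Finset.mem_powersetCard] at hW
    refine (Nat.mul_le_mul_right _ Finset.card_biUnion_le).trans ?_
    rw [Finset.sum_mul]
    refine (Finset.sum_le_card_nsmul _ _ (8 * (f * M)) ?_).trans (by rw [smul_eq_mul])
    intro X _
    exact (Nat.mul_le_mul_right _ Finset.card_image_le).trans (hpure W hW.1 hW.2)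
  refine hcard.trans ?_
  have h1 : (S.powersetCard w).card ≤ 2 ^ (L * w) := by
    rw [Finset.card_powersetCard, pow_mul]
    exact (Nat.choose_le_pow _ _).trans (Nat.pow_le_pow_left (by omega) w)
  have h2 : (S.offDiag.powerset.filter fun X => X.card ≤ k * w).card ≤ 2 ^ (2 * L * (k * w)) := by
    refine (card_small_subsets_le _ _).trans ?_
    rw [pow_mul 2 (2 * L) (k * w), pow_mul _ k w, pow_mul _ k w]
    refine Nat.pow_le_pow_left (Nat.pow_le_pow_left ?_ _) _
    rw [Finset.offDiag_card, mul_comm 2 L, pow_mul]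
    have := Nat.pow_le_pow_left (show S.card + 1 ≤ 2 ^ L by omega) 2
    have h3 : S.card * S.card - S.card ≤ S.card * S.card := Nat.sub_le _ _
    nlinarith
  calc _ ≤ 2 ^ (L * w) * (2 ^ (2 * L * (k * w)) * (8 * (f * M))) := by gcongr
    _ = f * (2 ^ (L * (2 * k + 1) * w + 3) * M) := by
      rw [show L * (2 * k + 1) * w + 3 = L * w + 2 * L * (k * w) + 3 by ring, pow_add, pow_add]
      ring

/-- Moment bound. -/
theorem exists_moment_bound {k : ℕ} (hk : 4 ≤ k) (hke : Even k) :
    ∃ K : ℕ, ∀ (N L : ℕ) (S : Finset (Fin N)) (t : ℕ), S.card + 2 ≤ 2 ^ L → 1 ≤ t →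
      ∑ E ∈ freeOn k S, kap k S E ^ t ≤ (freeOn k S).card * 2 ^ (K * t ^ 2 * L ^ 2) := by
  set c := (k * (2 * k + 1)) ^ 2 with hc
  have hc1 : 1 ≤ c := Nat.one_le_iff_ne_zero.2 (by positivity)
  set C := 4 * (2 * k + 6 + 2 * c) with hC
  refine ⟨c * C + 1, fun N L => ?_⟩
  set K := c * C + 1 with hK
  intro S
  induction h : S.card using Nat.strong_induction_on generalizing S with
  | _ n ih =>
    intro t hL ht
    rw [← h] at hL
    have hL1 : 1 ≤ L := by
      by_contra! h0
      interval_cases L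
      omega
    set w0 := C * t * L with hw0
    set M := 2 ^ (K * L ^ 2) with hM
    set f := (freeOn k S).card with hf
    have htL : 1 ≤ t * L := Nat.mul_pos ht hL1
    have hterm : ∀ w, w0 ≤ w →
        (bigUnlinked k S (c * w)).card * (2 ^ (L * c * (w + 1) * t) * 2 ^ (L + 1)) ≤ f * M := by
      intro w hw
      have hw2 : 2 ≤ w := by
        have : C * 1 ≤ C * (t * L) := Nat.mul_le_mul_left _ htL
        rw [hw0, mul_assoc] at hw
        omega
      have hwL : 12 * L ≤ w := by
        have : 12 * L ≤ C * t * L := Nat.mul_le_mul_right _ (by nlinarith)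
        omega
      have h1 := card_bigUnlinked_le hk hke (S := S) (M := M) hL hwL (by
        intro W hW hWc
        have h2 := Finset.card_sdiff_of_subset hW
        have h3 := Finset.card_le_card hW
        have h4 := ih (S \ W).card (by omega) (S \ W) rfl 1 (by omega) le_rfl
        simpa [hM] using h4)
      have hexp : L * (2 * k + 1) * w + 3 + (L * c * (w + 1) * t + (L + 1)) ≤ w.choose 2 := by
        have e1 : w * w ≤ 4 * w.choose 2 := by
          rw [Nat.choose_two_right]
          have := Nat.even_mul_pred_self w
          have h5 : 2 * (w * (w - 1) / 2) = w * (w - 1) := Nat.two_mul_div_two_of_even this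
          obtain ⟨v, rfl⟩ : ∃ v, w = v + 1 := ⟨w - 1, by omega⟩
          simp only [Nat.add_sub_cancel] at h5 ⊢
          nlinarith
        have e2 : C * (t * L) * w ≤ w * w := Nat.mul_le_mul_right _ (by rw [← mul_assoc]; exact hw)
        have e3 : L * (2 * k + 1) * w ≤ (2 * k + 1) * ((t * L) * w) := by
          calc L * (2 * k + 1) * w = (2 * k + 1) * ((1 * L) * w) := by ring
            _ ≤ _ := by gcongr
        have e4 : L * c * (w + 1) * t ≤ 2 * c * ((t * L) * w) := by
          calc L * c * (w + 1) * t = c * ((t * L) * (w + 1)) := by ring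
            _ ≤ c * ((t * L) * (2 * w)) := by gcongr; omega
            _ = _ := by ring
        have e5 : w ≤ (t * L) * w := Nat.le_mul_of_pos_left _ htL
        have e6 : L ≤ (t * L) * w := by
          calc L = 1 * L * 1 := by ring
            _ ≤ _ := by gcongr; omega
        have e7 : C * (t * L) * w = 4 * ((2 * k + 1) * ((t * L) * w) + 5 * ((t * L) * w) +
          2 * c * ((t * L) * w)) := by rw [hC]; ring
        omega
      have hpos : 0 < 2 ^ (w.choose 2) := by positivity
      refine Nat.le_of_mul_le_mul_right (c := 2 ^ (w.choose 2)) ?_ hpos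
      calc (bigUnlinked k S (c * w)).card * (2 ^ (L * c * (w + 1) * t) * 2 ^ (L + 1)) *
            2 ^ (w.choose 2)
          = ((bigUnlinked k S (c * w)).card * 2 ^ (w.choose 2)) *
            (2 ^ (L * c * (w + 1) * t) * 2 ^ (L + 1)) := by ring
        _ ≤ (f * (2 ^ (L * (2 * k + 1) * w + 3) * M)) *
            (2 ^ (L * c * (w + 1) * t) * 2 ^ (L + 1)) := Nat.mul_le_mul_right _ h1
        _ = f * M * 2 ^ (L * (2 * k + 1) * w + 3 + (L * c * (w + 1) * t + (L + 1))) := by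
            rw [pow_add _ (L * (2 * k + 1) * w + 3), pow_add _ (L * c * (w + 1) * t)]; ring
        _ ≤ f * M * 2 ^ (w.choose 2) :=
            Nat.mul_le_mul_left _ (Nat.pow_le_pow_right (by norm_num) hexp)
    have hpt : ∀ E ∈ freeOn k S, kap k S E ^ t ≤ 2 ^ (L * c * w0 * t) +
        ∑ w ∈ Finset.Icc w0 S.card, if E ∈ bigUnlinked k S (c * w)
          then 2 ^ (L * c * (w + 1) * t) else 0 := by
      intro E hE
      have hkp : ∀ w, E ∉ bigUnlinked k S (c * w) → kap k S E ^ t ≤ 2 ^ (L * c * w * t) := by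
        intro w hw
        have h1 : kap k S E ≤ (S.card + 1) ^ (c * w) := by
          apply kap_le_pow
          intro T hT hT'
          by_contra! hlt
          apply hw
          simp only [bigUnlinked, Finset.mem_filter]
          exact ⟨hE, T, hT, hT', hlt.le⟩
        calc kap k S E ^ t ≤ ((2 ^ L) ^ (c * w)) ^ t :=
              Nat.pow_le_pow_left (h1.trans (Nat.pow_le_pow_left (by omega) _)) _
          _ = _ := by rw [← pow_mul, ← pow_mul]; congr 1; ring
      by_cases h0 : E ∈ bigUnlinked k S (c * w0)
      · set w := Nat.findGreatest (fun w => E ∈ bigUnlinked k S (c * w)) S.card with hw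
        have hbd : ∀ w, E ∈ bigUnlinked k S (c * w) → w ≤ S.card := by
          intro w hw
          simp only [bigUnlinked, Finset.mem_filter] at hw
          obtain ⟨-, T, hT, -, hTc⟩ := hw
          calc w ≤ c * w := Nat.le_mul_of_pos_left _ hc1
            _ ≤ T.card := hTc
            _ ≤ _ := Finset.card_le_card hT
        have hw1 : E ∈ bigUnlinked k S (c * w) :=
          Nat.findGreatest_spec (P := fun w => E ∈ bigUnlinked k S (c * w)) (hbd w0 h0) h0
        have hw2 : w0 ≤ w := Nat.le_findGreatest (hbd w0 h0) h0
        have hw3 : E ∉ bigUnlinked k S (c * (w + 1)) := fun h' => by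
          have : w + 1 ≤ w := Nat.le_findGreatest
            (P := fun w => E ∈ bigUnlinked k S (c * w)) (hbd _ h') h'
          omega
        refine (hkp _ hw3).trans (le_trans ?_ (Nat.le_add_left _ _))
        have := Finset.single_le_sum (s := Finset.Icc w0 S.card)
          (f := fun w => if E ∈ bigUnlinked k S (c * w) then 2 ^ (L * c * (w + 1) * t) else 0)
          (fun _ _ => Nat.zero_le _) (Finset.mem_Icc.2 ⟨hw2, hbd w hw1⟩)
        simpa [hw1] using this
      · exact (hkp _ h0).trans (Nat.le_add_right _ _)
    have hsum : (∑ w ∈ Finset.Icc w0 S.card,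
        (bigUnlinked k S (c * w)).card * 2 ^ (L * c * (w + 1) * t)) * 2 ≤ f * M := by
      have h1 : (∑ w ∈ Finset.Icc w0 S.card,
          (bigUnlinked k S (c * w)).card * 2 ^ (L * c * (w + 1) * t)) * 2 ^ (L + 1) ≤
          2 ^ L * (f * M) := by
        rw [Finset.sum_mul]
        refine (Finset.sum_le_card_nsmul _ _ (f * M) fun w hw => ?_).trans ?_
        · rw [mul_assoc]
          exact hterm w (Finset.mem_Icc.1 hw).1
        · rw [smul_eq_mul, Nat.card_Icc]
          exact Nat.mul_le_mul_right _ (by omega)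
      rw [pow_succ] at h1
      have : 0 < 2 ^ L := by positivity
      nlinarith
    have hmain : ∑ E ∈ freeOn k S, kap k S E ^ t ≤ f * 2 ^ (L * c * w0 * t) +
        ∑ w ∈ Finset.Icc w0 S.card,
          (bigUnlinked k S (c * w)).card * 2 ^ (L * c * (w + 1) * t) := by
      refine (Finset.sum_le_sum hpt).trans ?_
      rw [Finset.sum_add_distrib, Finset.sum_const, smul_eq_mul, Finset.sum_comm]
      refine Nat.add_le_add_left (Finset.sum_le_sum fun w _ => ?_) _
      rw [← Finset.sum_filter, Finset.sum_const, smul_eq_mul]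
      refine Nat.mul_le_mul_right _ (Finset.card_le_card fun E hE => ?_)
      exact (Finset.mem_filter.1 hE).2
    have hX1 : 2 * 2 ^ (L * c * w0 * t) ≤ 2 ^ (K * t ^ 2 * L ^ 2) := by
      rw [← pow_succ']
      refine Nat.pow_le_pow_right (by norm_num) ?_
      rw [hw0, hK]
      have : 1 ≤ t ^ 2 * L ^ 2 := Nat.mul_pos (by positivity) (by positivity)
      nlinarith
    have hX2 : M ≤ 2 ^ (K * t ^ 2 * L ^ 2) := by
      refine Nat.pow_le_pow_right (by norm_num) ?_
      apply Nat.mul_le_mul_right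
      exact Nat.le_mul_of_pos_right _ (by positivity)
    have hX3 := Nat.mul_le_mul_left f hX1
    have hX4 := Nat.mul_le_mul_left f hX2
    nlinarith

end Moments

section

variable {N : ℕ}

/-- Every set `I` of size at least `s` is joined by single arcs to a quarter of itself from all
but fewer than `j` vertices. -/
def Typ (j s : ℕ) (S : Finset (Fin N)) (E : ArcSet N) : Prop :=
  ∀ I ⊆ S, s ≤ I.card → ((S \ I).filter fun z => 4 * (oneNbr E z ∩ I).card < I.card).card < j

theorem card_sparse_subsets_pow_le {α : Type*} [DecidableEq α] (I : Finset α) :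
    (I.powerset.filter fun A => 4 * A.card < I.card).card ^ 8 * 2 ^ I.card ≤ 2 ^ (8 * I.card) := by
  set c := (I.powerset.filter fun A => 4 * A.card < I.card).card
  set i := I.card with hi
  have h1 : c * 2 ^ (i - i / 4) ≤ 3 ^ i := by
    have h := Finset.sum_pow_mul_eq_add_pow (1 : ℕ) 2 I
    rw [show (1 + 2 : ℕ) = 3 by norm_num, ← hi] at h
    rw [← h, ← smul_eq_mul]
    refine (Finset.card_nsmul_le_sum _ _ _ ?_).trans
      (Finset.sum_le_sum_of_subset (Finset.filter_subset _ _))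
    intro A hA
    rw [Finset.mem_filter] at hA
    rw [one_pow, one_mul]
    exact Nat.pow_le_pow_right (by norm_num) (by omega)
  have h2 : c ^ 4 * 8 ^ i ≤ 81 ^ i := by
    calc c ^ 4 * 8 ^ i = c ^ 4 * 2 ^ (3 * i) := by rw [pow_mul]; norm_num
      _ ≤ c ^ 4 * 2 ^ ((i - i / 4) * 4) :=
        Nat.mul_le_mul_left _ (Nat.pow_le_pow_right (by norm_num) (by omega))
      _ = (c * 2 ^ (i - i / 4)) ^ 4 := by rw [mul_pow, pow_mul]
      _ ≤ (3 ^ i) ^ 4 := Nat.pow_le_pow_left h1 4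
      _ = 81 ^ i := by rw [← pow_mul, mul_comm, pow_mul]; norm_num
  have h3 : c ^ 8 * 2 ^ i * 32 ^ i ≤ 2 ^ (8 * i) * 32 ^ i := by
    calc c ^ 8 * 2 ^ i * 32 ^ i = (c ^ 4 * 8 ^ i) ^ 2 := by
          have h64 : (64 : ℕ) ^ i = (8 ^ i) ^ 2 := by
            rw [← pow_mul, mul_comm, pow_mul]; norm_num
          rw [mul_assoc, ← mul_pow, show 2 * 32 = 64 by norm_num, h64]
          ring
      _ ≤ (81 ^ i) ^ 2 := Nat.pow_le_pow_left h2 2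
      _ = 6561 ^ i := by rw [← pow_mul, mul_comm, pow_mul]; norm_num
      _ ≤ 8192 ^ i := Nat.pow_le_pow_left (by norm_num) i
      _ = _ := by rw [pow_mul, ← mul_pow]; norm_num
  exact Nat.le_of_mul_le_mul_right h3 (by positivity)

theorem card_sparse_patterns_pow_le {α : Type*} [DecidableEq α] {T I : Finset α} (h : I ⊆ T) :
    (T.powerset.filter fun A => 4 * (A ∩ I).card < I.card).card ^ 8 * 2 ^ I.card ≤
      2 ^ (8 * T.card) := by
  have h1 : (T.powerset.filter fun A => 4 * (A ∩ I).card < I.card).card ≤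
      2 ^ (T \ I).card * (I.powerset.filter fun A => 4 * A.card < I.card).card := by
    rw [← Finset.card_powerset, ← Finset.card_product]
    apply Finset.card_le_card_of_injOn fun A => (A \ I, A ∩ I)
    · intro A hA
      simp only [Finset.mem_coe, Finset.mem_filter, Finset.mem_powerset, Finset.mem_product] at hA ⊢
      exact ⟨Finset.sdiff_subset_sdiff hA.1 subset_rfl, Finset.inter_subset_right, hA.2⟩
    · intro A _ A' _ heq
      simp only [Prod.mk.injEq] at heq
      rw [← Finset.sdiff_union_inter A I, ← Finset.sdiff_union_inter A' I, heq.1, heq.2]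
  have h2 := card_sparse_subsets_pow_le I
  have hc : (T \ I).card + I.card = T.card := Finset.card_sdiff_add_card_eq_card h
  calc _ ≤ (2 ^ (T \ I).card * (I.powerset.filter fun A => 4 * A.card < I.card).card) ^ 8 *
        2 ^ I.card := by gcongr
    _ = 2 ^ (8 * (T \ I).card) *
        ((I.powerset.filter fun A => 4 * A.card < I.card).card ^ 8 * 2 ^ I.card) := by
        rw [mul_pow, ← pow_mul, mul_comm 8, mul_assoc]
    _ ≤ 2 ^ (8 * (T \ I).card) * 2 ^ (8 * I.card) := Nat.mul_le_mul_left _ h2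
    _ = _ := by rw [← pow_add, ← hc]; ring

theorem card_bad_pair_le {k : ℕ} (hk : 4 ≤ k) {K L : ℕ}
    (hK : ∀ (S : Finset (Fin N)) (t : ℕ), S.card + 2 ≤ 2 ^ L → 1 ≤ t →
      ∑ E ∈ freeOn k S, kap k S E ^ t ≤ (freeOn k S).card * 2 ^ (K * t ^ 2 * L ^ 2))
    {S I Z : Finset (Fin N)} (hL : S.card + 2 ≤ 2 ^ L) (hI : I ⊆ S) (hZ : Z ⊆ S \ I)
    (hZ1 : 1 ≤ Z.card) {e : ℕ}
    (he : 8 * (Z.card ^ 2 + K * Z.card ^ 2 * L ^ 2 + e) ≤ I.card * Z.card) :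
    ((freeOn k S).filter fun E => ∀ z ∈ Z, 4 * (oneNbr E z ∩ I).card < I.card).card * 2 ^ e ≤
      (freeOn k S).card := by
  have : NeZero k := ⟨by omega⟩
  set j := Z.card with hj
  set T := S \ Z with hT
  have hZS : Z ⊆ S := hZ.trans Finset.sdiff_subset
  have hTZ : T ∪ Z = S := Finset.sdiff_union_of_subset hZS
  have hd : Disjoint T Z := Finset.sdiff_disjoint
  have hIT : I ⊆ T := fun a ha => Finset.mem_sdiff.2 ⟨hI ha, fun h =>
    (Finset.mem_sdiff.1 (hZ h)).2 ha⟩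
  set B := T.powerset.filter fun A => 4 * (A ∩ I).card < I.card with hB
  set 𝒢 := (freeOn k S).filter fun E => ∀ z ∈ Z, 4 * (oneNbr E z ∩ I).card < I.card with h𝒢
  have h1 : 𝒢.card ≤ 2 ^ (j ^ 2) * B.card ^ j *
      ((freeOn k T).card * 2 ^ (K * j ^ 2 * L ^ 2)) := by
    have hfib : 𝒢.card = ∑ H ∈ freeOn k T, (𝒢.filter fun E => rst E T = H).card := by
      apply Finset.card_eq_sum_card_fiberwise
      intro E hE
      simp only [h𝒢, Finset.coe_filter, Set.mem_ofPred_eq] at hE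
      exact rst_mem_freeOn hE.1
    rw [hfib]
    have hH : ∀ H ∈ freeOn k T, (𝒢.filter fun E => rst E T = H).card ≤
        2 ^ (j ^ 2) * B.card ^ j * kap k T H ^ j := by
      intro H _
      have := card_extend_set_le (k := k) (by omega) hd (H := H) B
      rw [mul_pow, ← mul_assoc] at this
      refine le_trans (Finset.card_le_card ?_) this
      intro E hE
      simp only [h𝒢, Finset.mem_filter] at hE ⊢
      rw [hTZ]
      refine ⟨hE.1.1, hE.2, fun z hz => ?_⟩
      simp only [hB, Finset.mem_filter, Finset.mem_powerset]
      refine ⟨Finset.inter_subset_right, ?_⟩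
      rw [Finset.inter_assoc, Finset.inter_eq_right.2 hIT]
      exact hE.1.2 z hz
    refine (Finset.sum_le_sum hH).trans ?_
    rw [← Finset.mul_sum]
    refine Nat.mul_le_mul_left _ (hK T j ?_ hZ1)
    exact (Nat.add_le_add_right (Finset.card_le_card Finset.sdiff_subset) 2).trans hL
  have h2 : 2 ^ (T.card * j) * (freeOn k T).card ≤ (freeOn k S).card := by
    have := card_freeOn_glue (k := k) hd
    rw [hTZ] at this
    refine le_trans (Nat.mul_le_mul_left _ ?_) this
    exact Nat.le_mul_of_pos_right _ (one_le_card_freeOn Z)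
  have h3 : B.card ^ 8 * 2 ^ I.card ≤ 2 ^ (8 * T.card) := card_sparse_patterns_pow_le hIT
  set f := (freeOn k T).card
  set F := (freeOn k S).card
  set a := j ^ 2 + K * j ^ 2 * L ^ 2 with ha
  have h4 : (𝒢.card * 2 ^ e) ^ 8 ≤ F ^ 8 := by
    calc (𝒢.card * 2 ^ e) ^ 8 ≤ (2 ^ (j ^ 2) * B.card ^ j * (f * 2 ^ (K * j ^ 2 * L ^ 2)) * 2 ^ e) ^ 8 := by
          gcongr
      _ = (B.card ^ 8) ^ j * f ^ 8 * 2 ^ (8 * (a + e)) := by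
          rw [mul_comm 8 (a + e), pow_mul 2 (a + e) 8, ha, pow_add, pow_add, ← pow_mul, mul_comm 8 j,
            pow_mul B.card]
          ring
      _ ≤ (B.card ^ 8) ^ j * f ^ 8 * 2 ^ (I.card * j) := by gcongr; norm_num
      _ = (B.card ^ 8 * 2 ^ I.card) ^ j * f ^ 8 := by rw [mul_pow, ← pow_mul]; ring
      _ ≤ (2 ^ (8 * T.card)) ^ j * f ^ 8 := by gcongr
      _ = (2 ^ (T.card * j) * f) ^ 8 := by
          rw [mul_pow, ← pow_mul, ← pow_mul]; congr 2; ring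
      _ ≤ F ^ 8 := by gcongr
  exact le_of_pow_le_pow_left₀ (by norm_num) (Nat.zero_le _) h4

/-- Few digraphs fail to be typical. -/
theorem card_not_typ_le {k : ℕ} (hk : 4 ≤ k) {K L : ℕ}
    (hK : ∀ (S : Finset (Fin N)) (t : ℕ), S.card + 2 ≤ 2 ^ L → 1 ≤ t →
      ∑ E ∈ freeOn k S, kap k S E ^ t ≤ (freeOn k S).card * 2 ^ (K * t ^ 2 * L ^ 2))
    {S : Finset (Fin N)} (hL : S.card + 2 ≤ 2 ^ L) {j s m : ℕ} (hj : 64 * L ≤ j)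
    (hs : 64 * (K + 3) * j * L ^ 2 ≤ s) (hm : 32 * m ≤ j * s) :
    ((freeOn k S).filter fun E => ¬ Typ j s S E).card * 2 ^ m ≤ (freeOn k S).card := by
  have hL1 : 1 ≤ L := by
    by_contra! h
    have : L = 0 := by omega
    subst this
    simp at hL
  set F := (freeOn k S).card with hF
  set 𝒢 : Finset (Fin N) → Finset (Fin N) → Finset (ArcSet N) := fun I Z =>
    (freeOn k S).filter fun E => ∀ z ∈ Z, 4 * (oneNbr E z ∩ I).card < I.card with h𝒢
  have hsub : ((freeOn k S).filter fun E => ¬ Typ j s S E) ⊆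
      (Finset.Icc s S.card).biUnion fun i => (S.powersetCard i).biUnion fun I =>
        ((S \ I).powersetCard j).biUnion fun Z => 𝒢 I Z := by
    intro E hE
    obtain ⟨hE, hn⟩ := Finset.mem_filter.1 hE
    unfold Typ at hn
    push Not at hn
    obtain ⟨I, hI, hsI, hjI⟩ := hn
    obtain ⟨Z, hZ, hZc⟩ := Finset.exists_subset_card_eq hjI
    simp only [Finset.mem_biUnion, Finset.mem_Icc, Finset.mem_powersetCard]
    refine ⟨I.card, ⟨hsI, Finset.card_le_card hI⟩, I, ⟨hI, rfl⟩, Z,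
      ⟨hZ.trans (Finset.filter_subset _ _), hZc⟩, ?_⟩
    simp only [h𝒢, Finset.mem_filter]
    exact ⟨hE, fun z hz => (Finset.mem_filter.1 (hZ hz)).2⟩
  have hone : ∀ i ∈ Finset.Icc s S.card, ∀ I ∈ S.powersetCard i, ∀ Z ∈ (S \ I).powersetCard j,
      (𝒢 I Z).card * 2 ^ (m + L * (i + j + 1)) ≤ F := by
    intro i hi I hI Z hZ
    rw [Finset.mem_Icc] at hi
    rw [Finset.mem_powersetCard] at hI hZ
    refine card_bad_pair_le hk hK hL hI.1 hZ.1 (by omega) ?_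
    rw [hI.2, hZ.2]
    have e1 : 64 * (L * i) ≤ i * j := by nlinarith [Nat.mul_le_mul_right i hj]
    have e2 : 32 * m ≤ i * j := hm.trans (by nlinarith [Nat.mul_le_mul_right j hi.1])
    have e3 : 64 * (K + 3) * j ^ 2 * L ^ 2 ≤ i * j := by
      calc _ = (64 * (K + 3) * j * L ^ 2) * j := by ring
        _ ≤ _ := Nat.mul_le_mul_right _ (hs.trans hi.1)
    have e4 : L * (j + 1) ≤ 2 * (j ^ 2 * L ^ 2) := by
      have : j + 1 ≤ 2 * j ^ 2 := by nlinarith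
      have h2 : L ≤ L ^ 2 := by nlinarith
      calc L * (j + 1) ≤ L ^ 2 * (2 * j ^ 2) := Nat.mul_le_mul h2 this
        _ = _ := by ring
    have e5 : j ^ 2 ≤ j ^ 2 * L ^ 2 := Nat.le_mul_of_pos_right _ (by positivity)
    set q := j ^ 2 * L ^ 2
    have e3' : 64 * (K * q + 3 * q) ≤ i * j := by
      calc _ = 64 * (K + 3) * j ^ 2 * L ^ 2 := by ring
        _ ≤ _ := e3
    have : K * j ^ 2 * L ^ 2 = K * q := by rw [mul_assoc]
    rw [this, show L * (i + j + 1) = L * i + L * (j + 1) by ring]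
    omega
  have hcount : ∀ i ∈ Finset.Icc s S.card, ((S.powersetCard i).biUnion fun I =>
        ((S \ I).powersetCard j).biUnion fun Z => 𝒢 I Z).card * 2 ^ (m + L) ≤ F := by
    intro i hi
    have hb : ∀ (A : Finset (Fin N)) (b : ℕ), A.card ≤ S.card →
        (A.powersetCard b).card ≤ 2 ^ (L * b) := by
      intro A b hA
      rw [Finset.card_powersetCard, pow_mul]
      exact (Nat.choose_le_pow _ _).trans (Nat.pow_le_pow_left (by omega) b)
    have hZ : ∀ I ∈ S.powersetCard i,
        (((S \ I).powersetCard j).biUnion fun Z => 𝒢 I Z).card * 2 ^ (m + L + L * i) ≤ F := by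
      intro I hI
      have h1 : (((S \ I).powersetCard j).biUnion fun Z => 𝒢 I Z).card *
          2 ^ (m + L * (i + j + 1)) ≤ 2 ^ (L * j) * F := by
        refine (Nat.mul_le_mul_right _ Finset.card_biUnion_le).trans ?_
        rw [Finset.sum_mul]
        refine (Finset.sum_le_card_nsmul _ _ F fun Z hZ => hone i hi I hI Z hZ).trans ?_
        rw [smul_eq_mul]
        exact Nat.mul_le_mul_right _ (hb _ _ (Finset.card_le_card Finset.sdiff_subset))
      have h2 : m + L * (i + j + 1) = (m + L + L * i) + L * j := by ring
      rw [h2, pow_add 2 (m + L + L * i), ← mul_assoc, mul_comm (2 ^ (L * j)) F] at h1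
      exact Nat.le_of_mul_le_mul_right h1 (by positivity)
    have h1 : ((S.powersetCard i).biUnion fun I =>
        ((S \ I).powersetCard j).biUnion fun Z => 𝒢 I Z).card * 2 ^ (m + L + L * i) ≤
        2 ^ (L * i) * F := by
      refine (Nat.mul_le_mul_right _ Finset.card_biUnion_le).trans ?_
      rw [Finset.sum_mul]
      refine (Finset.sum_le_card_nsmul _ _ F hZ).trans ?_
      rw [smul_eq_mul]
      exact Nat.mul_le_mul_right _ (hb _ _ le_rfl)
    rw [pow_add 2 (m + L), ← mul_assoc, mul_comm (2 ^ (L * i)) F] at h1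
    exact Nat.le_of_mul_le_mul_right h1 (by positivity)
  have hfin : ((freeOn k S).filter fun E => ¬ Typ j s S E).card * 2 ^ (m + L) ≤ 2 ^ L * F := by
    refine (Nat.mul_le_mul_right _ ((Finset.card_le_card hsub).trans Finset.card_biUnion_le)).trans ?_
    rw [Finset.sum_mul]
    refine (Finset.sum_le_card_nsmul _ _ F hcount).trans ?_
    rw [smul_eq_mul]
    refine Nat.mul_le_mul_right _ ?_
    rw [Nat.card_Icc]
    omega
  rw [pow_add, ← mul_assoc, mul_comm (2 ^ L) F] at hfin
  exact Nat.le_of_mul_le_mul_right hfin (by positivity)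

end

section

variable {N : ℕ}

/-- The arcs inside `P` that do not go strictly upwards in the ranking `r`. -/
noncomputable def backs (E : ArcSet N) (P : Finset (Fin N)) (r : Fin N → ℕ) : ArcSet N :=
  E.filter fun e => e.1 ∈ P ∧ e.2 ∈ P ∧ r e.2 ≤ r e.1

/-- The minimum number of backwards arcs inside `P`. -/
noncomputable def bb (E : ArcSet N) (P : Finset (Fin N)) : ℕ :=
  sInf (Set.range fun r : Fin N → ℕ => (backs E P r).card)

/-- The arcs from `Y` to `X`. -/
noncomputable def arcs (E : ArcSet N) (Y X : Finset (Fin N)) : ArcSet N :=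
  E.filter fun e => e.1 ∈ Y ∧ e.2 ∈ X

theorem mem_backs {E : ArcSet N} {P : Finset (Fin N)} {r : Fin N → ℕ} {a b : Fin N} :
    (a, b) ∈ backs E P r ↔ (a, b) ∈ E ∧ a ∈ P ∧ b ∈ P ∧ r b ≤ r a := by
  simp [backs]

theorem mem_arcs {E : ArcSet N} {X Y : Finset (Fin N)} {a b : Fin N} :
    (a, b) ∈ arcs E Y X ↔ (a, b) ∈ E ∧ a ∈ Y ∧ b ∈ X := by
  simp [arcs]

theorem bb_le (E : ArcSet N) (P : Finset (Fin N)) (r : Fin N → ℕ) :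
    bb E P ≤ (backs E P r).card := Nat.sInf_le ⟨r, rfl⟩

theorem exists_bb (E : ArcSet N) (P : Finset (Fin N)) : ∃ r, (backs E P r).card = bb E P :=
  Nat.sInf_mem (Set.range_nonempty fun r : Fin N → ℕ => (backs E P r).card)

theorem bb_congr {E E' : ArcSet N} {P : Finset (Fin N)}
    (h : ∀ a ∈ P, ∀ b ∈ P, (a, b) ∈ E ↔ (a, b) ∈ E') : bb E P = bb E' P := by
  have : ∀ r, backs E P r = backs E' P r := by
    intro r
    ext ⟨a, b⟩
    rw [mem_backs, mem_backs]
    constructor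
    · rintro ⟨h1, h2, h3, h4⟩
      exact ⟨(h a h2 b h3).1 h1, h2, h3, h4⟩
    · rintro ⟨h1, h2, h3, h4⟩
      exact ⟨(h a h2 b h3).2 h1, h2, h3, h4⟩
  simp only [bb, this]

theorem bb_rst {E : ArcSet N} {P X : Finset (Fin N)} (h : P ⊆ X) : bb (rst E X) P = bb E P :=
  bb_congr fun a ha b hb => by
    rw [mem_rst]
    exact ⟨fun h' => h'.1, fun h' => ⟨h', h ha, h hb⟩⟩

theorem bb_le_sq (E : ArcSet N) (P : Finset (Fin N)) : bb E P ≤ P.card ^ 2 := by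
  refine (bb_le E P fun _ => 0).trans ?_
  rw [sq, ← Finset.card_product]
  refine Finset.card_le_card ?_
  rintro ⟨a, b⟩ h
  rw [mem_backs] at h
  exact Finset.mem_product.2 ⟨h.2.1, h.2.2.1⟩

theorem bb_le_add (E : ArcSet N) (P X : Finset (Fin N)) :
    bb E P ≤ bb E X + bb E (P \ X) + (arcs E (P \ X) X).card := by
  obtain ⟨r, hr⟩ := exists_bb E X
  obtain ⟨r', hr'⟩ := exists_bb E (P \ X)
  set M := ∑ z ∈ P, r z + 1 with hM
  have hlt : ∀ z ∈ P, r z < M := fun z hz =>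
    Nat.lt_succ_of_le (Finset.single_le_sum (fun _ _ => Nat.zero_le _) hz)
  refine (bb_le E P fun z => if z ∈ X then r z else M + r' z).trans ?_
  rw [← hr, ← hr']
  refine (Finset.card_le_card (t := backs E X r ∪ backs E (P \ X) r' ∪ arcs E (P \ X) X) ?_).trans
    ((Finset.card_union_le _ _).trans (Nat.add_le_add_right (Finset.card_union_le _ _) _))
  rintro ⟨a, b⟩ h
  rw [mem_backs] at h
  obtain ⟨h1, h2, h3, h4⟩ := h
  rw [Finset.mem_union, Finset.mem_union, mem_backs, mem_backs, mem_arcs]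
  by_cases ha : a ∈ X <;> by_cases hb : b ∈ X <;> simp only [ha, hb, if_true, if_false] at h4
  · exact Or.inl (Or.inl ⟨h1, ha, hb, h4⟩)
  · have := hlt a h2
    omega
  · exact Or.inr ⟨h1, Finset.mem_sdiff.2 ⟨h2, ha⟩, hb⟩
  · exact Or.inl (Or.inr ⟨h1, Finset.mem_sdiff.2 ⟨h2, ha⟩, Finset.mem_sdiff.2 ⟨h3, hb⟩, by omega⟩)

theorem bb_add_le {E : ArcSet N} {P X : Finset (Fin N)} (hX : X ⊆ P) :
    bb E X + bb E (P \ X) ≤ bb E P := by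
  obtain ⟨r, hr⟩ := exists_bb E P
  rw [← hr]
  refine (Nat.add_le_add (bb_le E X r) (bb_le E (P \ X) r)).trans ?_
  rw [← Finset.card_union_of_disjoint]
  · refine Finset.card_le_card ?_
    rintro ⟨a, b⟩ h
    rw [Finset.mem_union, mem_backs, mem_backs] at h
    rw [mem_backs]
    rcases h with h | h
    · exact ⟨h.1, hX h.2.1, hX h.2.2.1, h.2.2.2⟩
    · exact ⟨h.1, Finset.sdiff_subset h.2.1, Finset.sdiff_subset h.2.2.1, h.2.2.2⟩
  · rw [Finset.disjoint_left]
    rintro ⟨a, b⟩ h h'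
    rw [mem_backs] at h h'
    exact (Finset.mem_sdiff.1 h'.2.1).2 h.2.1

/-- Single-arc pairs between disjoint sets. -/
theorem Typ.card_pairs {j s : ℕ} {S : Finset (Fin N)} {E : ArcSet N} (h : Typ j s S E)
    {A I : Finset (Fin N)} (hA : A ⊆ S) (hI : I ⊆ S) (hd : Disjoint A I) (hs : s ≤ I.card) :
    (A.card - j) * I.card ≤ 4 * ((arcs E A I).card + (arcs E I A).card) := by
  set G := A.filter fun z => I.card ≤ 4 * (oneNbr E z ∩ I).card with hG
  have hbad : (A.filter fun z => ¬ I.card ≤ 4 * (oneNbr E z ∩ I).card).card < j := by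
    refine lt_of_le_of_lt (Finset.card_le_card ?_) (h I hI hs)
    intro z hz
    rw [Finset.mem_filter] at hz
    simp only [Finset.mem_filter, Finset.mem_sdiff]
    exact ⟨⟨hA hz.1, Finset.disjoint_left.1 hd hz.1⟩, by omega⟩
  have hcard : A.card - j ≤ G.card := by
    have := Finset.card_filter_add_card_filter_not (s := A)
      (fun z => I.card ≤ 4 * (oneNbr E z ∩ I).card)
    change G.card + _ = _ at this
    omega
  have h1 : G.card * I.card ≤ 4 * ∑ z ∈ A, (oneNbr E z ∩ I).card := by
    rw [Finset.mul_sum]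
    refine le_trans ?_ (Finset.sum_le_sum_of_subset (Finset.filter_subset _ _ : G ⊆ A))
    rw [← smul_eq_mul]
    exact Finset.card_nsmul_le_sum _ _ _ fun z hz => (Finset.mem_filter.1 hz).2
  have h2 : ∑ z ∈ A, (oneNbr E z ∩ I).card ≤ (arcs E A I).card + (arcs E I A).card := by
    rw [← Finset.card_sigma]
    have hdis : Disjoint (arcs E A I) (arcs E I A) := by
      rw [Finset.disjoint_left]
      rintro ⟨a, b⟩ h h'
      rw [mem_arcs] at h h'
      exact Finset.disjoint_left.1 hd h.2.1 h'.2.1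
    rw [← Finset.card_union_of_disjoint hdis]
    apply Finset.card_le_card_of_injOn fun p => if (p.1, p.2) ∈ E then (p.1, p.2) else (p.2, p.1)
    · rintro ⟨z, u⟩ hzu
      simp only [Finset.mem_coe, Finset.mem_sigma, Finset.mem_inter, mem_oneNbr] at hzu
      simp only [Finset.mem_coe, Finset.mem_union]
      split_ifs with hc
      · exact Or.inl (mem_arcs.2 ⟨hc, hzu.1, hzu.2.2⟩)
      · refine Or.inr (mem_arcs.2 ⟨?_, hzu.2.2, hzu.1⟩)
        rcases hzu.2.1 with h | h
        · exact absurd h.1 hc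
        · exact h.1
    · rintro ⟨z, u⟩ h ⟨z', u'⟩ h' heq
      simp only [Finset.mem_coe, Finset.mem_sigma, Finset.mem_inter, mem_oneNbr] at h h'
      have n1 : z ≠ u' := fun e => Finset.disjoint_left.1 hd h.1 (e ▸ h'.2.2)
      have n2 : z' ≠ u := fun e => Finset.disjoint_left.1 hd h'.1 (e ▸ h.2.2)
      simp only at heq
      split_ifs at heq <;> simp only [Prod.mk.injEq] at heq
      · rw [heq.1, heq.2]
      · exact absurd heq.1 n1
      · exact absurd heq.2 n1
      · rw [heq.1, heq.2]
  calc _ ≤ G.card * I.card := Nat.mul_le_mul_right _ hcard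
    _ ≤ _ := h1.trans (Nat.mul_le_mul_left _ h2)

/-- Large sets span many arcs. -/
theorem Typ.card_arcs {j s : ℕ} {S : Finset (Fin N)} {E : ArcSet N} (h : Typ j s S E)
    (hjs : j ≤ s) {h' : ℕ} (hh : s ≤ h') (hs1 : 1 ≤ s)
    {Z : Finset (Fin N)} (hZ : Z ⊆ S) (hc : 20 * h' < Z.card) :
    Z.card * h' < (arcs E Z Z).card := by
  obtain ⟨I, hIZ, hIc⟩ := Finset.exists_subset_card_eq (show Z.card / 2 ≤ Z.card by omega)
  have hA : (Z \ I).card = Z.card - Z.card / 2 := by rw [Finset.card_sdiff_of_subset hIZ, hIc]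
  have h1 := h.card_pairs (A := Z \ I) (I := I) (Finset.sdiff_subset.trans hZ) (hIZ.trans hZ)
    Finset.sdiff_disjoint (by omega)
  have h2 : (arcs E (Z \ I) I).card + (arcs E I (Z \ I)).card ≤ (arcs E Z Z).card := by
    rw [← Finset.card_union_of_disjoint]
    · refine Finset.card_le_card ?_
      rintro ⟨a, b⟩ h
      rw [Finset.mem_union, mem_arcs, mem_arcs] at h
      rw [mem_arcs]
      rcases h with h | h
      · exact ⟨h.1, Finset.sdiff_subset h.2.1, hIZ h.2.2⟩
      · exact ⟨h.1, hIZ h.2.1, Finset.sdiff_subset h.2.2⟩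
    · rw [Finset.disjoint_left]
      rintro ⟨a, b⟩ h h'
      rw [mem_arcs] at h h'
      exact (Finset.mem_sdiff.1 h.2.1).2 h'.2.1
  rw [hA, hIc] at h1
  by_contra! hcon
  have h3 : (9 * h') * (Z.card / 2) ≤ 4 * (Z.card * h') := by
    calc _ ≤ (Z.card - Z.card / 2 - j) * (Z.card / 2) := Nat.mul_le_mul_right _ (by omega)
      _ ≤ _ := h1
      _ ≤ _ := by omega
  have h4 : 9 * Z.card ≤ 18 * (Z.card / 2) + 9 := by omega
  have h5 : 9 * Z.card * h' ≤ 8 * Z.card * h' + 9 * h' := by nlinarith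
  nlinarith

/-- In-neighbours inside `C`. -/
noncomputable def inn (E : ArcSet N) (C : Finset (Fin N)) (z : Fin N) : Finset (Fin N) :=
  C.filter fun c => (c, z) ∈ E

theorem mem_inn {E : ArcSet N} {C : Finset (Fin N)} {z c : Fin N} :
    c ∈ inn E C z ↔ c ∈ C ∧ (c, z) ∈ E := by
  simp [inn]

theorem inn_mono {E : ArcSet N} {C C' : Finset (Fin N)} (h : C ⊆ C') (z : Fin N) :
    inn E C z ⊆ inn E C' z := Finset.filter_subset_filter _ h

/-- Out-neighbours inside `C`. -/
noncomputable def outn (E : ArcSet N) (C : Finset (Fin N)) (z : Fin N) : Finset (Fin N) :=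
  C.filter fun c => (z, c) ∈ E

theorem mem_outn {E : ArcSet N} {C : Finset (Fin N)} {z c : Fin N} :
    c ∈ outn E C z ↔ c ∈ C ∧ (z, c) ∈ E := by
  simp [outn]

theorem card_arcs_le_of_inn {E : ArcSet N} {Y Z : Finset (Fin N)} {h : ℕ}
    (hd : ∀ z ∈ Z, (inn E Y z).card ≤ h) : (arcs E Y Z).card ≤ Z.card * h := by
  have : arcs E Y Z = Z.biUnion fun z => (inn E Y z).image fun c => (c, z) := by
    ext ⟨a, b⟩
    simp only [mem_arcs, Finset.mem_biUnion, Finset.mem_image, mem_inn, Prod.mk.injEq]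
    constructor
    · rintro ⟨h1, h2, h3⟩
      exact ⟨b, h3, a, ⟨h2, h1⟩, rfl, rfl⟩
    · rintro ⟨z, hz, c, ⟨h2, h1⟩, rfl, rfl⟩
      exact ⟨h1, h2, hz⟩
  rw [this]
  refine Finset.card_biUnion_le_card_mul _ _ _ fun z hz => ?_
  exact Finset.card_image_le.trans (hd z hz)

theorem card_arcs_le_of_outn {E : ArcSet N} {Y Z : Finset (Fin N)} {h : ℕ}
    (hd : ∀ z ∈ Z, (outn E Y z).card ≤ h) : (arcs E Z Y).card ≤ Z.card * h := by
  have : arcs E Z Y = Z.biUnion fun z => (outn E Y z).image fun c => (z, c) := by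
    ext ⟨a, b⟩
    simp only [mem_arcs, Finset.mem_biUnion, Finset.mem_image, mem_outn, Prod.mk.injEq]
    constructor
    · rintro ⟨h1, h2, h3⟩
      exact ⟨a, h2, b, ⟨h3, h1⟩, rfl, rfl⟩
    · rintro ⟨z, hz, c, ⟨h2, h1⟩, rfl, rfl⟩
      exact ⟨h1, hz, h2⟩
  rw [this]
  refine Finset.card_biUnion_le_card_mul _ _ _ fun z hz => ?_
  exact Finset.card_image_le.trans (hd z hz)

theorem Typ.card_low_inn {j s : ℕ} {S : Finset (Fin N)} {E : ArcSet N} (h : Typ j s S E)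
    (hjs : j ≤ s) {h' : ℕ} (hh : s ≤ h') (hs1 : 1 ≤ s)
    {C : Finset (Fin N)} (hC : C ⊆ S) :
    (C.filter fun z => (inn E C z).card ≤ h').card ≤ 20 * h' := by
  by_contra! hcon
  have h1 := h.card_arcs hjs hh hs1 ((Finset.filter_subset _ _).trans hC) hcon
  refine absurd (card_arcs_le_of_inn (h := h') fun z hz => ?_) h1.not_ge
  refine (Finset.card_le_card (inn_mono (Finset.filter_subset _ _) z)).trans ?_
  exact (Finset.mem_filter.1 hz).2

theorem Typ.card_low_outn {j s : ℕ} {S : Finset (Fin N)} {E : ArcSet N} (h : Typ j s S E)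
    (hjs : j ≤ s) {h' : ℕ} (hh : s ≤ h') (hs1 : 1 ≤ s)
    {C : Finset (Fin N)} (hC : C ⊆ S) :
    (C.filter fun z => (outn E C z).card ≤ h').card ≤ 20 * h' := by
  by_contra! hcon
  have h1 := h.card_arcs hjs hh hs1 ((Finset.filter_subset _ _).trans hC) hcon
  refine absurd (card_arcs_le_of_outn (h := h') fun z hz => ?_) h1.not_ge
  refine (Finset.card_le_card (Finset.filter_subset_filter _ (Finset.filter_subset _ _))).trans ?_
  exact (Finset.mem_filter.1 hz).2

/-- Iterated removal of vertices of low in-degree. -/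
noncomputable def core (E : ArcSet N) (h : ℕ) (C : Finset (Fin N)) : ℕ → Finset (Fin N)
  | 0 => C
  | m + 1 => (core E h C m).filter fun c => h < (inn E (core E h C m) c).card

theorem core_succ_subset (E : ArcSet N) (h : ℕ) (C : Finset (Fin N)) (m : ℕ) :
    core E h C (m + 1) ⊆ core E h C m := Finset.filter_subset _ _

theorem core_anti (E : ArcSet N) (h : ℕ) (C : Finset (Fin N)) {m m' : ℕ} (hm : m ≤ m') :
    core E h C m' ⊆ core E h C m := by
  induction hm with
  | refl => exact subset_rfl
  | step _ ih => exact (core_succ_subset E h C _).trans ih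

theorem mem_core_succ {E : ArcSet N} {h : ℕ} {C : Finset (Fin N)} {m : ℕ} {c : Fin N} :
    c ∈ core E h C (m + 1) ↔ c ∈ core E h C m ∧ h < (inn E (core E h C m) c).card := by
  simp only [core, Finset.mem_filter]

theorem card_le_card_core {j s : ℕ} {S : Finset (Fin N)} {E : ArcSet N} (h : Typ j s S E)
    (hjs : j ≤ s) {h' : ℕ} (hh : s ≤ h') (hs1 : 1 ≤ s)
    {C : Finset (Fin N)} (hC : C ⊆ S) (m : ℕ) :
    C.card ≤ (core E h' C m).card + m * (20 * h') := by
  induction m with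
  | zero => simp [core]
  | succ m ih =>
    have h1 := h.card_low_inn hjs hh hs1 ((core_anti E h' C (Nat.zero_le m)).trans hC)
    have h2 := Finset.card_filter_add_card_filter_not (s := core E h' C m)
      (fun c => h' < (inn E (core E h' C m) c).card)
    simp only [not_lt] at h2
    have h3 : (core E h' C (m + 1)).card =
      ((core E h' C m).filter fun c => h' < (inn E (core E h' C m) c).card).card := rfl
    rw [h3]
    linarith

/-- Backwards extension of paths inside the cores. -/
theorem exists_path_core {E : ArcSet N} {h : ℕ} {C : Finset (Fin N)} (F : Finset (Fin N))
    (l : ℕ) : ∀ {m : ℕ} {c : Fin N}, F.card + l ≤ h → c ∈ core E h C (m + l) → c ∉ F →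
      ∃ x A, Pth E l x c A ∧ x ∈ core E h C m ∧ A ⊆ core E h C m ∧ Disjoint A F := by
  induction l with
  | zero =>
    intro m c _ hc hF
    exact ⟨c, {c}, Pth.nil c, hc, by simpa using hc, by simpa using hF⟩
  | succ l ih =>
    intro m c hh hc hF
    obtain ⟨x, A, hp, hx, hA, hAF⟩ := ih (m := m + 1) (by omega)
      (by rwa [show m + 1 + l = m + (l + 1) by ring]) hF
    have hx' := (mem_core_succ.1 hx).2
    have hcard := hp.card_eq
    have : ¬ inn E (core E h C m) x ⊆ A ∪ F := by
      intro hsub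
      have h1 := Finset.card_le_card hsub
      have h2 := Finset.card_union_le A F
      omega
    obtain ⟨y, hy, hyn⟩ := Finset.not_subset.1 this
    rw [mem_inn] at hy
    rw [Finset.mem_union, not_or] at hyn
    refine ⟨y, insert y A, Pth.cons hy.2 hyn.1 hp, hy.1, ?_, ?_⟩
    · exact Finset.insert_subset hy.1 (hA.trans (core_succ_subset E h C m))
    · exact Finset.disjoint_insert_left.2 ⟨hyn.2, hAF⟩

end

section

variable {N : ℕ}

theorem exists_small_drop {α : Type*} [DecidableEq α] (Y : ℕ → Finset α)
    (hY : ∀ i, Y (i + 1) ⊆ Y i) (K : ℕ) (hK : 1 ≤ K) :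
    ∃ i < K, K * (Y i \ Y (i + 1)).card ≤ (Y 0).card := by
  have h : ∀ K, ∑ i ∈ Finset.range K, (Y i \ Y (i + 1)).card + (Y K).card = (Y 0).card := by
    intro K
    induction K with
    | zero => simp
    | succ K ih =>
      rw [Finset.sum_range_succ, add_assoc, Finset.card_sdiff_add_card_eq_card (hY K), ih]
  by_contra! hcon
  have h1 := h K
  have h2 : ∑ i ∈ Finset.range K, (Y 0).card < ∑ i ∈ Finset.range K, K * (Y i \ Y (i + 1)).card :=
    Finset.sum_lt_sum_of_nonempty (Finset.nonempty_range_iff.2 (by omega))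
      fun i hi => hcon i (Finset.mem_range.1 hi)
  rw [Finset.sum_const, Finset.card_range, smul_eq_mul, ← Finset.mul_sum] at h2
  have := Nat.lt_of_mul_lt_mul_left h2
  omega

/-- Large sets have balanced cuts with few arcs in one direction. -/
theorem exists_sparse_cut {k j s : ℕ} (hk : 4 ≤ k) {S : Finset (Fin N)} {E : ArcSet N}
    (hE : E ∈ freeOn k S) (h : Typ j s S E) (hjs : j ≤ s) (hks : 2 * k ≤ s)
    {P : Finset (Fin N)} (hP : P ⊆ S) (hc : 24000 * k * s ≤ P.card) :
    ∃ X ⊆ P, P.card ≤ 100 * X.card ∧ P.card ≤ 100 * (P \ X).card ∧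
      (arcs E (P \ X) X).card ≤ (48000 * k + 1) * s * P.card := by
  have hs8 : 8 ≤ s := by omega
  have hloop : ∀ a b, (a, b) ∈ E → a ≠ b := fun a b hab => (freeOn_ne_of_mem hE hab).2.2
  have hfree := (mem_freeOn.1 hE).2
  set p := P.card with hp
  have hps : 24000 * 4 * s ≤ p := le_trans (by gcongr) hc
  obtain ⟨v, hvP, hvi, hvo⟩ : ∃ v ∈ P, p / 50 < (inn E P v).card ∧ p / 50 < (outn E P v).card := by
    by_contra! hcon
    have h1 := h.card_low_inn hjs (h' := p / 50) (by omega) (by omega) hP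
    have h2 := h.card_low_outn hjs (h' := p / 50) (by omega) (by omega) hP
    have h3 : P ⊆ (P.filter fun z => (inn E P z).card ≤ p / 50) ∪
        (P.filter fun z => (outn E P z).card ≤ p / 50) := by
      intro z hz
      rw [Finset.mem_union, Finset.mem_filter, Finset.mem_filter]
      by_cases hzi : (inn E P z).card ≤ p / 50
      · exact Or.inl ⟨hz, hzi⟩
      · exact Or.inr ⟨hz, hcon z hz (not_le.1 hzi)⟩
    have h4 := (Finset.card_le_card h3).trans (Finset.card_union_le _ _)
    omega
  set A := inn E P v with hA
  set C := outn E P v with hC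
  have hCP : C ⊆ P := Finset.filter_subset _ _
  have hAP : A ⊆ P := Finset.filter_subset _ _
  have hvC : v ∉ C := fun hv => hloop v v (mem_outn.1 hv).2 rfl
  set co := core E (2 * s) C with hco
  have hcoC : ∀ m, co m ⊆ C := fun m => core_anti E (2 * s) C (Nat.zero_le m)
  set Y : ℕ → Finset (Fin N) := fun m => P.filter fun z => z ≠ v ∧ 2 ≤ (inn E (co m) z).card with hY
  have hmY : ∀ m z, z ∈ Y m ↔ z ∈ P ∧ z ≠ v ∧ 2 ≤ (inn E (co m) z).card := by
    intro m z
    simp only [hY, Finset.mem_filter]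
  have hYP : ∀ m, Y m ⊆ P := fun m => Finset.filter_subset _ _
  have hYanti : ∀ m m', m ≤ m' → Y m' ⊆ Y m := by
    intro m m' hm z hz
    rw [hmY] at hz ⊢
    exact ⟨hz.1, hz.2.1, hz.2.2.trans (Finset.card_le_card (inn_mono (core_anti E _ C hm) z))⟩
  have hcoY : ∀ m, co (m + 1) ⊆ Y m := by
    intro m z hz
    rw [hmY]
    refine ⟨hCP (hcoC _ hz), fun e => hvC (e ▸ hcoC _ hz), ?_⟩
    have := (mem_core_succ.1 hz).2
    change 2 * s < (inn E (co m) z).card at this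
    omega
  have hAY : ∀ m, k ≤ m → (A ∩ Y m).card ≤ 20 * s := by
    intro m hm
    by_contra! hcon
    have h1 := h.card_arcs hjs le_rfl (by omega)
      ((Finset.inter_subset_left.trans hAP).trans hP) hcon
    obtain ⟨⟨z, a⟩, hza⟩ := Finset.card_pos.1 (lt_of_le_of_lt (Nat.zero_le _) h1)
    rw [mem_arcs, Finset.mem_inter, Finset.mem_inter, hmY] at hza
    obtain ⟨hza, ⟨-, -, hzv, hz2⟩, haA, -⟩ := hza
    obtain ⟨c, hc, hca⟩ : ∃ c ∈ inn E (co m) z, c ≠ a := by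
      by_contra! hall
      have : inn E (co m) z ⊆ {a} := fun c hc => Finset.mem_singleton.2 (hall c hc)
      have := Finset.card_le_card this
      rw [Finset.card_singleton] at this
      omega
    rw [mem_inn] at hc
    have hzc := hloop _ _ hc.2
    have hza' := hloop _ _ hza
    obtain ⟨x, B, hpth, hx, hB, hBF⟩ := exists_path_core (E := E) (h := 2 * s) (C := C) {a, z}
      (k - 4) (m := m - (k - 4)) (c := c)
      ((Nat.add_le_add_right Finset.card_le_two _).trans (by omega))
      (by rw [Nat.sub_add_cancel (by omega)]; exact hc.1) (by simp [hca, hzc])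
    have hav := (mem_inn.1 haA).2
    have hav' := hloop _ _ hav
    have hvx := (mem_outn.1 (hcoC _ hx)).2
    have hvB : v ∉ B := fun hv => hvC (hcoC _ (hB hv))
    have haB : a ∉ B := Finset.disjoint_right.1 hBF (by simp)
    have hzB : z ∉ B := Finset.disjoint_right.1 hBF (by simp)
    have hp1 := Pth.cons hvx hvB hpth
    have hp2 := hp1.snoc hc.2 (by simp [hzv, hzB])
    have hp3 := hp2.snoc hza (by simp [Ne.symm hza', hav', haB])
    exact hfree.no_closed (by omega) (by omega) hp3 hav
  set K := p / (24000 * k * s) with hK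
  have hDpos : 0 < 24000 * k * s := by positivity
  have hK1 : 1 ≤ K := (Nat.one_le_div_iff hDpos).2 hc
  have hKp : K * (24000 * k * s) ≤ p := Nat.div_mul_le_self _ _
  have hKp' : p < (K + 1) * (24000 * k * s) := by
    rw [mul_comm]; exact Nat.lt_mul_div_succ p hDpos
  obtain ⟨i, hiK, hi⟩ := exists_small_drop (fun i => Y (k * (i + 1)))
    (fun i => hYanti _ _ (Nat.mul_le_mul_left _ (by omega))) K hK1
  set m := k * (i + 1) with hm
  have hmk : k * (i + 1 + 1) = m + k := by rw [hm]; ring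
  have hmK : m ≤ k * K := Nat.mul_le_mul_left _ (by omega)
  have hkm : k ≤ m := Nat.le_mul_of_pos_right _ (by omega)
  simp only [hmk] at hi
  have hdrop : (Y m \ Y (m + k)).card ≤ 2 * (24000 * k * s) := by
    have h1 : K * (Y m \ Y (m + k)).card ≤ K * (2 * (24000 * k * s)) := by
      calc _ ≤ (Y (k * (0 + 1))).card := hi
        _ ≤ p := Finset.card_le_card (hYP _)
        _ ≤ (K + 1) * (24000 * k * s) := hKp'.le
        _ ≤ (2 * K) * (24000 * k * s) := Nat.mul_le_mul_right _ (by omega)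
        _ = _ := by ring
    exact Nat.le_of_mul_le_mul_left h1 (by omega)
  have hXY : P \ (P \ Y m) = Y m := by
    rw [Finset.sdiff_sdiff_eq_self (hYP m)]
  refine ⟨P \ Y m, Finset.sdiff_subset, ?_, ?_, ?_⟩
  · have h1 := hAY m hkm
    have h2 : A.card ≤ (A ∩ Y m).card + (P \ Y m).card := by
      rw [← Finset.card_inter_add_card_sdiff A (Y m)]
      exact Nat.add_le_add_left (Finset.card_le_card (Finset.sdiff_subset_sdiff hAP subset_rfl)) _
    omega
  · rw [hXY]
    have h1 := card_le_card_core h hjs (h' := 2 * s) (by omega) (by omega) (hCP.trans hP) (m + 1)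
    have h2 : (co (m + 1)).card ≤ (Y m).card := Finset.card_le_card (hcoY m)
    have h3 : (m + 1) * (20 * (2 * s)) * 200 ≤ p := by
      refine le_trans ?_ hKp
      have : m + 1 ≤ 2 * (k * K) := by nlinarith
      calc (m + 1) * (20 * (2 * s)) * 200 ≤ (2 * (k * K)) * (20 * (2 * s)) * 200 := by gcongr
        _ = K * (16000 * k * s) := by ring
        _ ≤ _ := by gcongr; norm_num
    change C.card ≤ (co (m + 1)).card + _ at h1
    omega
  · rw [hXY]
    have hout : ∀ y ∈ Y (m + k), (outn E (P \ Y m) y).card ≤ s := by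
      intro y hy
      rw [hmY] at hy
      obtain ⟨hyP, hyv, hy2⟩ := hy
      obtain ⟨c, hc⟩ := Finset.card_pos.1 (show 0 < (inn E (co (m + k)) y).card by omega)
      rw [mem_inn] at hc
      have hcy := hloop _ _ hc.2
      obtain ⟨x0, B, hpth, hx0, hB, hBF⟩ := exists_path_core (E := E) (h := 2 * s) (C := C) {y}
        (k - 4) (m := m + 4) (c := c) (by rw [Finset.card_singleton]; omega)
        (by rw [show m + 4 + (k - 4) = m + k by omega]; exact hc.1) (by simp [hcy])
      have hyB : y ∉ B := Finset.disjoint_right.1 hBF (by simp)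
      set T := inn E (co (m + 3)) x0 \ insert y B with hT
      have hTc : s ≤ T.card := by
        have h1 : 2 * s < (inn E (co (m + 3)) x0).card := (mem_core_succ.1 hx0).2
        have h2 : _ ≤ T.card := Finset.le_card_sdiff (insert y B) (inn E (co (m + 3)) x0)
        have h3 := Finset.card_insert_le y B
        have h4 := hpth.card_eq
        omega
      have hTco : T ⊆ co (m + 3) := Finset.sdiff_subset.trans (Finset.filter_subset _ _)
      have hTY : T ⊆ Y m := hTco.trans ((core_anti E _ C (by omega)).trans (hcoY m))
      have hBY : B ⊆ Y m := hB.trans ((core_anti E _ C (by omega)).trans (hcoY m))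
      have hcount := h T (hTY.trans ((hYP m).trans hP)) hTc
      have hsub : outn E (P \ Y m) y ⊆
          insert v ((S \ T).filter fun z => 4 * (oneNbr E z ∩ T).card < T.card) := by
        intro x hx
        rw [mem_outn, Finset.mem_sdiff] at hx
        obtain ⟨⟨hxP, hxY⟩, hyx⟩ := hx
        rw [Finset.mem_insert]
        by_cases hxv : x = v
        · exact Or.inl hxv
        right
        rw [Finset.mem_filter]
        refine ⟨Finset.mem_sdiff.2 ⟨hP hxP, fun hxT => hxY (hTY hxT)⟩, ?_⟩
        by_contra! hcon
        have h1 : (inn E (co m) x).card < 2 := by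
          by_contra! h2
          exact hxY ((hmY _ _).2 ⟨hxP, hxv, h2⟩)
        obtain ⟨c', hc', hcn⟩ : ∃ c' ∈ oneNbr E x ∩ T, c' ∉ inn E (co m) x := by
          by_contra! hall
          have := Finset.card_le_card (show oneNbr E x ∩ T ⊆ inn E (co m) x from hall)
          omega
        rw [Finset.mem_inter, mem_oneNbr] at hc'
        rw [mem_inn] at hcn
        have hc'm : c' ∈ co m := core_anti E _ C (by omega) (hTco hc'.2)
        have hxc' : (x, c') ∈ E := by
          rcases hc'.1 with h | h
          · exact h.1
          · exact absurd ⟨hc'm, h.1⟩ hcn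
        have hc'T := hc'.2
        rw [hT, Finset.mem_sdiff, mem_inn, Finset.mem_insert, not_or] at hc'T
        obtain ⟨⟨-, hc'x0⟩, hc'y, hc'B⟩ := hc'T
        have hxB : x ∉ B := fun hx => hxY (hBY hx)
        have hp1 := Pth.cons hc'x0 hc'B hpth
        have hp2 := Pth.cons hxc' (by simp [hloop _ _ hxc', hxB]) hp1
        have hp3 := Pth.cons hyx (by simp [hloop _ _ hyx, Ne.symm hc'y, hyB]) hp2
        exact hfree.no_closed (by omega) (by omega) hp3 hc.2
      have := (Finset.card_le_card hsub).trans (Finset.card_insert_le _ _)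
      omega
    have h1 := card_arcs_le_of_outn hout
    have h2 : (arcs E (Y m \ Y (m + k)) (P \ Y m)).card ≤ (2 * (24000 * k * s)) * p := by
      refine (card_arcs_le_of_outn (h := p) fun z _ => ?_).trans (Nat.mul_le_mul_right _ hdrop)
      exact Finset.card_le_card ((Finset.filter_subset _ _).trans Finset.sdiff_subset)
    have h3 : (arcs E (Y m) (P \ Y m)).card ≤
        (arcs E (Y (m + k)) (P \ Y m)).card + (arcs E (Y m \ Y (m + k)) (P \ Y m)).card := by
      refine (Finset.card_le_card ?_).trans (Finset.card_union_le _ _)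
      rintro ⟨a, b⟩ hab
      rw [mem_arcs] at hab
      rw [Finset.mem_union, mem_arcs, mem_arcs]
      by_cases ha : a ∈ Y (m + k)
      · exact Or.inl ⟨hab.1, ha, hab.2.2⟩
      · exact Or.inr ⟨hab.1, Finset.mem_sdiff.2 ⟨hab.2.1, ha⟩, hab.2.2⟩
    have h4 : (Y (m + k)).card * s ≤ p * s :=
      Nat.mul_le_mul_right _ (Finset.card_le_card (hYP _))
    calc _ ≤ p * s + (2 * (24000 * k * s)) * p := h3.trans (Nat.add_le_add (h1.trans h4) h2)
      _ = _ := by ring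

/-- Typical digraphs are nearly acyclic. -/
theorem bb_le_of_typ {k j s L : ℕ} (hk : 4 ≤ k) {S : Finset (Fin N)} {E : ArcSet N}
    (hE : E ∈ freeOn k S) (h : Typ j s S E) (hjs : j ≤ s) (hks : 2 * k ≤ s)
    (hL : S.card + 2 ≤ 2 ^ L) {P : Finset (Fin N)} (hP : P ⊆ S) :
    bb E P ≤ 6000000 * k * L * s * P.card := by
  set D := 24000 * k with hD
  have key : ∀ t : ℕ, ∀ P ⊆ S, 99 ^ t * P.card ≤ 100 ^ t * (D * s) →
      bb E P ≤ (D + (2 * D + 1) * t) * s * P.card := by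
    have hsmall : ∀ t : ℕ, ∀ P : Finset (Fin N), P.card ≤ D * s →
        bb E P ≤ (D + (2 * D + 1) * t) * s * P.card := by
      intro t P hPc
      refine (bb_le_sq E P).trans ?_
      rw [sq]
      refine Nat.mul_le_mul_right _ (hPc.trans (Nat.mul_le_mul_right _ (by omega)))
    intro t
    induction t with
    | zero =>
      intro P _ hPc
      exact hsmall 0 P (by simpa using hPc)
    | succ t ih =>
      intro P hP hPc
      rcases lt_or_ge P.card (D * s) with hlt | hge
      · exact hsmall _ P hlt.le
      obtain ⟨X, hX, hXc, hYc, harc⟩ := exists_sparse_cut hk hE h hjs hks hP hge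
      have hsum := Finset.card_sdiff_add_card_eq_card hX
      have hb : ∀ q, 100 * q ≤ 99 * P.card → 99 ^ t * q ≤ 100 ^ t * (D * s) := by
        intro q hq
        have : 100 * (99 ^ t * q) ≤ 100 * (100 ^ t * (D * s)) := by
          calc 100 * (99 ^ t * q) = 99 ^ t * (100 * q) := by ring
            _ ≤ 99 ^ t * (99 * P.card) := Nat.mul_le_mul_left _ hq
            _ = 99 ^ (t + 1) * P.card := by ring
            _ ≤ _ := hPc
            _ = _ := by ring
        omega
      have h1 := ih X (hX.trans hP) (hb _ (by omega))
      have h2 := ih (P \ X) (Finset.sdiff_subset.trans hP) (hb _ (by omega))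
      have h3 := bb_le_add E P X
      have h4 : (2 * D + 1) * s * P.card = (48000 * k + 1) * s * P.card := by rw [hD]; ring
      calc bb E P ≤ (D + (2 * D + 1) * t) * s * X.card + (D + (2 * D + 1) * t) * s * (P \ X).card +
            (2 * D + 1) * s * P.card := by omega
        _ = (D + (2 * D + 1) * t) * s * ((P \ X).card + X.card) + (2 * D + 1) * s * P.card := by ring
        _ = _ := by rw [hsum]; ring
  have hL1 : 1 ≤ L := by
    by_contra! h
    have : L = 0 := by omega
    subst this
    simp at hL
  refine (key (70 * L) P hP ?_).trans ?_
  · have h1 : P.card ≤ 2 ^ L := by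
      have := Finset.card_le_card hP
      omega
    have h2 : (99 ^ 70 * 2) ^ L ≤ (100 ^ 70) ^ L := Nat.pow_le_pow_left (by norm_num) L
    calc 99 ^ (70 * L) * P.card ≤ 99 ^ (70 * L) * 2 ^ L := Nat.mul_le_mul_left _ h1
      _ = (99 ^ 70 * 2) ^ L := by rw [mul_pow, pow_mul]
      _ ≤ (100 ^ 70) ^ L := h2
      _ = 100 ^ (70 * L) := by rw [pow_mul]
      _ ≤ _ := Nat.le_mul_of_pos_right _ (Nat.mul_pos (by omega) (by omega))
  · refine Nat.mul_le_mul_right _ (Nat.mul_le_mul_right _ ?_)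
    nlinarith [Nat.mul_le_mul hk hL1]

end

section

variable {N : ℕ}

/-- The reversed digraph. -/
noncomputable def rev (E : ArcSet N) : ArcSet N := E.image Prod.swap

theorem mem_rev {E : ArcSet N} {a b : Fin N} : (a, b) ∈ rev E ↔ (b, a) ∈ E := by
  simp [rev]

theorem rev_rev (E : ArcSet N) : rev (rev E) = E := by
  ext ⟨a, b⟩
  rw [mem_rev, mem_rev]

theorem CkFree.rev {k : ℕ} {E : ArcSet N} (h : CkFree k E) : CkFree k (rev E) := by
  rintro ⟨f, hf, hf'⟩
  refine h ⟨fun i => f (-i), fun i j hij => neg_injective (hf hij), fun i => ?_⟩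
  have := hf' (-(i + 1))
  rw [mem_rev] at this
  simpa using this

theorem rev_mem_freeOn {k : ℕ} {S : Finset (Fin N)} {E : ArcSet N} (h : E ∈ freeOn k S) :
    rev E ∈ freeOn k S := by
  refine mem_freeOn.2 ⟨?_, (mem_freeOn.1 h).2.rev⟩
  rintro ⟨a, b⟩ hab
  rw [mem_rev] at hab
  have := freeOn_ne_of_mem h hab
  exact Finset.mem_offDiag.2 ⟨this.2.1, this.1, this.2.2.symm⟩

theorem oneNbr_rev (E : ArcSet N) (v : Fin N) : oneNbr (rev E) v = oneNbr E v := by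
  ext u
  rw [mem_oneNbr, mem_oneNbr, mem_rev, mem_rev, xor_comm]

theorem Typ.rev {j s : ℕ} {S : Finset (Fin N)} {E : ArcSet N} (h : Typ j s S E) :
    Typ j s S (rev E) := by
  intro I hI hs
  simp only [oneNbr_rev]
  exact h I hI hs

theorem backs_rev {E : ArcSet N} {P : Finset (Fin N)} {r : Fin N → ℕ} {M : ℕ}
    (hM : ∀ z ∈ P, r z ≤ M) :
    (backs (rev E) P fun z => M - r z).card = (backs E P r).card := by
  have : (backs (rev E) P fun z => M - r z) = (backs E P r).image Prod.swap := by
    ext ⟨a, b⟩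
    simp only [Finset.mem_image, Prod.exists, Prod.swap_prod_mk, Prod.mk.injEq, mem_backs, mem_rev]
    constructor
    · rintro ⟨h1, h2, h3, h4⟩
      have := hM a h2
      have := hM b h3
      exact ⟨b, a, ⟨h1, h3, h2, by omega⟩, rfl, rfl⟩
    · rintro ⟨b, a, ⟨h1, h3, h2, h4⟩, rfl, rfl⟩
      exact ⟨h1, h2, h3, by omega⟩
  rw [this, Finset.card_image_of_injective _ Prod.swap_injective]

theorem bb_rev (E : ArcSet N) (P : Finset (Fin N)) : bb (rev E) P = bb E P := by
  have key : ∀ E : ArcSet N, bb (rev E) P ≤ bb E P := by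
    intro E
    obtain ⟨r, hr⟩ := exists_bb E P
    rw [← hr, ← backs_rev (M := ∑ z ∈ P, r z)
      fun z hz => Finset.single_le_sum (fun _ _ => Nat.zero_le _) hz]
    exact bb_le _ _ _
  refine le_antisymm (key E) ?_
  have := key (rev E)
  rwa [rev_rev] at this

/-- An ordering of `P` with the minimum number of backwards arcs. -/
structure Opt (E : ArcSet N) (P : Finset (Fin N)) (pos : Fin N → ℕ) : Prop where
  inj : Set.InjOn pos P
  lt : ∀ z ∈ P, pos z < P.card
  card : (backs E P pos).card = bb E P

theorem exists_opt (E : ArcSet N) (P : Finset (Fin N)) : ∃ pos, Opt E P pos := by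
  obtain ⟨r, hr⟩ := exists_bb E P
  set lt : Fin N → Fin N → Prop := fun w z => r w < r z ∨ r w = r z ∧ w < z with hlt
  have htrans : ∀ a b c, lt a b → lt b c → lt a c := by
    rintro a b c (h | ⟨h, h'⟩) (g | ⟨g, g'⟩)
    · exact Or.inl (h.trans g)
    · exact Or.inl (g ▸ h)
    · exact Or.inl (h ▸ g)
    · exact Or.inr ⟨h.trans g, h'.trans g'⟩
  have hirr : ∀ a, ¬ lt a a := by
    rintro a (h | ⟨-, h⟩)
    · exact lt_irrefl _ h
    · exact lt_irrefl _ h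
  set pos : Fin N → ℕ := fun z => (P.filter fun w => lt w z).card with hpos
  have hmono : ∀ w ∈ P, ∀ z, lt w z → pos w < pos z := by
    intro w hw z hwz
    apply Finset.card_lt_card
    refine ⟨fun x hx => ?_, fun hsub => ?_⟩
    · rw [Finset.mem_filter] at hx ⊢
      exact ⟨hx.1, htrans _ _ _ hx.2 hwz⟩
    · exact hirr w (Finset.mem_filter.1 (hsub (Finset.mem_filter.2 ⟨hw, hwz⟩))).2
  refine ⟨pos, ?_, ?_, ?_⟩
  · intro a ha b hb hab
    by_contra hne
    rcases lt_trichotomy (r a) (r b) with h | h | h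
    · exact (hmono a ha b (Or.inl h)).ne hab
    · rcases lt_or_gt_of_ne hne with h' | h'
      · exact (hmono a ha b (Or.inr ⟨h, h'⟩)).ne hab
      · exact (hmono b hb a (Or.inr ⟨h.symm, h'⟩)).ne' hab
    · exact (hmono b hb a (Or.inl h)).ne' hab
  · intro z hz
    apply Finset.card_lt_card
    refine ⟨Finset.filter_subset _ _, fun hsub => ?_⟩
    exact hirr z (Finset.mem_filter.1 (hsub hz)).2
  · refine le_antisymm ?_ (bb_le _ _ _)
    rw [← hr]
    refine Finset.card_le_card ?_
    rintro ⟨a, b⟩ hab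
    rw [mem_backs] at hab ⊢
    refine ⟨hab.1, hab.2.1, hab.2.2.1, ?_⟩
    by_contra! hcon
    exact (hmono a hab.2.1 b (Or.inl hcon)).not_ge hab.2.2.2

theorem Opt.rev {E : ArcSet N} {P : Finset (Fin N)} {pos : Fin N → ℕ} (h : Opt E P pos) :
    Opt (rev E) P fun z => P.card - 1 - pos z := by
  refine ⟨?_, ?_, ?_⟩
  · intro a ha b hb hab
    have h1 := h.lt a ha
    have h2 := h.lt b hb
    change P.card - 1 - pos a = P.card - 1 - pos b at hab
    exact h.inj ha hb (by omega)
  · intro z hz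
    have := h.lt z hz
    change P.card - 1 - pos z < P.card
    omega
  · rw [backs_rev fun z hz => ?_, h.card, bb_rev]
    have := h.lt z hz
    omega

/-- Intervals of an optimal ordering are optimally ordered. -/
theorem Opt.interval {E : ArcSet N} {P : Finset (Fin N)} {pos : Fin N → ℕ} (h : Opt E P pos)
    (a0 b0 : ℕ) : (backs E (P.filter fun z => a0 ≤ pos z ∧ pos z < b0) pos).card ≤
      bb E (P.filter fun z => a0 ≤ pos z ∧ pos z < b0) := by
  set W := P.filter fun z => a0 ≤ pos z ∧ pos z < b0 with hW
  have hWm : ∀ z, z ∈ W ↔ z ∈ P ∧ a0 ≤ pos z ∧ pos z < b0 := by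
    intro z
    simp only [hW, Finset.mem_filter]
  obtain ⟨r, hr⟩ := exists_bb E W
  set M := ∑ z ∈ P, r z + 1 with hM
  have hlt : ∀ z ∈ P, r z < M := fun z hz =>
    Nat.lt_succ_of_le (Finset.single_le_sum (fun _ _ => Nat.zero_le _) hz)
  have hsub1 : backs E W pos ⊆ backs E P pos := by
    rintro ⟨a, b⟩ hab
    rw [mem_backs] at hab ⊢
    exact ⟨hab.1, ((hWm _).1 hab.2.1).1, ((hWm _).1 hab.2.2.1).1, hab.2.2.2⟩
  have hsub2 : (backs E P fun z => if z ∈ W then M * a0 + r z else M * pos z) ⊆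
      backs E W r ∪ (backs E P pos \ backs E W pos) := by
    rintro ⟨a, b⟩ hab
    rw [mem_backs] at hab
    obtain ⟨h1, h2, h3, h4⟩ := hab
    rw [Finset.mem_union, Finset.mem_sdiff, mem_backs, mem_backs, mem_backs]
    have ea := hlt a h2
    have eb := hlt b h3
    by_cases ha : a ∈ W <;> by_cases hb : b ∈ W <;> simp only [ha, hb, if_true, if_false] at h4
    · exact Or.inl ⟨h1, ha, hb, by omega⟩
    · right
      refine ⟨⟨h1, h2, h3, ?_⟩, fun h => hb h.2.2.1⟩
      rw [hWm] at ha hb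
      have : pos b < a0 + 1 := by
        by_contra! hc
        have := Nat.mul_le_mul_left M hc
        rw [mul_add] at this
        omega
      omega
    · right
      refine ⟨⟨h1, h2, h3, ?_⟩, fun h => ha h.2.1⟩
      rw [hWm] at ha hb
      have : a0 ≤ pos a := Nat.le_of_mul_le_mul_left (by omega : M * a0 ≤ M * pos a) (by omega)
      by_contra! hc
      exact ha ⟨h2, this, by omega⟩
    · right
      exact ⟨⟨h1, h2, h3, Nat.le_of_mul_le_mul_left h4 (by omega)⟩, fun h => ha h.2.1⟩
  have h1 := (bb_le E P _).trans ((Finset.card_le_card hsub2).trans (Finset.card_union_le _ _))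
  have h2 := Finset.card_sdiff_add_card_eq_card hsub1
  have h3 := h.card
  omega

/-- Moving a vertex upwards does not improve an optimal ordering. -/
theorem Opt.move_up {E : ArcSet N} {P : Finset (Fin N)} {pos : Fin N → ℕ} (h : Opt E P pos)
    (hloop : IsLoopless E) {u : Fin N} (hu : u ∈ P) (b : ℕ) :
    (inn E (P.filter fun w => pos u < pos w ∧ pos w ≤ b) u).card ≤
      (outn E (P.filter fun w => pos u < pos w ∧ pos w ≤ b) u).card := by
  set I := P.filter fun w => pos u < pos w ∧ pos w ≤ b with hI
  have hIm : ∀ z, z ∈ I ↔ z ∈ P ∧ pos u < pos z ∧ pos z ≤ b := by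
    intro z
    simp only [hI, Finset.mem_filter]
  rcases lt_or_ge b (pos u) with hb | hb
  · have : I = ∅ := by
      ext z
      simp only [hIm, Finset.notMem_empty, iff_false]
      omega
    rw [this]
    rfl
  have hsub1 : (inn E I u).image (fun w => (w, u)) ⊆ backs E P pos := by
    rintro ⟨x, y⟩ hxy
    rw [Finset.mem_image] at hxy
    obtain ⟨w, hw, heq⟩ := hxy
    simp only [Prod.mk.injEq] at heq
    obtain ⟨rfl, rfl⟩ := heq
    rw [mem_inn, hIm] at hw
    exact mem_backs.2 ⟨hw.2, hw.1.1, hu, hw.1.2.1.le⟩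
  have hsub2 : (backs E P fun z => if z = u then 2 * b + 1 else 2 * pos z) ⊆
      (outn E I u).image (fun w => (u, w)) ∪
        (backs E P pos \ (inn E I u).image (fun w => (w, u))) := by
    rintro ⟨x, y⟩ hxy
    rw [mem_backs] at hxy
    obtain ⟨h1, h2, h3, h4⟩ := hxy
    have hne : x ≠ y := fun e => hloop x (by rwa [← e] at h1)
    simp only [Finset.mem_union, Finset.mem_sdiff, mem_backs, Finset.mem_image, Prod.mk.injEq,
      mem_outn, mem_inn, hIm]
    by_cases hx : x = u
    · subst hx
      simp only [if_true, if_neg hne.symm] at h4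
      by_cases hy : pos x < pos y
      · exact Or.inl ⟨y, ⟨⟨h3, hy, by omega⟩, h1⟩, rfl, rfl⟩
      · refine Or.inr ⟨⟨h1, h2, h3, by omega⟩, ?_⟩
        rintro ⟨w, -, rfl, e⟩
        exact hne e
    · by_cases hy : y = u
      · subst hy
        simp only [if_true, if_neg hx] at h4
        refine Or.inr ⟨⟨h1, h2, h3, by omega⟩, ?_⟩
        rintro ⟨w, hw, rfl, -⟩
        omega
      · simp only [if_neg hx, if_neg hy] at h4
        refine Or.inr ⟨⟨h1, h2, h3, by omega⟩, ?_⟩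
        rintro ⟨w, hw, rfl, e⟩
        exact hy e.symm
  have h1 := (bb_le E P _).trans ((Finset.card_le_card hsub2).trans (Finset.card_union_le _ _))
  have h2 := Finset.card_sdiff_add_card_eq_card hsub1
  have h3 := h.card
  rw [Finset.card_image_of_injective _ fun _ _ e => (Prod.mk.inj e).1] at h2
  rw [Finset.card_image_of_injective _ fun _ _ e => (Prod.mk.inj e).2] at h1
  omega

/-- Moving a vertex downwards does not improve an optimal ordering. -/
theorem Opt.move_down {E : ArcSet N} {P : Finset (Fin N)} {pos : Fin N → ℕ} (h : Opt E P pos)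
    (hloop : IsLoopless E) {u : Fin N} (hu : u ∈ P) (b : ℕ) :
    (outn E (P.filter fun w => b ≤ pos w ∧ pos w < pos u) u).card ≤
      (inn E (P.filter fun w => b ≤ pos w ∧ pos w < pos u) u).card := by
  have hloop' : IsLoopless (_root_.rev E) := fun v hv => hloop v (mem_rev.1 hv)
  have h1 := h.rev.move_up hloop' hu (P.card - 1 - b)
  rcases lt_or_ge (pos u) b with hb | hb
  · have : (P.filter fun w => b ≤ pos w ∧ pos w < pos u) = ∅ := by
      ext z
      simp only [Finset.mem_filter, Finset.notMem_empty, iff_false]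
      omega
    rw [this]
    rfl
  have hu' := h.lt u hu
  have e : (P.filter fun w => P.card - 1 - pos u < P.card - 1 - pos w ∧
      P.card - 1 - pos w ≤ P.card - 1 - b) = P.filter fun w => b ≤ pos w ∧ pos w < pos u := by
    ext z
    simp only [Finset.mem_filter]
    constructor
    · rintro ⟨hz, h1, h2⟩
      have := h.lt z hz
      exact ⟨hz, by omega, by omega⟩
    · rintro ⟨hz, h1, h2⟩
      have := h.lt z hz
      exact ⟨hz, by omega, by omega⟩
  rw [e] at h1
  have e1 : ∀ I, inn (_root_.rev E) I u = outn E I u := by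
    intro I
    ext z
    rw [mem_inn, mem_outn, mem_rev]
  have e2 : ∀ I, outn (_root_.rev E) I u = inn E I u := by
    intro I
    ext z
    rw [mem_inn, mem_outn, mem_rev]
  rwa [e1, e2] at h1

theorem exists_threshold {α : Type*} {A : Finset α} {pos : α → ℕ} (hinj : Set.InjOn pos A)
    {y : ℕ} (hy : y ≤ A.card) : ∃ b, (A.filter fun z => pos z < b).card = y := by
  have hex : ∃ b, y ≤ (A.filter fun z => pos z < b).card := by
    refine ⟨∑ z ∈ A, pos z + 1, ?_⟩
    rw [Finset.filter_true_of_mem]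
    · exact hy
    · intro z hz
      exact Nat.lt_succ_of_le (Finset.single_le_sum (fun _ _ => Nat.zero_le _) hz)
  refine ⟨Nat.find hex, le_antisymm ?_ (Nat.find_spec hex)⟩
  rcases Nat.eq_zero_or_pos (Nat.find hex) with h0 | h0
  · rw [h0]
    simp
  · have h1 := Nat.find_min hex (Nat.sub_lt h0 one_pos)
    set b := Nat.find hex - 1 with hb
    have hb' : Nat.find hex = b + 1 := by omega
    rw [hb']
    have h2 : (A.filter fun z => pos z < b + 1) ⊆
        (A.filter fun z => pos z < b) ∪ (A.filter fun z => pos z = b) := by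
      intro z hz
      simp only [Finset.mem_union, Finset.mem_filter] at hz ⊢
      rcases lt_or_eq_of_le (Nat.lt_succ_iff.1 hz.2) with h | h
      · exact Or.inl ⟨hz.1, h⟩
      · exact Or.inr ⟨hz.1, h⟩
    have h3 : (A.filter fun z => pos z = b).card ≤ 1 := by
      rw [Finset.card_le_one]
      intro x hx z hz
      rw [Finset.mem_filter] at hx hz
      exact hinj hx.1 hz.1 (hx.2.trans hz.2.symm)
    have h4 := (Finset.card_le_card h2).trans (Finset.card_union_le _ _)
    omega

theorem exists_chop {α : Type*} {A : Finset α} {pos : α → ℕ} (hinj : Set.InjOn pos A)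
    {m y : ℕ} (hy : m * y ≤ A.card) (hy1 : 1 ≤ y) :
    ∃ T : ℕ → Finset α, (∀ i < m, T i ⊆ A ∧ y ≤ (T i).card) ∧
      ∀ i < m, ∀ i' < m, i < i' → ∀ z ∈ T i, ∀ z' ∈ T i', pos z < pos z' := by
  have hex : ∀ i, ∃ b, i ≤ m → (A.filter fun z => pos z < b).card = i * y := by
    intro i
    by_cases hi : i ≤ m
    · obtain ⟨b, hb⟩ := exists_threshold hinj ((Nat.mul_le_mul_right y hi).trans hy)
      exact ⟨b, fun _ => hb⟩
    · exact ⟨0, fun h => absurd h hi⟩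
  choose b hb using hex
  have hmono : ∀ i i', i' ≤ m → i ≤ i' → b i ≤ b i' := by
    intro i i' hi' hii
    by_contra! hlt
    rcases eq_or_lt_of_le hii with rfl | hii
    · exact lt_irrefl _ hlt
    have h1 : (A.filter fun z => pos z < b i') ⊆ A.filter fun z => pos z < b i :=
      Finset.monotone_filter_right _ fun z _ hz => hz.trans hlt
    have h2 := Finset.card_le_card h1
    rw [hb i (by omega), hb i' hi'] at h2
    have := Nat.le_of_mul_le_mul_right h2 (by omega)
    omega
  refine ⟨fun i => A.filter fun z => b i ≤ pos z ∧ pos z < b (i + 1), fun i hi => ?_, ?_⟩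
  · refine ⟨Finset.filter_subset _ _, ?_⟩
    have h1 : (A.filter fun z => pos z < b (i + 1)) ⊆
        (A.filter fun z => pos z < b i) ∪ A.filter fun z => b i ≤ pos z ∧ pos z < b (i + 1) := by
      intro z hz
      simp only [Finset.mem_union, Finset.mem_filter] at hz ⊢
      rcases lt_or_ge (pos z) (b i) with h | h
      · exact Or.inl ⟨hz.1, h⟩
      · exact Or.inr ⟨hz.1, h, hz.2⟩
    have h2 := (Finset.card_le_card h1).trans (Finset.card_union_le _ _)
    rw [hb i hi.le, hb (i + 1) hi, add_mul] at h2
    change y ≤ (A.filter fun z => b i ≤ pos z ∧ pos z < b (i + 1)).card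
    omega
  · intro i _ i' hi' hii z hz z' hz'
    rw [Finset.mem_filter] at hz hz'
    exact hz.2.2.trans_le ((hmono (i + 1) i' hi'.le hii).trans hz'.2.1)

/-- Forward paths through consecutive sets. -/
theorem exists_forward_path {j s : ℕ} {S : Finset (Fin N)} {E : ArcSet N} (h : Typ j s S E)
    {pos : Fin N → ℕ} {W : Finset (Fin N)} (hW : W ⊆ S) {y r : ℕ} (hs : s ≤ y) (hj : 2 * j ≤ y)
    (hβ : 8 * (backs E W pos).card < y ^ 2) {T : ℕ → Finset (Fin N)}
    (hT : ∀ i ≤ r, T i ⊆ W ∧ 2 * y ≤ (T i).card)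
    (hord : ∀ i ≤ r, ∀ i' ≤ r, i < i' → ∀ z ∈ T i, ∀ z' ∈ T i', pos z < pos z') :
    ∃ x ∈ T 0, ∃ z ∈ T r, ∃ A, Pth E r x z A ∧ ∀ w ∈ A, ∃ i ≤ r, w ∈ T i := by
  have key : ∀ i ≤ r, ∃ R ⊆ T i, y ≤ R.card ∧ ∀ z ∈ R, ∃ x ∈ T 0, ∃ A, Pth E i x z A ∧
      ∀ w ∈ A, ∃ i' ≤ i, w ∈ T i' := by
    intro i
    induction i with
    | zero =>
      intro h0
      refine ⟨T 0, subset_rfl, by have := (hT 0 h0).2; omega, fun z hz => ?_⟩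
      exact ⟨z, hz, {z}, Pth.nil z, fun w hw => ⟨0, le_rfl, Finset.mem_singleton.1 hw ▸ hz⟩⟩
    | succ i ih =>
      intro hi
      obtain ⟨R, hR, hRc, hRp⟩ := ih (by omega)
      refine ⟨(T (i + 1)).filter fun z => ∃ w ∈ R, (w, z) ∈ E, Finset.filter_subset _ _, ?_, ?_⟩
      · by_contra! hlt
        set A := (T (i + 1)).filter fun z => ¬ ∃ w ∈ R, (w, z) ∈ E with hA
        have hAm : ∀ z, z ∈ A ↔ z ∈ T (i + 1) ∧ ¬ ∃ w ∈ R, (w, z) ∈ E := by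
          intro z; simp only [hA, Finset.mem_filter]
        have hAc : y ≤ A.card := by
          have h1 := Finset.card_filter_add_card_filter_not (s := T (i + 1))
            (fun z => ∃ w ∈ R, (w, z) ∈ E)
          have h2 := (hT (i + 1) hi).2
          change _ + A.card = _ at h1
          omega
        have hAT : A ⊆ T (i + 1) := Finset.filter_subset _ _
        have hAW := hAT.trans (hT (i + 1) hi).1
        have hRW := hR.trans (hT i (by omega)).1
        have hlt' : ∀ z ∈ R, ∀ z' ∈ A, pos z < pos z' := fun z hz z' hz' =>
          hord i (by omega) (i + 1) hi (by omega) z (hR hz) z' (hAT hz')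
        have hd : Disjoint R A := Finset.disjoint_left.2 fun z hz hz' =>
          (hlt' z hz z hz').ne rfl
        have h1 := h.card_pairs (hRW.trans hW) (hAW.trans hW) hd (hs.trans hAc)
        have h2 : (arcs E R A).card = 0 := by
          rw [Finset.card_eq_zero, Finset.eq_empty_iff_forall_notMem]
          rintro ⟨a, b⟩ hab
          rw [mem_arcs] at hab
          exact ((hAm b).1 hab.2.2).2 ⟨a, hab.2.1, hab.1⟩
        have h3 : (arcs E A R).card ≤ (backs E W pos).card := by
          refine Finset.card_le_card ?_
          rintro ⟨a, b⟩ hab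
          rw [mem_arcs] at hab
          exact mem_backs.2 ⟨hab.1, hAW hab.2.1, hRW hab.2.2, (hlt' b hab.2.2 a hab.2.1).le⟩
        have h4 : (y - j) * y ≤ (R.card - j) * A.card := Nat.mul_le_mul (by omega) hAc
        have h5 : y * y ≤ 2 * ((y - j) * y) := by
          rw [← mul_assoc]
          exact Nat.mul_le_mul_right _ (by omega)
        rw [sq] at hβ
        omega
      · intro z hz
        rw [Finset.mem_filter] at hz
        obtain ⟨hz, w, hw, hwz⟩ := hz
        obtain ⟨x, hx, A, hp, hA⟩ := hRp w hw
        refine ⟨x, hx, insert z A, hp.snoc hwz ?_, ?_⟩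
        · intro hzA
          obtain ⟨i', hi', hzi⟩ := hA z hzA
          exact (hord i' (by omega) (i + 1) hi (by omega) z hzi z hz).ne rfl
        · intro q hq
          rcases Finset.mem_insert.1 hq with rfl | hq
          · exact ⟨i + 1, le_rfl, hz⟩
          · obtain ⟨i', hi', hqi⟩ := hA q hq
            exact ⟨i', by omega, hqi⟩
  obtain ⟨R, hR, hRc, hRp⟩ := key r le_rfl
  have hy : 0 < y := by
    by_contra! h0
    have : y = 0 := by omega
    subst this
    simp at hβ
  obtain ⟨z, hz⟩ := Finset.card_pos.1 (hy.trans_le hRc)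
  obtain ⟨x, hx, A, hp, hA⟩ := hRp z hz
  exact ⟨x, hx, z, hR hz, A, hp, hA⟩

/-- No vertex receives many backwards arcs. -/
theorem Opt.card_back_in {k j s : ℕ} (hk : 4 ≤ k) {S : Finset (Fin N)} {E : ArcSet N}
    (hE : E ∈ freeOn k S) (h : Typ j s S E) {pos : Fin N → ℕ} (ho : Opt E S pos) {y : ℕ}
    (hs : s ≤ y) (hj : 2 * j ≤ y) (hβ : 8 * bb E S < y ^ 2) {u : Fin N} (hu : u ∈ S) :
    (inn E (S.filter fun w => pos u < pos w) u).card ≤ 4 * k * y := by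
  by_contra! hcon
  have hloop : IsLoopless E := fun v hv => (freeOn_ne_of_mem hE hv).2.2 rfl
  have hy1 : 1 ≤ y := by
    by_contra! h0
    have : y = 0 := by omega
    subst this
    simp at hβ
  set D := inn E (S.filter fun w => pos u < pos w) u with hD
  have hDm : ∀ z, z ∈ D ↔ (z ∈ S ∧ pos u < pos z) ∧ (z, u) ∈ E := by
    intro z
    rw [hD, mem_inn, Finset.mem_filter]
  have hDS : D ⊆ S := fun z hz => ((hDm z).1 hz).1.1
  have hsmall : (k - 2) * (2 * y) + 2 * y ≤ D.card := by
    have : (k - 2) * (2 * y) + 2 * y ≤ k * (2 * y) + k * (2 * y) :=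
      Nat.add_le_add (Nat.mul_le_mul_right _ (by omega)) (Nat.le_mul_of_pos_left _ (by omega))
    have e : k * (2 * y) + k * (2 * y) = 4 * k * y := by ring
    omega
  obtain ⟨b, hb⟩ := exists_threshold (ho.inj.mono hDS) (y := (k - 2) * (2 * y)) (by omega)
  have hb0 : 1 ≤ b := by
    by_contra! h0
    have : b = 0 := by omega
    subst this
    simp only [Nat.not_lt_zero, Finset.filter_false, Finset.card_empty] at hb
    have := Nat.mul_pos (show 0 < k - 2 by omega) (show 0 < 2 * y by omega)
    omega
  have hmove := ho.move_up hloop hu (b - 1)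
  set I := S.filter fun w => pos u < pos w ∧ pos w ≤ b - 1 with hI
  have hIm : ∀ z, z ∈ I ↔ z ∈ S ∧ pos u < pos z ∧ pos z ≤ b - 1 := by
    intro z; simp only [hI, Finset.mem_filter]
  have hin : (D.filter fun z => pos z < b) ⊆ inn E I u := by
    intro z hz
    rw [Finset.mem_filter, hDm] at hz
    rw [mem_inn, hIm]
    exact ⟨⟨hz.1.1.1, hz.1.1.2, by omega⟩, hz.1.2⟩
  have hA := (Finset.card_le_card hin).trans hmove
  rw [hb] at hA
  set A := outn E I u with hAdef
  have hAm : ∀ z, z ∈ A ↔ (z ∈ S ∧ pos u < pos z ∧ pos z ≤ b - 1) ∧ (u, z) ∈ E := by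
    intro z; rw [hAdef, mem_outn, hIm]
  have hAS : A ⊆ S := fun z hz => ((hAm z).1 hz).1.1
  obtain ⟨T, hT, hord⟩ := exists_chop (ho.inj.mono hAS) hA (by omega)
  set T' : ℕ → Finset (Fin N) := fun i => if i < k - 2 then T i else D.filter fun z => b ≤ pos z
    with hT'
  have hlow : ∀ i < k - 2, T' i = T i := fun i hi => by simp only [hT', if_pos hi]
  have hhigh : T' (k - 2) = D.filter fun z => b ≤ pos z := by simp [hT']
  have hcard : 2 * y ≤ (D.filter fun z => b ≤ pos z).card := by
    have h1 := Finset.card_filter_add_card_filter_not (s := D) (fun z => pos z < b)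
    simp only [not_lt] at h1
    omega
  obtain ⟨x, hx, z, hz, B, hp, hB⟩ := exists_forward_path h (pos := pos) (W := S) subset_rfl
    (r := k - 2) hs hj (by rw [ho.card]; exact hβ) (T := T') (by
      intro i hi
      rcases lt_or_eq_of_le hi with hi | rfl
      · rw [hlow i hi]
        exact ⟨(hT i hi).1.trans hAS, (hT i hi).2⟩
      · rw [hhigh]
        exact ⟨(Finset.filter_subset _ _).trans hDS, hcard⟩) (by
      intro i hi i' hi' hii w hw w' hw'
      rw [hlow i (by omega)] at hw
      rcases lt_or_eq_of_le hi' with hi' | rfl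
      · rw [hlow i' hi'] at hw'
        exact hord i (by omega) i' hi' hii w hw w' hw'
      · rw [hhigh, Finset.mem_filter] at hw'
        have := ((hAm w).1 ((hT i hii).1 hw)).1.2.2
        omega)
  rw [hlow 0 (by omega)] at hx
  rw [hhigh, Finset.mem_filter, hDm] at hz
  have huB : u ∉ B := by
    intro huB
    obtain ⟨i, hi, hui⟩ := hB u huB
    rcases lt_or_eq_of_le hi with hi | rfl
    · rw [hlow i hi] at hui
      exact lt_irrefl _ ((hAm u).1 ((hT i hi).1 hui)).1.2.1
    · rw [hhigh, Finset.mem_filter, hDm] at hui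
      exact lt_irrefl _ hui.1.1.2
  have hux := ((hAm x).1 ((hT 0 (by omega)).1 hx)).2
  exact (mem_freeOn.1 hE).2.no_closed (by omega) (by omega) (Pth.cons hux huB hp) hz.1.2

/-- No vertex sends many backwards arcs. -/
theorem Opt.card_back_out {k j s : ℕ} (hk : 4 ≤ k) {S : Finset (Fin N)} {E : ArcSet N}
    (hE : E ∈ freeOn k S) (h : Typ j s S E) {pos : Fin N → ℕ} (ho : Opt E S pos) {y : ℕ}
    (hs : s ≤ y) (hj : 2 * j ≤ y) (hβ : 8 * bb E S < y ^ 2) {u : Fin N} (hu : u ∈ S) :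
    (outn E (S.filter fun w => pos w < pos u) u).card ≤ 4 * k * y := by
  refine le_trans (Finset.card_le_card ?_)
    (ho.rev.card_back_in hk (rev_mem_freeOn hE) h.rev hs hj (by rwa [bb_rev]) hu)
  intro z hz
  rw [mem_outn, Finset.mem_filter] at hz
  rw [mem_inn, Finset.mem_filter, mem_rev]
  have h1 := ho.lt u hu
  exact ⟨⟨hz.1.1, by omega⟩, hz.2⟩

end

section

variable {N : ℕ}

theorem Opt.card_interval {E : ArcSet N} {S : Finset (Fin N)} {pos : Fin N → ℕ}
    (h : Opt E S pos) {a b : ℕ} (hb : b ≤ S.card) :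
    (S.filter fun z => a ≤ pos z ∧ pos z < b).card = b - a := by
  have himg : S.image pos = Finset.range S.card := by
    refine Finset.eq_of_subset_of_card_le ?_ ?_
    · intro x hx
      obtain ⟨z, hz, rfl⟩ := Finset.mem_image.1 hx
      exact Finset.mem_range.2 (h.lt z hz)
    · rw [Finset.card_range, Finset.card_image_of_injOn h.inj]
  have : (S.filter fun z => a ≤ pos z ∧ pos z < b).image pos = Finset.Ico a b := by
    ext x
    simp only [Finset.mem_image, Finset.mem_filter, Finset.mem_Ico]
    constructor
    · rintro ⟨z, hz, rfl⟩
      exact hz.2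
    · intro hx
      have : x ∈ S.image pos := by
        rw [himg]
        exact Finset.mem_range.2 (hx.2.trans_le hb)
      obtain ⟨z, hz, rfl⟩ := Finset.mem_image.1 this
      exact ⟨z, ⟨hz, hx⟩, rfl⟩
  rw [← Nat.card_Ico, ← this, Finset.card_image_of_injOn]
  exact h.inj.mono (Finset.filter_subset _ _)

theorem Opt.card_interval_le {E : ArcSet N} {S : Finset (Fin N)} {pos : Fin N → ℕ}
    (h : Opt E S pos) (a b : ℕ) :
    (S.filter fun z => a ≤ pos z ∧ pos z < b).card ≤ b - a := by
  rw [← Nat.card_Ico, ← Finset.card_image_of_injOn (h.inj.mono (Finset.filter_subset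
    (fun z => a ≤ pos z ∧ pos z < b) S))]
  refine Finset.card_le_card fun x hx => ?_
  obtain ⟨z, hz, rfl⟩ := Finset.mem_image.1 hx
  exact Finset.mem_Ico.2 (Finset.mem_filter.1 hz).2

theorem oneNbr_inter_subset (E : ArcSet N) (C : Finset (Fin N)) (u : Fin N) :
    oneNbr E u ∩ C ⊆ inn E C u ∪ outn E C u := by
  intro z hz
  rw [Finset.mem_inter, mem_oneNbr] at hz
  rw [Finset.mem_union, mem_inn, mem_outn]
  rcases hz.1 with h | h
  · exact Or.inr ⟨hz.2, h.1⟩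
  · exact Or.inl ⟨hz.2, h.1⟩

/-- A vertex regular to an interval not far above it has many out-neighbours there. -/
theorem Opt.le_card_outn {E : ArcSet N} {S : Finset (Fin N)} {pos : Fin N → ℕ}
    (h : Opt E S pos) (hloop : IsLoopless E) {u : Fin N} (hu : u ∈ S) {lo hi c : ℕ}
    (h1 : pos u < lo) (h2 : lo ≤ pos u + c + 1) (h3 : hi ≤ S.card) (h4 : lo + 16 * c ≤ hi)
    (hreg : (S.filter fun z => lo ≤ pos z ∧ pos z < hi).card ≤
      4 * (oneNbr E u ∩ S.filter fun z => lo ≤ pos z ∧ pos z < hi).card) :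
    c ≤ (outn E (S.filter fun z => lo ≤ pos z ∧ pos z < hi) u).card := by
  rw [h.card_interval h3] at hreg
  have hup := h.move_up hloop hu (hi - 1)
  set I := S.filter fun z => lo ≤ pos z ∧ pos z < hi with hI
  set J := S.filter fun w => pos u < pos w ∧ pos w ≤ hi - 1 with hJ
  have hIm : ∀ z, z ∈ I ↔ z ∈ S ∧ lo ≤ pos z ∧ pos z < hi := fun z => by
    simp only [hI, Finset.mem_filter]
  have hJm : ∀ z, z ∈ J ↔ z ∈ S ∧ pos u < pos z ∧ pos z ≤ hi - 1 := fun z => by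
    simp only [hJ, Finset.mem_filter]
  have hIJ : I ⊆ J := fun z hz => by
    rw [hIm] at hz
    rw [hJm]
    exact ⟨hz.1, by omega, by omega⟩
  have h5 : (oneNbr E u ∩ I).card ≤ (inn E J u).card + (outn E J u).card :=
    (Finset.card_le_card ((oneNbr_inter_subset E I u).trans (Finset.union_subset_union
      (inn_mono hIJ u) (Finset.filter_subset_filter _ hIJ)))).trans (Finset.card_union_le _ _)
  have h6 : outn E J u ⊆ outn E I u ∪ S.filter fun z => pos u + 1 ≤ pos z ∧ pos z < lo := by
    intro z hz
    rw [mem_outn, hJm] at hz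
    simp only [Finset.mem_union, mem_outn, hIm, Finset.mem_filter]
    rcases lt_or_ge (pos z) lo with h' | h'
    · exact Or.inr ⟨hz.1.1, hz.1.2.1, h'⟩
    · exact Or.inl ⟨⟨hz.1.1, h', by omega⟩, hz.2⟩
  have h7 := (Finset.card_le_card h6).trans (Finset.card_union_le _ _)
  have h8 := h.card_interval_le (pos u + 1) lo
  omega

/-- A vertex regular to an interval not far below it has many in-neighbours there. -/
theorem Opt.le_card_inn {E : ArcSet N} {S : Finset (Fin N)} {pos : Fin N → ℕ}
    (h : Opt E S pos) (hloop : IsLoopless E) {v : Fin N} (hv : v ∈ S) {lo hi c : ℕ}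
    (h1 : hi ≤ pos v) (h2 : pos v ≤ hi + c) (h4 : lo + 16 * c ≤ hi)
    (hreg : (S.filter fun z => lo ≤ pos z ∧ pos z < hi).card ≤
      4 * (oneNbr E v ∩ S.filter fun z => lo ≤ pos z ∧ pos z < hi).card) :
    c ≤ (inn E (S.filter fun z => lo ≤ pos z ∧ pos z < hi) v).card := by
  rw [h.card_interval (h1.trans (h.lt v hv).le)] at hreg
  have hup := h.move_down hloop hv lo
  set I := S.filter fun z => lo ≤ pos z ∧ pos z < hi with hI
  set J := S.filter fun w => lo ≤ pos w ∧ pos w < pos v with hJ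
  have hIm : ∀ z, z ∈ I ↔ z ∈ S ∧ lo ≤ pos z ∧ pos z < hi := fun z => by
    simp only [hI, Finset.mem_filter]
  have hJm : ∀ z, z ∈ J ↔ z ∈ S ∧ lo ≤ pos z ∧ pos z < pos v := fun z => by
    simp only [hJ, Finset.mem_filter]
  have hIJ : I ⊆ J := fun z hz => by
    rw [hIm] at hz
    rw [hJm]
    exact ⟨hz.1, by omega, by omega⟩
  have h5 : (oneNbr E v ∩ I).card ≤ (inn E J v).card + (outn E J v).card :=
    (Finset.card_le_card ((oneNbr_inter_subset E I v).trans (Finset.union_subset_union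
      (inn_mono hIJ v) (Finset.filter_subset_filter _ hIJ)))).trans (Finset.card_union_le _ _)
  have h6 : inn E J v ⊆ inn E I v ∪ S.filter fun z => hi ≤ pos z ∧ pos z < pos v := by
    intro z hz
    rw [mem_inn, hJm] at hz
    simp only [Finset.mem_union, mem_inn, hIm, Finset.mem_filter]
    rcases lt_or_ge (pos z) hi with h' | h'
    · exact Or.inl ⟨⟨hz.1.1, hz.1.2.1, h'⟩, hz.2⟩
    · exact Or.inr ⟨hz.1.1, h', hz.1.2.2⟩
  have h7 := (Finset.card_le_card h6).trans (Finset.card_union_le _ _)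
  have h8 := h.card_interval_le hi (pos v)
  omega

/-- The vertices outside `I` with few single-arc neighbours in `I`. -/
noncomputable def irr (E : ArcSet N) (S I : Finset (Fin N)) : Finset (Fin N) :=
  (S \ I).filter fun z => 4 * (oneNbr E z ∩ I).card < I.card

/-- Sixteen consecutive cells of length `c`. -/
noncomputable def blk (S : Finset (Fin N)) (pos : Fin N → ℕ) (c a : ℕ) : Finset (Fin N) :=
  S.filter fun z => a * c ≤ pos z ∧ pos z < (a + 16) * c

theorem mem_blk {S : Finset (Fin N)} {pos : Fin N → ℕ} {c a : ℕ} {z : Fin N} :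
    z ∈ blk S pos c a ↔ z ∈ S ∧ a * c ≤ pos z ∧ pos z < (a + 16) * c := by
  simp only [blk, Finset.mem_filter]

/-- There are no long backwards arcs between regular vertices. -/
theorem Opt.no_long {k j s : ℕ} (hk : 4 ≤ k) {S : Finset (Fin N)} {E : ArcSet N}
    (hE : E ∈ freeOn k S) (h : Typ j s S E) {pos : Fin N → ℕ} (ho : Opt E S pos) {y β : ℕ}
    (hs : s ≤ y) (hj : 2 * j ≤ y) (hy : 1 ≤ y) (hβ : ∀ W ⊆ S, bb E W ≤ β * W.card)
    (hβy : 40 * (k + 40) * β < y) {u v : Fin N} (hvu : (v, u) ∈ E)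
    (h1 : pos u + (k + 40) * (2 * y) ≤ pos v) (h2 : pos v ≤ pos u + 2 * (k + 40) * (2 * y))
    (hu : u ∉ irr E S (blk S pos (2 * y) (pos u / (2 * y) + 1)))
    (hv : v ∉ irr E S (blk S pos (2 * y) (pos v / (2 * y) - 16))) : False := by
  have hmem := freeOn_ne_of_mem hE hvu
  have hloop : IsLoopless E := fun a ha => (freeOn_ne_of_mem hE ha).2.2 rfl
  set c := 2 * y with hc
  have hc1 : 1 ≤ c := by omega
  set a := pos u / c with ha
  set b := pos v / c with hb
  have hua : a * c ≤ pos u := Nat.div_mul_le_self _ _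
  have hua' : pos u < (a + 1) * c := Nat.lt_mul_of_div_lt (Nat.lt_succ_self _) hc1
  have hvb : b * c ≤ pos v := Nat.div_mul_le_self _ _
  have hvb' : pos v < (b + 1) * c := Nat.lt_mul_of_div_lt (Nat.lt_succ_self _) hc1
  clear_value a b
  have hab : a + k + 40 < b + 1 := by
    have : (a + (k + 40)) * c < (b + 1) * c := by
      rw [add_mul]
      omega
    have := lt_of_mul_lt_mul_right this (Nat.zero_le _)
    omega
  have hvn := ho.lt v hmem.1
  have hmono : ∀ m m' : ℕ, m ≤ m' → m * c ≤ m' * c := fun m m' h => Nat.mul_le_mul_right c h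
  have hout : c ≤ (outn E (blk S pos c (a + 1)) u).card := by
    have h17 := hmono (a + 1 + 16) b (by omega)
    refine ho.le_card_outn hloop hmem.2.1 hua' ?_ (by omega) ?_ ?_
    · rw [add_mul]
      omega
    · rw [add_mul (a + 1)]
    · by_contra! hcon
      refine hu (Finset.mem_filter.2 ⟨Finset.mem_sdiff.2 ⟨hmem.2.1, fun hm => ?_⟩, hcon⟩)
      have := (mem_blk.1 hm).2.1
      omega
  have hinn : c ≤ (inn E (blk S pos c (b - 16)) v).card := by
    have hb16 : b - 16 + 16 = b := by omega
    refine ho.le_card_inn hloop hmem.1 ?_ ?_ ?_ ?_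
    · rwa [hb16]
    · rw [hb16]
      rw [add_mul] at hvb'
      omega
    · rw [add_mul (b - 16)]
    · by_contra! hcon
      refine hv (Finset.mem_filter.2 ⟨Finset.mem_sdiff.2 ⟨hmem.1, fun hm => ?_⟩, hcon⟩)
      have := (mem_blk.1 hm).2.2
      rw [hb16] at this
      omega
  set W := S.filter fun z => pos u + 1 ≤ pos z ∧ pos z < pos v with hW
  have hWm : ∀ z, z ∈ W ↔ z ∈ S ∧ pos u + 1 ≤ pos z ∧ pos z < pos v := fun z => by
    simp only [hW, Finset.mem_filter]
  have hback : 8 * (backs E W pos).card < y ^ 2 := by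
    have e1 := ho.interval (pos u + 1) (pos v)
    have e2 := hβ W (Finset.filter_subset _ _)
    have e3 : W.card ≤ 4 * (k + 40) * y := by
      have := ho.card_interval_le (pos u + 1) (pos v)
      have e : 2 * (k + 40) * c = 4 * (k + 40) * y := by
        rw [hc]
        ring
      change W.card ≤ _ at this
      omega
    have e4 : β * W.card ≤ β * (4 * (k + 40) * y) := Nat.mul_le_mul_left β e3
    have e5 : 40 * (k + 40) * β * y < y * y := Nat.mul_lt_mul_of_pos_right hβy (by omega)
    change (backs E W pos).card ≤ bb E W at e1
    have e6 : 8 * (β * (4 * (k + 40) * y)) ≤ 40 * (k + 40) * β * y := by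
      nlinarith [Nat.zero_le ((k + 40) * β * y)]
    calc 8 * (backs E W pos).card ≤ 8 * (β * (4 * (k + 40) * y)) := by omega
      _ ≤ _ := e6
      _ < _ := e5
      _ = y ^ 2 := by ring
  let T : ℕ → Finset (Fin N) := fun i =>
    if i = 0 then outn E (blk S pos c (a + 1)) u else
      if i = k - 3 then inn E (blk S pos c (b - 16)) v else
        S.filter fun z => (a + 16 + i) * c ≤ pos z ∧ pos z < (a + 17 + i) * c
  have hTm : ∀ i ≤ k - 3, ∀ z ∈ T i, z ∈ S ∧
      (if i = 0 then a + 1 else if i = k - 3 then b - 16 else a + 16 + i) * c ≤ pos z ∧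
      pos z < (if i = k - 3 then b else a + 17 + i) * c := by
    intro i hi z hz
    simp only [T] at hz
    split_ifs at hz with c1 c2
    · subst c1
      rw [mem_outn, mem_blk] at hz
      have : ¬ 0 = k - 3 := by omega
      simp only [if_neg this, if_true]
      exact ⟨hz.1.1, hz.1.2.1, by simpa [add_assoc] using hz.1.2.2⟩
    · rw [mem_inn, mem_blk] at hz
      have hb16 : b - 16 + 16 = b := by omega
      rw [hb16] at hz
      simp only [if_neg c1, if_pos c2]
      exact hz.1
    · rw [Finset.mem_filter] at hz
      simp only [if_neg c1, if_neg c2]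
      exact hz
  have hTW : ∀ i ≤ k - 3, T i ⊆ W := by
    intro i hi z hz
    obtain ⟨e1, e2, e3⟩ := hTm i hi z hz
    rw [hWm]
    have e4 := hmono (a + 1) (if i = 0 then a + 1 else if i = k - 3 then b - 16 else a + 16 + i)
      (by split_ifs <;> omega)
    have e5 := hmono (if i = k - 3 then b else a + 17 + i) b (by split_ifs <;> omega)
    exact ⟨e1, by omega, by omega⟩
  have hTc : ∀ i ≤ k - 3, 2 * y ≤ (T i).card := by
    intro i hi
    simp only [T]
    split_ifs with c1 c2
    · exact hout
    · exact hinn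
    · rw [ho.card_interval]
      · rw [← Nat.sub_mul]
        have : a + 17 + i - (a + 16 + i) = 1 := by omega
        rw [this, one_mul]
      · have := hmono (a + 17 + i) b (by omega)
        omega
  have hTo : ∀ i ≤ k - 3, ∀ i' ≤ k - 3, i < i' → ∀ z ∈ T i, ∀ z' ∈ T i', pos z < pos z' := by
    intro i hi i' hi' hii z hz z' hz'
    have e1 := (hTm i hi z hz).2.2
    have e2 := (hTm i' hi' z' hz').2.1
    have e3 := hmono (if i = k - 3 then b else a + 17 + i)
      (if i' = 0 then a + 1 else if i' = k - 3 then b - 16 else a + 16 + i')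
      (by split_ifs <;> omega)
    omega
  obtain ⟨x, hx, z, hz, A, hP, hA⟩ := exists_forward_path (r := k - 3) (T := T) h
    (Finset.filter_subset _ _) hs hj hback (fun i hi => ⟨hTW i hi, hTc i hi⟩) hTo
  have hAW : ∀ w ∈ A, pos u + 1 ≤ pos w ∧ pos w < pos v := fun w hw => by
    obtain ⟨i, hi, hwi⟩ := hA w hw
    exact ((hWm w).1 (hTW i hi hwi)).2
  have hux : (u, x) ∈ E := by
    simp only [T, if_true] at hx
    exact (mem_outn.1 hx).2
  have hzv : (z, v) ∈ E := by
    have : ¬ k - 3 = 0 := by omega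
    simp only [T, if_neg this, if_true] at hz
    exact (mem_inn.1 hz).2
  have p1 : Pth E (k - 3 + 1) u z (insert u A) :=
    Pth.cons hux (fun hm => by have := hAW u hm; omega) hP
  have p2 := p1.snoc hzv (fun hm => by
    rw [Finset.mem_insert] at hm
    rcases hm with hm | hm
    · exact hmem.2.2 hm
    · have := hAW v hm
      omega)
  exact (mem_freeOn.1 hE).2.no_closed (by omega) (by omega) p2 hvu

end

section

variable {N : ℕ}

/-- A balanced cut with few arcs going from `S \ X` to `X`, all of them in special position. -/
structure GoodCut (k t q r M : ℕ) (S : Finset (Fin N)) (E : ArcSet N) (X : Finset (Fin N)) :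
    Prop where
  subset : X ⊆ S
  card : X.card = S.card / 2
  arcs_le : (arcs E (S \ X) X).card ≤ r
  kap_le : kap k X (rst E X) ≤ M
  kap_le' : kap k (S \ X) (rst E (S \ X)) ≤ M
  cover : ∃ U ⊆ S, U.card ≤ t ∧ ∃ Q ⊆ S, Q.card ≤ q ∧
    ∀ y ∈ S \ X, ∀ x ∈ X, (y, x) ∈ E → y ∈ U ∨ x ∈ U ∨ y ∈ Q ∧ x ∈ Q

theorem Typ.card_indep_le {j s : ℕ} {S : Finset (Fin N)} {E : ArcSet N} (h : Typ j s S E)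
    (hj : j ≤ s) (hs : 1 ≤ s) {W : Finset (Fin N)} (hW : W ⊆ S) (hi : Indep E W) :
    W.card ≤ 2 * s := by
  by_contra! hcon
  obtain ⟨I, hIW, hI⟩ := Finset.exists_subset_card_eq (show s ≤ W.card by omega)
  have h1 := h I (hIW.trans hW) hI.ge
  have h2 : W \ I ⊆ (S \ I).filter fun z => 4 * (oneNbr E z ∩ I).card < I.card := by
    intro z hz
    rw [Finset.mem_sdiff] at hz
    refine Finset.mem_filter.2 ⟨Finset.mem_sdiff.2 ⟨hW hz.1, hz.2⟩, ?_⟩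
    have : oneNbr E z ∩ I = ∅ := by
      refine Finset.eq_empty_of_forall_notMem fun w hw => ?_
      rw [Finset.mem_inter, mem_oneNbr] at hw
      rcases hw.1 with h' | h'
      · exact hi z hz.1 w (hIW hw.2) h'.1
      · exact hi w (hIW hw.2) z hz.1 h'.1
    rw [this, Finset.card_empty]
    omega
  have h3 := Finset.card_le_card h2
  have h4 := Finset.card_sdiff_add_card_eq_card hIW
  omega

theorem Typ.kap_rst_le {k j s L : ℕ} (hk : 3 ≤ k) {S : Finset (Fin N)} {E : ArcSet N}
    (hE : E ∈ freeOn k S) (h : Typ j s S E) (hj : j ≤ s) (hs : 1 ≤ s)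
    (hL : S.card + 2 ≤ 2 ^ L) {X : Finset (Fin N)} (hX : X ⊆ S) :
    kap k X (rst E X) ≤ 2 ^ (L * (k * (2 * k + 1) * (2 * s))) := by
  have h1 : kap k X (rst E X) ≤ (X.card + 1) ^ (k * (2 * k + 1) * (2 * s)) := by
    refine kap_le_pow fun T hT hTl => ?_
    obtain ⟨W, hWT, hWi, hc⟩ := hTl.exists_indep hk
      fun a ha => (freeOn_ne_of_mem hE (rst_subset E X ha)).2.2 rfl
    have : Indep E W := fun a ha b hb hab =>
      hWi a ha b hb (mem_rst.2 ⟨hab, hT (hWT ha), hT (hWT hb)⟩)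
    exact hc.trans (Nat.mul_le_mul_left _ (h.card_indep_le hj hs ((hWT.trans hT).trans hX) this))
  refine h1.trans ?_
  rw [pow_mul 2]
  refine Nat.pow_le_pow_left ?_ _
  have := Finset.card_le_card hX
  omega

theorem exists_scale {e d : ℕ} (h : e ≤ d) : ∀ m : ℕ, d < e * 2 ^ m →
    ∃ i < m, e * 2 ^ i ≤ d ∧ d < 2 * (e * 2 ^ i)
  | 0, hm => by
    rw [pow_zero, mul_one] at hm
    omega
  | m + 1, hm => by
    rcases lt_or_ge d (e * 2 ^ m) with h' | h'
    · obtain ⟨i, hi, h1⟩ := exists_scale h m h'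
      exact ⟨i, by omega, h1⟩
    · refine ⟨m, Nat.lt_succ_self _, h', ?_⟩
      rw [pow_succ] at hm
      linarith

theorem Opt.back_le {k j s y : ℕ} (hk : 4 ≤ k) {S : Finset (Fin N)} {E : ArcSet N}
    (hE : E ∈ freeOn k S) (h : Typ j s S E) {pos : Fin N → ℕ} (ho : Opt E S pos)
    (hs : s ≤ y) (hj : 2 * j ≤ y) (hβ : 8 * bb E S < y ^ 2) {X U Q : Finset (Fin N)}
    (hX : X ⊆ S) (hlt : ∀ x ∈ X, ∀ y ∈ S \ X, pos x < pos y) (hU : U ⊆ S)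
    (hcov : ∀ y ∈ S \ X, ∀ x ∈ X, (y, x) ∈ E → y ∈ U ∨ x ∈ U ∨ y ∈ Q ∧ x ∈ Q) :
    (arcs E (S \ X) X).card ≤ Q.card ^ 2 + U.card * (8 * k * y) := by
  have hsub : arcs E (S \ X) X ⊆ Q ×ˢ Q ∪ U.biUnion fun u =>
      ((inn E (S.filter fun w => pos u < pos w) u).image fun w => (w, u)) ∪
        ((outn E (S.filter fun w => pos w < pos u) u).image fun w => (u, w)) := by
    rintro ⟨b, a⟩ hba
    rw [mem_arcs] at hba
    obtain ⟨hE', hb, ha⟩ := hba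
    have hab := hlt a ha b hb
    rw [Finset.mem_union, Finset.mem_biUnion]
    rcases hcov b hb a ha hE' with h' | h' | h'
    · refine Or.inr ⟨b, h', Finset.mem_union_right _ (Finset.mem_image.2 ⟨a, ?_, rfl⟩)⟩
      exact mem_outn.2 ⟨Finset.mem_filter.2 ⟨hX ha, hab⟩, hE'⟩
    · refine Or.inr ⟨a, h', Finset.mem_union_left _ (Finset.mem_image.2 ⟨b, ?_, rfl⟩)⟩
      exact mem_inn.2 ⟨Finset.mem_filter.2 ⟨(Finset.mem_sdiff.1 hb).1, hab⟩, hE'⟩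
    · exact Or.inl (Finset.mem_product.2 h')
  refine (Finset.card_le_card hsub).trans ((Finset.card_union_le _ _).trans ?_)
  rw [Finset.card_product, sq]
  refine Nat.add_le_add_left (Finset.card_biUnion_le_card_mul _ _ _ fun u hu => ?_) _
  refine (Finset.card_union_le _ _).trans ?_
  have h1 := ho.card_back_in hk hE h hs hj hβ (hU hu)
  have h2 := ho.card_back_out hk hE h hs hj hβ (hU hu)
  have h3 := Finset.card_image_le (s := inn E (S.filter fun w => pos u < pos w) u)
    (f := fun w => (w, u))
  have h4 := Finset.card_image_le (s := outn E (S.filter fun w => pos w < pos u) u)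
    (f := fun w => (u, w))
  linarith

set_option maxHeartbeats 800000 in
/-- Typical digraphs have good cuts. -/
theorem exists_goodCut {k j s j' s' L y z : ℕ} (hk : 4 ≤ k) {S : Finset (Fin N)} {E : ArcSet N}
    (hE : E ∈ freeOn k S) (h : Typ j s S E) (h' : Typ j' s' S E) (hjs : j ≤ s)
    (hks : 2 * k ≤ s) (hjs' : j' ≤ s') (hs' : 1 ≤ s') (hL : S.card + 2 ≤ 2 ^ L)
    (hsy : s ≤ y) (hjy : 2 * j ≤ y) (hy : 40 * (k + 40) * (6000000 * k * L * s) < y)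
    (hsz : s ≤ z) (hjz : 2 * j ≤ z) (hz : 8 * (6000000 * k * L * s * S.card) < z ^ 2) :
    ∃ X, GoodCut k (L * (4 * (k + 40) + 2) * j) (4 * (k + 40) * y)
      ((4 * (k + 40) * y) ^ 2 + L * (4 * (k + 40) + 2) * j * (8 * k * z))
      (2 ^ (L * (k * (2 * k + 1) * (2 * s')))) S E X := by
  have hbb : ∀ W ⊆ S, bb E W ≤ 6000000 * k * L * s * W.card := fun W hW =>
    bb_le_of_typ hk hE h hjs hks hL hW
  obtain ⟨pos, ho⟩ := exists_opt E S
  set B := k + 40 with hB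
  set p := S.card / 2 with hp
  set X := S.filter fun z => 0 ≤ pos z ∧ pos z < p with hX
  have hXm : ∀ z, z ∈ X ↔ z ∈ S ∧ pos z < p := fun z => by
    simp only [hX, Finset.mem_filter, Nat.zero_le, true_and]
  have hXS : X ⊆ S := Finset.filter_subset _ _
  set c : ℕ → ℕ := fun i => 2 * (y * 2 ^ i) with hc
  set J : ℕ → Finset ℕ := fun i =>
    (Finset.Icc (p / c i - 2 * B) (p / c i + 2 * B + 1)).filter fun a =>
      s ≤ (blk S pos (c i) a).card with hJ
  set U := (Finset.range L).biUnion fun i => (J i).biUnion fun a => irr E S (blk S pos (c i) a)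
    with hU
  set Q := S.filter fun z => p - 2 * B * y ≤ pos z ∧ pos z < p + 2 * B * y with hQ
  have hUS : U ⊆ S := by
    intro u hu
    obtain ⟨i, _, hu⟩ := Finset.mem_biUnion.1 hu
    obtain ⟨a, _, hu⟩ := Finset.mem_biUnion.1 hu
    exact (Finset.mem_sdiff.1 (Finset.mem_filter.1 hu).1).1
  have hUc : U.card ≤ L * (4 * B + 2) * j := by
    have : U.card ≤ (Finset.range L).card * ((4 * B + 2) * j) := by
      refine Finset.card_biUnion_le_card_mul _ _ _ fun i _ => ?_
      refine (Finset.card_biUnion_le_card_mul _ _ j fun a ha => ?_).trans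
        (Nat.mul_le_mul_right j ?_)
      · exact (h _ (Finset.filter_subset _ _) (Finset.mem_filter.1 ha).2).le
      · refine (Finset.card_filter_le _ _).trans ?_
        rw [Nat.card_Icc]
        omega
    rwa [Finset.card_range, ← mul_assoc] at this
  have hQc : Q.card ≤ 4 * B * y := by
    refine (ho.card_interval_le _ _).trans ?_
    rw [mul_assoc 4, mul_assoc 2]
    omega
  have hlt : ∀ x ∈ X, ∀ w ∈ S \ X, pos x < pos w := by
    intro x hx w hw
    rw [Finset.mem_sdiff, hXm] at hw
    rw [hXm] at hx
    have : ¬ pos w < p := fun h => hw.2 ⟨hw.1, h⟩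
    omega
  have hcov : ∀ v ∈ S \ X, ∀ u ∈ X, (v, u) ∈ E → v ∈ U ∨ u ∈ U ∨ v ∈ Q ∧ u ∈ Q := by
    intro v hv u hu hvu
    by_contra hcon
    push Not at hcon
    rw [Finset.mem_sdiff, hXm] at hv
    rw [hXm] at hu
    have hpv : p ≤ pos v := by
      by_contra! h
      exact hv.2 ⟨hv.1, h⟩
    have hvn := ho.lt v hv.1
    have hfar : B * (2 * y) ≤ pos v - pos u := by
      by_contra! hn
      have e : B * (2 * y) = 2 * B * y := by ring
      rw [e] at hn
      exact hcon.2.2 (Finset.mem_filter.2 ⟨hv.1, by omega, by omega⟩)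
        (Finset.mem_filter.2 ⟨hu.1, by omega, by omega⟩)
    have hy1 : 1 ≤ y := by omega
    have hB1 : 1 ≤ B * (2 * y) := Nat.mul_pos (by omega) (by omega)
    obtain ⟨i, hiL, hi1, hi2⟩ := exists_scale hfar L (by
      have := Nat.mul_le_mul_right (2 ^ L) hB1
      omega)
    have hyi : y ≤ y * 2 ^ i := Nat.le_mul_of_pos_right _ (by positivity)
    have hci : c i = 2 * (y * 2 ^ i) := rfl
    have e1 : B * (2 * y) * 2 ^ i = B * c i := by rw [hci]; ring
    rw [e1] at hi1 hi2
    have hc1 : 0 < c i := by omega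
    have hBc : 44 * c i ≤ B * c i := Nat.mul_le_mul_right _ (by omega)
    set a := pos u / c i with ha
    set b := pos v / c i with hb
    have hua : a * c i ≤ pos u := Nat.div_mul_le_self _ _
    have hua' : pos u < (a + 1) * c i := Nat.lt_mul_of_div_lt (Nat.lt_succ_self _) hc1
    have hvb : b * c i ≤ pos v := Nat.div_mul_le_self _ _
    have hvb' : pos v < (b + 1) * c i := Nat.lt_mul_of_div_lt (Nat.lt_succ_self _) hc1
    have hpa : a ≤ p / c i := Nat.div_le_div_right hu.2.le
    have hpb : p / c i ≤ b := Nat.div_le_div_right hpv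
    have hpa' : p / c i ≤ a + 2 * B := by
      rw [ha, ← Nat.add_mul_div_right _ _ hc1]
      refine Nat.div_le_div_right ?_
      rw [mul_assoc]
      omega
    have hpb' : b ≤ p / c i + 2 * B := by
      rw [← Nat.add_mul_div_right _ _ hc1]
      refine Nat.div_le_div_right ?_
      rw [mul_assoc]
      omega
    have hb16 : 16 ≤ b := by
      rw [hb, Nat.le_div_iff_mul_le hc1]
      omega
    have hbsub : b - 16 + 16 = b := Nat.sub_add_cancel hb16
    clear_value a b
    have m1 : p / c i - 2 * B ≤ a + 1 :=
      tsub_le_iff_right.2 (hpa'.trans (Nat.add_le_add_right (Nat.le_succ a) _))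
    have m2 : a + 1 ≤ p / c i + 2 * B + 1 := Nat.succ_le_succ (hpa.trans (Nat.le_add_right _ _))
    have m3 : p / c i - 2 * B ≤ b - 16 :=
      by clear * - hpb hB; omega
    have m4 : b - 16 ≤ p / c i + 2 * B + 1 :=
      (Nat.sub_le _ _).trans (hpb'.trans (Nat.le_succ _))
    refine ho.no_long (y := y * 2 ^ i) hk hE h (hsy.trans hyi) (hjy.trans hyi)
      (hy1.trans hyi) hbb (hy.trans_le hyi) hvu ?_ ?_ (fun hirr => ?_) fun hirr => ?_
    · change pos u + B * c i ≤ pos v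
      omega
    · change pos v ≤ pos u + 2 * B * c i
      rw [mul_assoc]
      omega
    · refine hcon.2.1 (Finset.mem_biUnion.2 ⟨i, Finset.mem_range.2 hiL, Finset.mem_biUnion.2
        ⟨a + 1, Finset.mem_filter.2 ⟨Finset.mem_Icc.2 ⟨m1, m2⟩, ?_⟩, by rw [ha]; exact hirr⟩⟩)
      rw [blk, ho.card_interval, ← Nat.sub_mul]
      · rw [Nat.add_sub_cancel_left]
        clear * - hsy hyi hci
        omega
      · rw [add_mul, add_mul]
        have e2 : pos u + B * c i ≤ pos v := by omega
        linarith
    · refine hcon.1 (Finset.mem_biUnion.2 ⟨i, Finset.mem_range.2 hiL, Finset.mem_biUnion.2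
        ⟨b - 16, Finset.mem_filter.2 ⟨Finset.mem_Icc.2 ⟨m3, m4⟩, ?_⟩, by rw [hb]; exact hirr⟩⟩)
      rw [blk, ho.card_interval, ← Nat.sub_mul]
      · rw [Nat.add_sub_cancel_left]
        clear * - hsy hyi hci
        omega
      · rw [hbsub]
        exact hvb.trans hvn.le
  have hr := ho.back_le hk hE h hsz hjz
    ((Nat.mul_le_mul_left 8 (hbb S subset_rfl)).trans_lt hz) hXS hlt hUS hcov
  refine ⟨X, hXS, ?_, hr.trans ?_, h'.kap_rst_le (by omega) hE hjs' hs' hL hXS,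
    h'.kap_rst_le (by omega) hE hjs' hs' hL Finset.sdiff_subset, U, hUS, hUc, Q,
    Finset.filter_subset _ _, hQc, hcov⟩
  · rw [hX, ho.card_interval (Nat.div_le_self _ _), Nat.sub_zero]
  · exact Nat.add_le_add (Nat.pow_le_pow_left hQc 2) (Nat.mul_le_mul_right _ hUc)

end

section

variable {N : ℕ}

/-- A bipartite graph with no complete bipartite subgraph with sides of size `h` is sparse. -/
theorem card_le_of_biclique_free {α : Type*} {A B : Finset α} {D : Finset (α × α)}
    (hD : D ⊆ A ×ˢ B) {h m d : ℕ}
    (hfree : ∀ A' ⊆ A, ∀ B' ⊆ B, A'.card = h → B'.card = h → ¬ A' ×ˢ B' ⊆ D)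
    (hm : 1 ≤ m) (hmd : 2 * h * B.card ≤ m * d) (hd : 2 * h * m ^ h ≤ d) :
    D.card ≤ m * B.card + A.card * d := by
  set dg : α → ℕ := fun x => (B.filter fun y => (x, y) ∈ D).card with hdg
  set H := A.filter fun x => d < dg x with hH
  have hHm : H.card < m := by
    by_contra! hcon
    obtain ⟨H', hH', hc⟩ := Finset.exists_subset_card_eq hcon
    set cd : α → ℕ := fun y => (H'.filter fun x => (x, y) ∈ D).card with hcd
    have e1 : ∑ y ∈ B, cd y = ∑ x ∈ H', dg x := by
      simp only [hcd, hdg, Finset.card_filter]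
      exact Finset.sum_comm
    have e2 : m * (d + 1) ≤ ∑ x ∈ H', dg x := by
      rw [← hc, ← smul_eq_mul]
      exact Finset.card_nsmul_le_sum _ _ _ fun x hx => (Finset.mem_filter.1 (hH' hx)).2
    set Y := B.filter fun y => h ≤ cd y with hY
    have e3 : ∑ y ∈ B, cd y ≤ Y.card * m + B.card * h := by
      have h1 : ∀ y ∈ B, cd y ≤ (if h ≤ cd y then m else 0) + h := by
        intro y _
        have : cd y ≤ m := hc ▸ Finset.card_filter_le _ _
        split_ifs <;> omega
      refine (Finset.sum_le_sum h1).trans ?_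
      rw [Finset.sum_add_distrib, ← Finset.sum_filter, Finset.sum_const, Finset.sum_const,
        smul_eq_mul, smul_eq_mul]
    have e4 : d < 2 * Y.card := by
      have : m * d < m * (2 * Y.card) := by nlinarith
      exact lt_of_mul_lt_mul_left this (Nat.zero_le _)
    have e5 : ∀ y ∈ Y, ∃ T, T ∈ H'.powersetCard h ∧ ∀ x ∈ T, (x, y) ∈ D := by
      intro y hy
      obtain ⟨T, hT, hTc⟩ := Finset.exists_subset_card_eq (Finset.mem_filter.1 hy).2
      exact ⟨T, Finset.mem_powersetCard.2 ⟨hT.trans (Finset.filter_subset _ _), hTc⟩,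
        fun x hx => (Finset.mem_filter.1 (hT hx)).2⟩
    choose! T hT hTD using e5
    have e6 : (H'.powersetCard h).card * h ≤ Y.card := by
      rw [Finset.card_powersetCard, hc]
      have := Nat.mul_le_mul_right h (Nat.choose_le_pow m h)
      nlinarith
    have hYne : Y.Nonempty := by
      rw [← Finset.card_pos]
      omega
    obtain ⟨y0, hy0⟩ := hYne
    obtain ⟨A', hA', hfib⟩ := Finset.exists_le_card_fiber_of_mul_le_card_of_maps_to hT
      ⟨T y0, hT y0 hy0⟩ e6
    obtain ⟨B', hB', hBc⟩ := Finset.exists_subset_card_eq hfib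
    rw [Finset.mem_powersetCard] at hA'
    refine hfree A' (hA'.1.trans (hH'.trans (Finset.filter_subset _ _))) B' ?_ hA'.2 hBc ?_
    · exact fun y hy => (Finset.mem_filter.1 (Finset.mem_filter.1 (hB' hy)).1).1
    · rintro ⟨x, y⟩ hxy
      rw [Finset.mem_product] at hxy
      have hy := Finset.mem_filter.1 (hB' hxy.2)
      exact hTD y hy.1 x (hy.2 ▸ hxy.1)
  have e1 : D.card ≤ ∑ x ∈ A, dg x := by
    have : D ⊆ A.biUnion fun x => (B.filter fun y => (x, y) ∈ D).image fun y => (x, y) := by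
      rintro ⟨x, y⟩ hxy
      have := Finset.mem_product.1 (hD hxy)
      exact Finset.mem_biUnion.2 ⟨x, this.1, Finset.mem_image.2
        ⟨y, Finset.mem_filter.2 ⟨this.2, hxy⟩, rfl⟩⟩
    refine (Finset.card_le_card this).trans (Finset.card_biUnion_le.trans ?_)
    exact Finset.sum_le_sum fun x _ => Finset.card_image_le
  have e2 : ∀ x ∈ A, dg x ≤ (if d < dg x then B.card else 0) + d := by
    intro x _
    have : dg x ≤ B.card := Finset.card_filter_le _ _
    split_ifs <;> omega
  refine e1.trans ((Finset.sum_le_sum e2).trans ?_)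
  rw [Finset.sum_add_distrib, ← Finset.sum_filter, Finset.sum_const, Finset.sum_const,
    smul_eq_mul, smul_eq_mul]
  exact Nat.add_le_add_right (Nat.mul_le_mul_right _ hHm.le) _

theorem Pth.of_fun {E : ArcSet N} (g : ℕ → Fin N) : ∀ m : ℕ,
    (∀ i ≤ m, ∀ j ≤ m, g i = g j → i = j) → (∀ i < m, (g i, g (i + 1)) ∈ E) →
    Pth E m (g 0) (g m) ((Finset.range (m + 1)).image g)
  | 0, _, _ => by simpa using Pth.nil (E := E) (g 0)
  | m + 1, hinj, harc => by
    have ih := Pth.of_fun g m (fun i hi j hj => hinj i (by omega) j (by omega))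
      fun i hi => harc i (by omega)
    have := ih.snoc (harc m (Nat.lt_succ_self _)) (fun hm => by
      obtain ⟨i, hi, hgi⟩ := Finset.mem_image.1 hm
      have := Finset.mem_range.1 hi
      have := hinj i (by omega) (m + 1) le_rfl hgi
      omega)
    rwa [Finset.range_add_one (n := m + 1), Finset.image_insert]

theorem exists_enum {α : Type*} {A : Finset α} {h : ℕ} (hA : A.card = h) (hh : 1 ≤ h) :
    ∃ a : ℕ → α, (∀ i < h, a i ∈ A) ∧ ∀ i < h, ∀ j < h, a i = a j → i = j := by
  obtain ⟨x, hx⟩ := Finset.card_pos.1 (by omega : 0 < A.card)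
  refine ⟨fun i => if hi : i < A.card then A.equivFin.symm ⟨i, hi⟩ else x, fun i hi => ?_,
    fun i hi j hj hij => ?_⟩
  · simp only [dif_pos (hA ▸ hi : i < A.card)]
    exact Finset.coe_mem _
  · simp only [dif_pos (hA ▸ hi : i < A.card), dif_pos (hA ▸ hj : j < A.card)] at hij
    simpa using A.equivFin.symm.injective (Subtype.ext hij)

/-- The pairs flexible across a cut contain no complete bipartite graph on `k` vertices. -/
theorem Flex.not_biclique {k h : ℕ} (hk : 4 ≤ k) (hh : k = 2 * h) {S : Finset (Fin N)}
    {𝒢 : Finset (ArcSet N)} (h𝒢 : 𝒢 ⊆ freeOn k S) {D : ArcSet N} (hD : Flex 𝒢 D)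
    {A' B' : Finset (Fin N)} (hd : Disjoint A' B') (hA : A'.card = h) (hB : B'.card = h) :
    ¬ A' ×ˢ B' ⊆ D := by
  intro hsub
  obtain ⟨a, haA, hai⟩ := exists_enum hA (by omega)
  obtain ⟨b, hbB, hbi⟩ := exists_enum hB (by omega)
  have hab : ∀ i < h, ∀ j < h, a i ≠ b j := fun i hi j hj =>
    Finset.disjoint_left.1 hd |> fun hdl he => hdl (haA i hi) (he ▸ hbB j hj)
  have hmem : ∀ i < h, ∀ j < h, (a i, b j) ∈ D := fun i hi j hj =>
    hsub (Finset.mem_product.2 ⟨haA i hi, hbB j hj⟩)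
  set O := (Finset.range h).image fun i => (a ((i + 1) % h), b i) with hO
  have hmod : ∀ i, i % h < h := fun i => Nat.mod_lt _ (by omega)
  obtain ⟨E, hE, h1, h2⟩ := hD O (by
    intro e he
    obtain ⟨i, hi, rfl⟩ := Finset.mem_image.1 he
    exact hmem _ (hmod _) _ (Finset.mem_range.1 hi))
  have hE1 : ∀ i < h, (a i, b i) ∈ E := by
    intro i hi
    refine h1 _ (hmem i hi i hi) fun hmO => ?_
    obtain ⟨j, hj, hje⟩ := Finset.mem_image.1 hmO
    rw [Prod.mk.injEq] at hje
    have hj := Finset.mem_range.1 hj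
    have e1 := hbi j hj i hi hje.2
    subst e1
    have e2 := hai _ (hmod _) j hj hje.1
    rcases Nat.lt_or_ge (j + 1) h with hlt | hge
    · rw [Nat.mod_eq_of_lt hlt] at e2
      omega
    · have : j + 1 = h := by omega
      rw [this, Nat.mod_self] at e2
      omega
  have hE2 : ∀ i < h, (b i, a ((i + 1) % h)) ∈ E := fun i hi =>
    h2 (a ((i + 1) % h), b i) (Finset.mem_image.2 ⟨i, Finset.mem_range.2 hi, rfl⟩)
  let g : ℕ → Fin N := fun i => if i % 2 = 0 then a (i / 2) else b (i / 2)
  have hg : Pth E (k - 1) (g 0) (g (k - 1)) ((Finset.range (k - 1 + 1)).image g) := by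
    refine Pth.of_fun g _ (fun i hi j hj hij => ?_) fun i hi => ?_
    · simp only [g] at hij
      split_ifs at hij with c1 c2 c2
      · have := hai _ (by omega) _ (by omega) hij
        omega
      · exact absurd hij (hab _ (by omega) _ (by omega))
      · exact absurd hij.symm (hab _ (by omega) _ (by omega))
      · have := hbi _ (by omega) _ (by omega) hij
        omega
    · simp only [g]
      split_ifs with c1 c2 c2
      · omega
      · have : (i + 1) / 2 = i / 2 := by omega
        rw [this]
        exact hE1 _ (by omega)
      · have e : (i + 1) / 2 = (i / 2 + 1) % h := by
          rw [Nat.mod_eq_of_lt (by omega)]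
          omega
        rw [e]
        exact hE2 _ (by omega)
      · omega
  refine (mem_freeOn.1 (h𝒢 hE)).2.no_closed (by omega) (by omega) hg ?_
  have c1 : ¬ (k - 1) % 2 = 0 := by omega
  have c2 : (k - 1) / 2 = h - 1 := by omega
  have := hE2 (h - 1) (by omega)
  rw [Nat.sub_add_cancel (by omega), Nat.mod_self] at this
  simpa only [g, c1, c2, if_false, Nat.zero_mod, Nat.zero_div, if_true] using this

end

section

variable {N : ℕ}

/-- The stars of the pairs flexible across a cut are unlinked. -/
theorem Flex.noLink_left {k : ℕ} (hk : 4 ≤ k) {S X : Finset (Fin N)} {𝒢 : Finset (ArcSet N)}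
    (h𝒢 : 𝒢 ⊆ freeOn k S) {B : ArcSet N} (hB : ∀ E ∈ 𝒢, rst E (S \ X) = B) {D : ArcSet N}
    (hD : Flex 𝒢 D) {u : Fin N} (hu : u ∈ X) {T : Finset (Fin N)} (hT : ∀ w ∈ T, (u, w) ∈ D) :
    NoLink k B T := by
  intro w hw w' hw' A hP
  have hne := hP.ne (by omega)
  obtain ⟨E, hE, h1, h2⟩ := hD {(u, w')} (by
    intro e he
    rw [Finset.mem_singleton.1 he]
    exact hT w' hw')
  have e1 : (u, w) ∈ E := h1 _ (hT w hw) (by simpa using hne)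
  have e2 : (w', u) ∈ E := h2 (u, w') (Finset.mem_singleton_self _)
  have hBE : B ⊆ E := hB E hE ▸ rst_subset _ _
  have hBX : B ⊆ (S \ X).offDiag := hB E hE ▸ (mem_freeOn.1 (rst_mem_freeOn (h𝒢 hE))).1
  have hA := hP.subset (by omega) hBX
  refine (mem_freeOn.1 (h𝒢 hE)).2.no_closed (by omega) (by omega)
    (Pth.cons e1 (fun hm => ?_) (hP.mono hBE)) e2
  exact (Finset.mem_sdiff.1 (hA hm)).2 hu

theorem Flex.noLink_right {k : ℕ} (hk : 4 ≤ k) {S X : Finset (Fin N)} {𝒢 : Finset (ArcSet N)}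
    (h𝒢 : 𝒢 ⊆ freeOn k S) {B : ArcSet N} (hB : ∀ E ∈ 𝒢, rst E X = B) {D : ArcSet N}
    (hD : Flex 𝒢 D) {u : Fin N} (hu : u ∉ X) {T : Finset (Fin N)} (hT : ∀ w ∈ T, (w, u) ∈ D) :
    NoLink k B T := by
  intro w hw w' hw' A hP
  have hne := hP.ne (by omega)
  obtain ⟨E, hE, h1, h2⟩ := hD {(w, u)} (by
    intro e he
    rw [Finset.mem_singleton.1 he]
    exact hT w hw)
  have e1 : (w', u) ∈ E := h1 _ (hT w' hw') (by simpa using hne.symm)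
  have e2 : (u, w) ∈ E := h2 (w, u) (Finset.mem_singleton_self _)
  have hBE : B ⊆ E := hB E hE ▸ rst_subset _ _
  have hBX : B ⊆ X.offDiag := hB E hE ▸ (mem_freeOn.1 (rst_mem_freeOn (h𝒢 hE))).1
  have hA := hP.subset (by omega) hBX
  refine (mem_freeOn.1 (h𝒢 hE)).2.no_closed (by omega) (by omega)
    (Pth.cons e2 (fun hm => hu (hA hm)) (hP.mono hBE)) e1

/-- The number of ways to join two fixed digraphs across a cut with special position data. -/
theorem card_cut_fiber_le {k h : ℕ} (hk : 4 ≤ k) (hh : k = 2 * h) {S X U Q : Finset (Fin N)}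
    {A B : ArcSet N} {t q M m d : ℕ} (hU : U.card ≤ t) (hQ : Q.card ≤ q)
    (hA : kap k X A ≤ M) (hB : kap k (S \ X) B ≤ M)
    (hm : 1 ≤ m) (hmd : 2 * h * q ≤ m * d) (hd : 2 * h * m ^ h ≤ d) :
    ((freeOn k S).filter fun E => rst E X = A ∧ rst E (S \ X) = B ∧
      ∀ y ∈ S \ X, ∀ x ∈ X, (y, x) ∈ E → y ∈ U ∨ x ∈ U ∨ y ∈ Q ∧ x ∈ Q).card ≤
      2 ^ (X.card * (S \ X).card) * (M ^ t * (q ^ 2 + 1) ^ ((m + d) * q)) := by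
  set 𝒢 := (freeOn k S).filter fun E => rst E X = A ∧ rst E (S \ X) = B ∧
      ∀ y ∈ S \ X, ∀ x ∈ X, (y, x) ∈ E → y ∈ U ∨ x ∈ U ∨ y ∈ Q ∧ x ∈ Q with h𝒢
  have hG : ∀ E, E ∈ 𝒢 ↔ E ∈ freeOn k S ∧ rst E X = A ∧ rst E (S \ X) = B ∧
      ∀ y ∈ S \ X, ∀ x ∈ X, (y, x) ∈ E → y ∈ U ∨ x ∈ U ∨ y ∈ Q ∧ x ∈ Q := fun E => by
    rw [h𝒢, Finset.mem_filter]
  have hGs : 𝒢 ⊆ freeOn k S := Finset.filter_subset _ _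
  set P := X ×ˢ (S \ X) with hP
  have hXY : Disjoint X (S \ X) := Finset.disjoint_sdiff
  have h1 : 𝒢.card ≤ P.powerset.card * (P.powerset.filter (Flex 𝒢)).card := by
    refine card_le_mul_card_flex (P := P) (fun E hE E' hE' e he hes hee => ?_)
      fun E _ => Finset.mem_powerset.2 (Finset.filter_subset _ _)
    obtain ⟨a, b⟩ := e
    have hab := freeOn_ne_of_mem (hGs hE) hee
    have hE1 := (hG E).1 hE
    have hE1' := (hG E').1 hE'
    have c1 : ¬ (a ∈ X ∧ b ∈ S \ X) := fun h => he (Finset.mem_product.2 h)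
    have c2 : ¬ (b ∈ X ∧ a ∈ S \ X) := fun h => hes (Finset.mem_product.2 h)
    rw [Finset.mem_sdiff] at c1 c2
    by_cases ha : a ∈ X
    · have hb : b ∈ X := by tauto
      have : (a, b) ∈ rst E X := mem_rst.2 ⟨hee, ha, hb⟩
      rw [hE1.2.1, ← hE1'.2.1] at this
      exact rst_subset _ _ this
    · have hb : b ∉ X := by tauto
      have : (a, b) ∈ rst E (S \ X) := mem_rst.2 ⟨hee, Finset.mem_sdiff.2 ⟨hab.1, ha⟩,
        Finset.mem_sdiff.2 ⟨hab.2.1, hb⟩⟩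
      rw [hE1.2.2.1, ← hE1'.2.2.1] at this
      exact rst_subset _ _ this
  rw [Finset.card_powerset, show P.card = X.card * (S \ X).card from Finset.card_product _ _] at h1
  refine h1.trans (Nat.mul_le_mul_left _ ?_)
  have hM : 1 ≤ M := (one_le_kap _ _ _).trans hA
  let st : ArcSet N → Fin N → Finset (Fin N) := fun D u =>
    if u ∈ U then Finset.univ.filter fun w => (u, w) ∈ D ∨ (w, u) ∈ D else ∅
  let C : Fin N → Finset (Finset (Fin N)) := fun u =>
    if u ∈ U then (if u ∈ X then (S \ X).powerset.filter (NoLink k B) else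
      X.powerset.filter (NoLink k A)) else {∅}
  have hcov : ∀ D ∈ P.powerset.filter (Flex 𝒢), ∀ x y, (x, y) ∈ D →
      x ∈ X ∧ y ∈ S \ X ∧ (y ∈ U ∨ x ∈ U ∨ y ∈ Q ∧ x ∈ Q) := by
    intro D hD x y hxy
    rw [Finset.mem_filter, Finset.mem_powerset] at hD
    have hm := Finset.mem_product.1 (hD.1 hxy)
    obtain ⟨E, hE, -, h2⟩ := hD.2 D subset_rfl
    exact ⟨hm.1, hm.2, ((hG E).1 hE).2.2.2 y hm.2 x hm.1 (h2 _ hxy)⟩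
  have h2 : (P.powerset.filter (Flex 𝒢)).card ≤ (Fintype.piFinset C ×ˢ
      ((Q ×ˢ Q).powerset.filter fun D => D.card ≤ (m + d) * q)).card := by
    refine Finset.card_le_card_of_injOn (fun D => (st D, D ∩ Q ×ˢ Q)) ?_ ?_
    · intro D hD
      have hDc := hcov D hD
      have hD' := Finset.mem_filter.1 hD
      refine Finset.mem_coe.2 (Finset.mem_product.2 ⟨Fintype.mem_piFinset.2 fun u => ?_, ?_⟩)
      · simp only [st, C]
        split_ifs with c1 c2
        · have hT : ∀ w ∈ Finset.univ.filter fun w => (u, w) ∈ D ∨ (w, u) ∈ D,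
              (u, w) ∈ D := by
            intro w hw
            refine (Finset.mem_filter.1 hw).2.resolve_right fun h' => ?_
            exact (Finset.mem_sdiff.1 (hDc _ _ h').2.1).2 c2
          refine Finset.mem_filter.2 ⟨Finset.mem_powerset.2 fun w hw => (hDc _ _ (hT w hw)).2.1,
            hD'.2.noLink_left hk hGs (fun E hE => ((hG E).1 hE).2.2.1) c2 hT⟩
        · have hT : ∀ w ∈ Finset.univ.filter fun w => (u, w) ∈ D ∨ (w, u) ∈ D,
              (w, u) ∈ D := by
            intro w hw
            refine (Finset.mem_filter.1 hw).2.resolve_left fun h' => c2 (hDc _ _ h').1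
          refine Finset.mem_filter.2 ⟨Finset.mem_powerset.2 fun w hw => (hDc _ _ (hT w hw)).1,
            hD'.2.noLink_right hk hGs (fun E hE => ((hG E).1 hE).2.1) c2 hT⟩
        · exact Finset.mem_singleton_self _
      · refine Finset.mem_filter.2 ⟨Finset.mem_powerset.2 Finset.inter_subset_right, ?_⟩
        have hQX : (Q ∩ X).card ≤ q := (Finset.card_le_card Finset.inter_subset_left).trans hQ
        have hQY : (Q ∩ (S \ X)).card ≤ q :=
          (Finset.card_le_card Finset.inter_subset_left).trans hQ
        have h3 := card_le_of_biclique_free (A := Q ∩ X) (B := Q ∩ (S \ X)) (D := D ∩ Q ×ˢ Q)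
          (h := h) (m := m) (d := d) ?_ ?_ hm
          ((Nat.mul_le_mul_left _ hQY).trans hmd) hd
        · calc _ ≤ _ := h3
            _ ≤ m * q + q * d := Nat.add_le_add (Nat.mul_le_mul_left _ hQY)
              (Nat.mul_le_mul_right _ hQX)
            _ = _ := by ring
        · rintro ⟨x, y⟩ hxy
          rw [Finset.mem_inter, Finset.mem_product] at hxy
          have := hDc _ _ hxy.1
          exact Finset.mem_product.2 ⟨Finset.mem_inter.2 ⟨hxy.2.1, this.1⟩,
            Finset.mem_inter.2 ⟨hxy.2.2, this.2.1⟩⟩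
        · intro A' hA' B' hB' hA'c hB'c hsub
          refine hD'.2.not_biclique hk hh hGs ?_ hA'c hB'c (hsub.trans Finset.inter_subset_left)
          exact hXY.mono (hA'.trans Finset.inter_subset_right) (hB'.trans Finset.inter_subset_right)
    · intro D hD D' hD' hDD
      rw [Prod.mk.injEq] at hDD
      have key : ∀ D ∈ P.powerset.filter (Flex 𝒢), ∀ D' ∈ P.powerset.filter (Flex 𝒢),
          st D = st D' → D ∩ Q ×ˢ Q = D' ∩ Q ×ˢ Q → D ⊆ D' := by
        rintro D hD D' hD' e1 e2 ⟨x, y⟩ hxy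
        have hc := hcov D hD x y hxy
        rcases hc.2.2 with h' | h' | h'
        · have e3 := congrFun e1 y
          simp only [st, if_pos h'] at e3
          have : x ∈ Finset.univ.filter fun w => (y, w) ∈ D ∨ (w, y) ∈ D :=
            Finset.mem_filter.2 ⟨Finset.mem_univ _, Or.inr hxy⟩
          rw [e3] at this
          refine (Finset.mem_filter.1 this).2.resolve_left fun h'' => ?_
          exact (Finset.mem_sdiff.1 hc.2.1).2 (hcov D' hD' _ _ h'').1
        · have e3 := congrFun e1 x
          simp only [st, if_pos h'] at e3
          have : y ∈ Finset.univ.filter fun w => (x, w) ∈ D ∨ (w, x) ∈ D :=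
            Finset.mem_filter.2 ⟨Finset.mem_univ _, Or.inl hxy⟩
          rw [e3] at this
          refine (Finset.mem_filter.1 this).2.resolve_right fun h'' => ?_
          exact (Finset.mem_sdiff.1 (hcov D' hD' _ _ h'').2.1).2 hc.1
        · have : (x, y) ∈ D ∩ Q ×ˢ Q :=
            Finset.mem_inter.2 ⟨hxy, Finset.mem_product.2 ⟨h'.2, h'.1⟩⟩
          rw [e2] at this
          exact (Finset.mem_inter.1 this).1
      exact (key D hD D' hD' hDD.1 hDD.2).antisymm (key D' hD' D hD hDD.1.symm hDD.2.symm)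
  refine h2.trans ?_
  rw [Finset.card_product, Fintype.card_piFinset]
  refine Nat.mul_le_mul ?_ ?_
  · calc ∏ u, (C u).card ≤ ∏ u, if u ∈ U then M else 1 := by
          refine Finset.prod_le_prod' fun u _ => ?_
          simp only [C]
          split_ifs
          · exact hB
          · exact hA
          · simp
      _ = M ^ U.card := by
          rw [Finset.prod_ite_mem, Finset.univ_inter, Finset.prod_const]
      _ ≤ M ^ t := Nat.pow_le_pow_right hM hU
  · refine (card_small_subsets_le _ _).trans (Nat.pow_le_pow_left ?_ _)
    rw [Finset.card_product, ← sq]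
    exact Nat.add_le_add_right (Nat.pow_le_pow_left hQ 2) 1

end

section CutSum

variable {N : ℕ}

/-- Weighted count of the digraphs that join `A` on `X` and `B` on `S \ X` with special
position data. -/
theorem sum_cut_fiber_le {k h : ℕ} (hk : 4 ≤ k) (hh : k = 2 * h) {S X U Q : Finset (Fin N)}
    {t q M m d : ℕ} (hU : U.card ≤ t) (hQ : Q.card ≤ q)
    (hm : 1 ≤ m) (hmd : 2 * h * q ≤ m * d) (hd : 2 * h * m ^ h ≤ d)
    {u v : ArcSet N → ℝ} (hu : ∀ A, 0 ≤ u A) (hv : ∀ A, 0 ≤ v A) :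
    ∑ E ∈ (freeOn k S).filter fun E => kap k X (rst E X) ≤ M ∧
        kap k (S \ X) (rst E (S \ X)) ≤ M ∧
        ∀ y ∈ S \ X, ∀ x ∈ X, (y, x) ∈ E → y ∈ U ∨ x ∈ U ∨ y ∈ Q ∧ x ∈ Q,
      u (rst E X) * v (rst E (S \ X)) ≤
      2 ^ (X.card * (S \ X).card) * (M ^ t * (q ^ 2 + 1) ^ ((m + d) * q) : ℕ) *
        ((∑ A ∈ freeOn k X, u A) * ∑ B ∈ freeOn k (S \ X), v B) := by
  set 𝒢 := (freeOn k S).filter fun E => kap k X (rst E X) ≤ M ∧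
        kap k (S \ X) (rst E (S \ X)) ≤ M ∧
        ∀ y ∈ S \ X, ∀ x ∈ X, (y, x) ∈ E → y ∈ U ∨ x ∈ U ∨ y ∈ Q ∧ x ∈ Q with h𝒢
  have hmem : ∀ E, E ∈ 𝒢 ↔ E ∈ freeOn k S ∧ kap k X (rst E X) ≤ M ∧
        kap k (S \ X) (rst E (S \ X)) ≤ M ∧
        ∀ y ∈ S \ X, ∀ x ∈ X, (y, x) ∈ E → y ∈ U ∨ x ∈ U ∨ y ∈ Q ∧ x ∈ Q :=
    fun E => Finset.mem_filter
  rw [← Finset.sum_fiberwise_of_maps_to (g := fun E => (rst E X, rst E (S \ X)))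
    (t := freeOn k X ×ˢ freeOn k (S \ X)) fun E hE =>
      Finset.mem_product.2 ⟨rst_mem_freeOn ((hmem E).1 hE).1,
        rst_mem_freeOn ((hmem E).1 hE).1⟩, Finset.sum_mul_sum,
    ← Finset.sum_product', Finset.mul_sum]
  refine Finset.sum_le_sum fun p _ => ?_
  obtain ⟨A, B⟩ := p
  have huv : 0 ≤ u A * v B := mul_nonneg (hu A) (hv B)
  have h1 : ∑ E ∈ 𝒢 with (rst E X, rst E (S \ X)) = (A, B),
      u (rst E X) * v (rst E (S \ X)) =
      (𝒢.filter fun E => (rst E X, rst E (S \ X)) = (A, B)).card * (u A * v B) := by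
    rw [← nsmul_eq_mul, ← Finset.sum_const]
    refine Finset.sum_congr rfl fun E hE => ?_
    have := (Finset.mem_filter.1 hE).2
    rw [Prod.mk.injEq] at this
    rw [this.1, this.2]
  rw [h1]
  refine mul_le_mul_of_nonneg_right ?_ huv
  rcases (𝒢.filter fun E => (rst E X, rst E (S \ X)) = (A, B)).eq_empty_or_nonempty with h0 | ⟨E, hE⟩
  · rw [h0, Finset.card_empty, Nat.cast_zero]
    positivity
  have hE1 := Finset.mem_filter.1 hE
  have hE2 := (hmem E).1 hE1.1
  have hE3 := Prod.mk.injEq .. ▸ hE1.2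
  have h2 := card_cut_fiber_le hk hh (S := S) (X := X) (A := A) (B := B) hU hQ
    (hE3.1 ▸ hE2.2.1) (hE3.2 ▸ hE2.2.2.1) hm hmd hd
  have h3 : (𝒢.filter fun E => (rst E X, rst E (S \ X)) = (A, B)).card ≤ _ :=
    (Finset.card_le_card fun E hE => by
      have hE1 := Finset.mem_filter.1 hE
      have hE2 := (hmem E).1 hE1.1
      have hE3 := Prod.mk.injEq .. ▸ hE1.2
      exact Finset.mem_filter.2 ⟨hE2.1, hE3.1, hE3.2, hE2.2.2.2⟩).trans h2
  exact_mod_cast h3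

/-- Weighted count of the digraphs with a good cut. -/
theorem sum_goodCut_le {k h K L : ℕ} (hk : 4 ≤ k) (hh : k = 2 * h)
    (hK : ∀ (S : Finset (Fin N)) (t : ℕ), S.card + 2 ≤ 2 ^ L → 1 ≤ t →
      ∑ E ∈ freeOn k S, kap k S E ^ t ≤ (freeOn k S).card * 2 ^ (K * t ^ 2 * L ^ 2))
    {S : Finset (Fin N)} (hL : S.card + 2 ≤ 2 ^ L) {t q r M m d : ℕ}
    (hm : 1 ≤ m) (hmd : 2 * h * q ≤ m * d) (hd : 2 * h * m ^ h ≤ d)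
    {𝒢 : Finset (ArcSet N)} (h𝒢 : 𝒢 ⊆ freeOn k S) {cut : ArcSet N → Finset (Fin N)}
    (hcut : ∀ E ∈ 𝒢, GoodCut k t q r M S E (cut E)) {w : ArcSet N → ℝ}
    {u v : Finset (Fin N) → ArcSet N → ℝ} (hu : ∀ X A, 0 ≤ u X A) (hv : ∀ X A, 0 ≤ v X A)
    (hw : ∀ E ∈ 𝒢, w E ≤ u (cut E) (rst E (cut E)) * v (S \ cut E) (rst E (S \ cut E)))
    {a : ℝ} (ha0 : 0 ≤ a) (ha : ∀ X ⊆ S, X.card = S.card / 2 →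
      (∑ A ∈ freeOn k X, u X A) * ∑ B ∈ freeOn k (S \ X), v (S \ X) B ≤
        ((freeOn k X).card * (freeOn k (S \ X)).card) * a) :
    ∑ E ∈ 𝒢, w E ≤ (freeOn k S).card * ((((S.card + 1) ^ t * (S.card + 1) ^ q *
      (M ^ t * (q ^ 2 + 1) ^ ((m + d) * q)) * 2 ^ (K * L ^ 2) : ℕ) : ℝ) * a) := by
  set c : ℕ := M ^ t * (q ^ 2 + 1) ^ ((m + d) * q) with hc
  set 𝒳 := S.powerset.filter fun X => X.card = S.card / 2 with h𝒳
  set 𝒰 := S.powerset.filter fun X => X.card ≤ t with h𝒰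
  set 𝒬 := S.powerset.filter fun X => X.card ≤ q with h𝒬
  let R : Finset (Fin N) → Finset (Fin N) → Finset (Fin N) → ArcSet N → Prop := fun X U Q E =>
    kap k X (rst E X) ≤ M ∧ kap k (S \ X) (rst E (S \ X)) ≤ M ∧
        ∀ y ∈ S \ X, ∀ x ∈ X, (y, x) ∈ E → y ∈ U ∨ x ∈ U ∨ y ∈ Q ∧ x ∈ Q
  have huv : ∀ X E, 0 ≤ u X (rst E X) * v (S \ X) (rst E (S \ X)) := fun X E =>
    mul_nonneg (hu _ _) (hv _ _)
  have h1 : ∑ E ∈ 𝒢, w E ≤ ∑ E ∈ freeOn k S, ∑ X ∈ 𝒳, ∑ U ∈ 𝒰, ∑ Q ∈ 𝒬,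
      if R X U Q E then u X (rst E X) * v (S \ X) (rst E (S \ X)) else 0 := by
    have hnn : ∀ E X U Q, 0 ≤
        if R X U Q E then u X (rst E X) * v (S \ X) (rst E (S \ X)) else 0 := by
      intro E X U Q
      split_ifs
      · exact huv X E
      · exact le_rfl
    refine le_trans ?_ (Finset.sum_le_sum_of_subset_of_nonneg h𝒢 fun E _ _ =>
      Finset.sum_nonneg fun X _ => Finset.sum_nonneg fun U _ => Finset.sum_nonneg fun Q _ =>
        hnn E X U Q)
    refine Finset.sum_le_sum fun E hE => ?_
    have hg := hcut E hE
    obtain ⟨U, hU, hUt, Q, hQ, hQq, hcov⟩ := hg.cover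
    have hX : cut E ∈ 𝒳 := Finset.mem_filter.2 ⟨Finset.mem_powerset.2 hg.subset, hg.card⟩
    have hU' : U ∈ 𝒰 := Finset.mem_filter.2 ⟨Finset.mem_powerset.2 hU, hUt⟩
    have hQ' : Q ∈ 𝒬 := Finset.mem_filter.2 ⟨Finset.mem_powerset.2 hQ, hQq⟩
    refine (hw E hE).trans ?_
    have e1 : R (cut E) U Q E := ⟨hg.kap_le, hg.kap_le', hcov⟩
    calc u (cut E) (rst E (cut E)) * v (S \ cut E) (rst E (S \ cut E))
        = if R (cut E) U Q E then u (cut E) (rst E (cut E)) *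
            v (S \ cut E) (rst E (S \ cut E)) else 0 := (if_pos e1).symm
      _ ≤ ∑ Q ∈ 𝒬, if R (cut E) U Q E then u (cut E) (rst E (cut E)) *
            v (S \ cut E) (rst E (S \ cut E)) else 0 :=
          Finset.single_le_sum (f := fun Q => if R (cut E) U Q E then u (cut E) (rst E (cut E)) *
            v (S \ cut E) (rst E (S \ cut E)) else 0) (fun Q _ => hnn E _ U Q) hQ'
      _ ≤ ∑ U ∈ 𝒰, ∑ Q ∈ 𝒬, if R (cut E) U Q E then u (cut E) (rst E (cut E)) *
            v (S \ cut E) (rst E (S \ cut E)) else 0 :=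
          Finset.single_le_sum (f := fun U => ∑ Q ∈ 𝒬, if R (cut E) U Q E then
            u (cut E) (rst E (cut E)) * v (S \ cut E) (rst E (S \ cut E)) else 0)
            (fun U _ => Finset.sum_nonneg fun Q _ => hnn E _ U Q) hU'
      _ ≤ _ := Finset.single_le_sum (f := fun X => ∑ U ∈ 𝒰, ∑ Q ∈ 𝒬, if R X U Q E then
            u X (rst E X) * v (S \ X) (rst E (S \ X)) else 0)
            (fun X _ => Finset.sum_nonneg fun U _ => Finset.sum_nonneg fun Q _ => hnn E X U Q) hX
  have h2 : ∑ E ∈ freeOn k S, ∑ X ∈ 𝒳, ∑ U ∈ 𝒰, ∑ Q ∈ 𝒬,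
      (if R X U Q E then u X (rst E X) * v (S \ X) (rst E (S \ X)) else 0) =
      ∑ X ∈ 𝒳, ∑ U ∈ 𝒰, ∑ Q ∈ 𝒬, ∑ E ∈ (freeOn k S).filter (R X U Q),
        u X (rst E X) * v (S \ X) (rst E (S \ X)) := by
    rw [Finset.sum_comm]
    refine Finset.sum_congr rfl fun X _ => ?_
    rw [Finset.sum_comm]
    refine Finset.sum_congr rfl fun U _ => ?_
    rw [Finset.sum_comm]
    refine Finset.sum_congr rfl fun Q _ => ?_
    rw [Finset.sum_filter]
  rw [h2] at h1
  refine h1.trans ?_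
  have h3 : ∀ X ∈ 𝒳, ∑ U ∈ 𝒰, ∑ Q ∈ 𝒬, ∑ E ∈ (freeOn k S).filter (R X U Q),
        u X (rst E X) * v (S \ X) (rst E (S \ X)) ≤
      ((S.card + 1) ^ t * (S.card + 1) ^ q * c : ℕ) * a *
        (2 ^ (X.card * (S \ X).card) * ((freeOn k X).card * (freeOn k (S \ X)).card) : ℕ) := by
    intro X hX
    have hX' := Finset.mem_filter.1 hX
    have hXS := Finset.mem_powerset.1 hX'.1
    have h4 : ∀ U ∈ 𝒰, ∀ Q ∈ 𝒬, ∑ E ∈ (freeOn k S).filter (R X U Q),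
        u X (rst E X) * v (S \ X) (rst E (S \ X)) ≤ c * a *
        (2 ^ (X.card * (S \ X).card) * ((freeOn k X).card * (freeOn k (S \ X)).card) : ℕ) := by
      intro U hU Q hQ
      refine (sum_cut_fiber_le hk hh (Finset.mem_filter.1 hU).2 (Finset.mem_filter.1 hQ).2
        hm hmd hd (M := M) (hu X) (hv (S \ X))).trans ?_
      rw [← hc]
      calc _ ≤ (2 : ℝ) ^ (X.card * (S \ X).card) * (c : ℝ) *
            (((freeOn k X).card * (freeOn k (S \ X)).card) * a) :=
            mul_le_mul_of_nonneg_left (ha X hXS hX'.2) (by positivity)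
        _ = _ := by push_cast; ring
    have hU : (𝒰.card : ℝ) ≤ ((S.card + 1) ^ t : ℕ) := by
      exact_mod_cast card_small_subsets_le S t
    have hQ : (𝒬.card : ℝ) ≤ ((S.card + 1) ^ q : ℕ) := by
      exact_mod_cast card_small_subsets_le S q
    calc _ ≤ ∑ U ∈ 𝒰, ∑ Q ∈ 𝒬, c * a * (2 ^ (X.card * (S \ X).card) *
          ((freeOn k X).card * (freeOn k (S \ X)).card) : ℕ) :=
          Finset.sum_le_sum fun U hU => Finset.sum_le_sum fun Q hQ => h4 U hU Q hQ
      _ = (𝒰.card * 𝒬.card : ℝ) * (c * a * (2 ^ (X.card * (S \ X).card) *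
          ((freeOn k X).card * (freeOn k (S \ X)).card) : ℕ)) := by
          rw [Finset.sum_const, Finset.sum_const, nsmul_eq_mul, nsmul_eq_mul]; ring
      _ ≤ (((S.card + 1) ^ t : ℕ) * ((S.card + 1) ^ q : ℕ) : ℝ) *
          (c * a * (2 ^ (X.card * (S \ X).card) *
          ((freeOn k X).card * (freeOn k (S \ X)).card) : ℕ)) := by
          gcongr
      _ = _ := by push_cast; ring
  refine (Finset.sum_le_sum h3).trans ?_
  rw [← Finset.mul_sum, ← Nat.cast_sum]
  have h5 : ∑ X ∈ 𝒳, 2 ^ (X.card * (S \ X).card) *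
      ((freeOn k X).card * (freeOn k (S \ X)).card) ≤ (freeOn k S).card * 2 ^ (K * L ^ 2) := by
    have : NeZero k := ⟨by omega⟩
    refine (sum_glue_le_sum_kap (by omega) S 𝒳 (Finset.filter_subset _ _)).trans ?_
    have := hK S 1 hL le_rfl
    simpa using this
  calc _ ≤ ((S.card + 1) ^ t * (S.card + 1) ^ q * c : ℕ) * a *
        ((freeOn k S).card * 2 ^ (K * L ^ 2) : ℕ) := by gcongr
    _ = _ := by push_cast; ring

end CutSum

section Potential

/-- The sublinear potential that absorbs the losses along the recursion. -/
noncomputable def psi (n : ℕ) : ℝ := (n : ℝ) ^ (3 / 4 : ℝ)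

theorem psi_nonneg (n : ℕ) : 0 ≤ psi n := Real.rpow_nonneg (Nat.cast_nonneg _) _

theorem psi_pow (n : ℕ) : psi n ^ 4 = (n : ℝ) ^ 3 := by
  rw [psi, ← Real.rpow_natCast, ← Real.rpow_mul (Nat.cast_nonneg _), ← Real.rpow_natCast]
  norm_num

theorem psi_le_self (n : ℕ) : psi n ≤ n := by
  rcases n.eq_zero_or_pos with rfl | hn
  · simp [psi]
  refine le_of_pow_le_pow_left₀ (n := 4) (by norm_num) (Nat.cast_nonneg _) ?_
  rw [psi_pow]
  exact_mod_cast Nat.pow_le_pow_right hn (by norm_num : 3 ≤ 4)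

theorem psi_split {n : ℕ} (hn : 2 ≤ n) : 11 / 10 * psi n ≤ psi (n / 2) + psi (n - n / 2) := by
  have hn0 : (0 : ℝ) < n := by exact_mod_cast (by omega : 0 < n)
  have hp : 0 < psi n := Real.rpow_pos_of_pos hn0 _
  have key : ∀ x : ℕ, 3 * x ≤ 2 * n → 11 / 10 * psi n * x ≤ psi x * n := by
    intro x hx
    refine le_of_pow_le_pow_left₀ (n := 4) (by norm_num)
      (mul_nonneg (psi_nonneg _) hn0.le) ?_
    rw [mul_pow, mul_pow, mul_pow, psi_pow, psi_pow]
    have hx' : (3 : ℝ) * x ≤ 2 * n := by exact_mod_cast hx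
    have h0 : (0 : ℝ) ≤ (x : ℝ) ^ 3 * (n : ℝ) ^ 3 := by positivity
    nlinarith [mul_le_mul_of_nonneg_left hx' h0]
  have h1 := key (n / 2) (by omega)
  have h2 := key (n - n / 2) (by omega)
  have h3 : ((n / 2 : ℕ) : ℝ) + ((n - n / 2 : ℕ) : ℝ) = n := by
    rw [← Nat.cast_add]; congr 1; omega
  refine le_of_mul_le_mul_right ?_ hn0
  calc 11 / 10 * psi n * n = 11 / 10 * psi n * ((n / 2 : ℕ) : ℝ) +
        11 / 10 * psi n * ((n - n / 2 : ℕ) : ℝ) := by rw [← mul_add, h3]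
    _ ≤ _ := by rw [add_mul]; exact add_le_add h1 h2

end Potential

section Scheme

variable {N : ℕ}

/-- Parameters, as functions of the number of vertices, of a recursive cutting scheme. -/
structure Scheme where
  /-- the number of exceptional vertices of a cut -/
  t : ℕ → ℕ
  /-- the number of central vertices of a cut -/
  q : ℕ → ℕ
  /-- the number of backward arcs of a cut -/
  r : ℕ → ℕ
  /-- the number of unlinked sets on both sides of a cut -/
  M : ℕ → ℕ
  /-- the exponent of the number of choices of a cut -/
  e : ℕ → ℕ
  /-- the exponent of the proportion of digraphs without good cut -/
  g : ℕ → ℕ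
  /-- the size below which no set is cut -/
  m₀ : ℕ

/-- `E` has a good cut on `S`. -/
def Scheme.Cuttable (P : Scheme) (k : ℕ) (S : Finset (Fin N)) (E : ArcSet N) : Prop :=
  ∃ X, GoodCut k (P.t S.card) (P.q S.card) (P.r S.card) (P.M S.card) S E X

/-- A chosen good cut. -/
noncomputable def Scheme.cut (P : Scheme) (k : ℕ) (S : Finset (Fin N)) (E : ArcSet N) :
    Finset (Fin N) :=
  if h : P.Cuttable k S E then h.choose else ∅

theorem Scheme.Cuttable.goodCut {P : Scheme} {k : ℕ} {S : Finset (Fin N)} {E : ArcSet N}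
    (h : P.Cuttable k S E) :
    GoodCut k (P.t S.card) (P.q S.card) (P.r S.card) (P.M S.card) S E (P.cut k S E) := by
  rw [Scheme.cut, dif_pos h]
  exact h.choose_spec

/-- The properties of the parameters of a cutting scheme that make the recursion work. -/
structure Scheme.Valid (N : ℕ) (k : ℕ) (P : Scheme) : Prop where
  two_le : 2 ≤ P.m₀
  sum_le : ∀ {S : Finset (Fin N)}, P.m₀ ≤ S.card → ∀ {𝒢 : Finset (ArcSet N)},
    𝒢 ⊆ freeOn k S → (∀ E ∈ 𝒢, P.Cuttable k S E) → ∀ {w : ArcSet N → ℝ}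
    {u v : Finset (Fin N) → ArcSet N → ℝ}, (∀ X A, 0 ≤ u X A) → (∀ X A, 0 ≤ v X A) →
    (∀ E ∈ 𝒢, w E ≤ u (P.cut k S E) (rst E (P.cut k S E)) *
      v (S \ P.cut k S E) (rst E (S \ P.cut k S E))) →
    ∀ {a : ℝ}, 0 ≤ a → (∀ X ⊆ S, X.card = S.card / 2 →
      (∑ A ∈ freeOn k X, u X A) * ∑ B ∈ freeOn k (S \ X), v (S \ X) B ≤
        ((freeOn k X).card * (freeOn k (S \ X)).card) * a) →
    ∑ E ∈ 𝒢, w E ≤ (freeOn k S).card * (2 ^ P.e S.card * a)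
  card_not : ∀ {S : Finset (Fin N)}, P.m₀ ≤ S.card →
    ((freeOn k S).filter fun E => ¬ P.Cuttable k S E).card * 2 ^ (2 * P.g S.card) ≤
      (freeOn k S).card
  e_le : ∀ n, P.m₀ ≤ n → (P.e n + 1 : ℝ) ≤ psi n / 10
  r_le : ∀ n, P.m₀ ≤ n → (P.r n : ℝ) ≤ psi n / 10
  g_mono : ∀ m n, P.m₀ ≤ m → m ≤ n → P.g m ≤ P.g n
  small : ∀ m, P.m₀ ≤ m → ∃ R, ∀ n, m ≤ n → n ≤ 2 * m ^ 16 →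
    P.e n + 3 ≤ R ∧ 2 * R * (Nat.clog 2 n + 1) ≤ P.g m

theorem Scheme.Cuttable.card_cut_lt {P : Scheme} {k : ℕ} {S : Finset (Fin N)} {E : ArcSet N}
    (h : P.Cuttable k S E) (hS : 2 ≤ S.card) : (P.cut k S E).card < S.card := by
  rw [h.goodCut.card]; omega

theorem Scheme.Cuttable.card_sdiff {P : Scheme} {k : ℕ} {S : Finset (Fin N)} {E : ArcSet N}
    (h : P.Cuttable k S E) : (S \ P.cut k S E).card = S.card - S.card / 2 := by
  rw [Finset.card_sdiff_of_subset h.goodCut.subset, h.goodCut.card]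

/-- The sizes of the parts at which the recursive cutting stops early. -/
noncomputable def Scheme.leaves (P : Scheme) (k : ℕ) (S : Finset (Fin N)) (E : ArcSet N) :
    Multiset ℕ :=
  if S.card < P.m₀ then 0 else
    if h : 2 ≤ S.card ∧ P.Cuttable k S E then
      P.leaves k (P.cut k S E) (rst E (P.cut k S E)) +
        P.leaves k (S \ P.cut k S E) (rst E (S \ P.cut k S E))
    else {S.card}
termination_by S.card
decreasing_by
  · exact h.2.card_cut_lt h.1
  · rw [h.2.card_sdiff]; omega

theorem Scheme.leaves_of_lt {P : Scheme} {k : ℕ} {S : Finset (Fin N)} (E : ArcSet N)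
    (h : S.card < P.m₀) : P.leaves k S E = 0 := by
  rw [Scheme.leaves, if_pos h]

theorem Scheme.leaves_of_not {P : Scheme} {k : ℕ} {S : Finset (Fin N)} {E : ArcSet N}
    (h : P.m₀ ≤ S.card) (hc : ¬ P.Cuttable k S E) : P.leaves k S E = {S.card} := by
  rw [Scheme.leaves, if_neg (by omega), dif_neg fun h => hc h.2]

theorem Scheme.Valid.leaves_cut {P : Scheme} {k : ℕ} (hP : P.Valid N k) {S : Finset (Fin N)}
    {E : ArcSet N} (h : P.m₀ ≤ S.card) (hc : P.Cuttable k S E) :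
    P.leaves k S E = P.leaves k (P.cut k S E) (rst E (P.cut k S E)) +
        P.leaves k (S \ P.cut k S E) (rst E (S \ P.cut k S E)) := by
  rw [Scheme.leaves, if_neg (by omega), dif_pos ⟨hP.two_le.trans h, hc⟩]

theorem Scheme.Valid.mem_leaves {P : Scheme} {k : ℕ} (hP : P.Valid N k) {S : Finset (Fin N)}
    {E : ArcSet N} {l : ℕ} (hl : l ∈ P.leaves k S E) : P.m₀ ≤ l ∧ l ≤ S.card := by
  induction hn : S.card using Nat.strong_induction_on generalizing S E with
  | _ n ih =>
    subst hn
    rcases lt_or_ge S.card P.m₀ with h | h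
    · simp [Scheme.leaves_of_lt E h] at hl
    by_cases hc : P.Cuttable k S E
    · have h2 := hP.two_le.trans h
      rw [hP.leaves_cut h hc, Multiset.mem_add] at hl
      rcases hl with hl | hl
      · have := ih _ (hc.card_cut_lt h2) hl rfl
        have := hc.card_cut_lt h2
        omega
      · have h3 := hc.card_sdiff
        have := ih _ (by omega) hl rfl
        omega
    · rw [Scheme.leaves_of_not h hc, Multiset.mem_singleton] at hl
      omega

/-- The optimal number of backward arcs is linear up to the parts that are not cut. -/
theorem Scheme.Valid.bb_le {P : Scheme} {k : ℕ} (hP : P.Valid N k) (S : Finset (Fin N))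
    (E : ArcSet N) : (bb E S : ℝ) ≤ (P.m₀ + 1) * S.card - psi S.card +
      ((P.leaves k S E).map fun l : ℕ => (l : ℝ) ^ 2).sum := by
  induction hn : S.card using Nat.strong_induction_on generalizing S E with
  | _ n ih =>
    subst hn
    have hsq : (bb E S : ℝ) ≤ (S.card : ℝ) ^ 2 := by exact_mod_cast bb_le_sq E S
    have hpsi := psi_le_self S.card
    have hn0 : (0 : ℝ) ≤ S.card := Nat.cast_nonneg _
    have hm0 : (0 : ℝ) ≤ P.m₀ := Nat.cast_nonneg _
    rcases lt_or_ge S.card P.m₀ with h | h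
    · rw [Scheme.leaves_of_lt E h]
      have : (S.card : ℝ) ≤ P.m₀ := by exact_mod_cast h.le
      simp only [Multiset.map_zero, Multiset.sum_zero, add_zero]
      nlinarith
    by_cases hc : P.Cuttable k S E
    · have h2 := hP.two_le.trans h
      have hg := hc.goodCut
      have h3 := hc.card_sdiff
      have i1 := ih _ (hc.card_cut_lt h2) (P.cut k S E) (rst E (P.cut k S E)) rfl
      have i2 := ih _ (by omega) (S \ P.cut k S E) (rst E (S \ P.cut k S E)) rfl
      rw [bb_rst subset_rfl, hg.card] at i1
      rw [bb_rst subset_rfl, h3] at i2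
      rw [hP.leaves_cut h hc, Multiset.map_add, Multiset.sum_add]
      have h4 : (bb E S : ℝ) ≤ bb E (P.cut k S E) + bb E (S \ P.cut k S E) + P.r S.card := by
        exact_mod_cast (bb_le_add E S (P.cut k S E)).trans
          (Nat.add_le_add_left hg.arcs_le _)
      have h5 := hP.r_le _ h
      have h6 := psi_split h2
      have h7 : ((S.card / 2 : ℕ) : ℝ) + ((S.card - S.card / 2 : ℕ) : ℝ) = S.card := by
        rw [← Nat.cast_add]; congr 1; omega
      have h8 : (P.m₀ + 1 : ℝ) * S.card = (P.m₀ + 1) * ((S.card / 2 : ℕ) : ℝ) +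
        (P.m₀ + 1) * ((S.card - S.card / 2 : ℕ) : ℝ) := by rw [← mul_add, h7]
      linarith
    · rw [Scheme.leaves_of_not h hc]
      simp only [Multiset.map_singleton, Multiset.sum_singleton]
      nlinarith

/-- The recursive bound for submultiplicative weights. -/
theorem Scheme.Valid.sum_wt_le {P : Scheme} {k : ℕ} (hP : P.Valid N k)
    {wt : Finset (Fin N) → ArcSet N → ℝ} (hwt : ∀ S E, 0 ≤ wt S E) {n₀ : ℕ} (hn₀ : P.m₀ ≤ n₀)
    {θ : ℝ} (hsub : ∀ S E, n₀ ≤ S.card → E ∈ freeOn k S → P.Cuttable k S E →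
      wt S E ≤ wt (P.cut k S E) (rst E (P.cut k S E)) *
        wt (S \ P.cut k S E) (rst E (S \ P.cut k S E)))
    (hbase : ∀ S : Finset (Fin N), n₀ / 2 ≤ S.card → S.card < n₀ →
      ∑ E ∈ freeOn k S, wt S E ≤ (freeOn k S).card * 2 ^ (θ * S.card - psi S.card))
    (hnot : ∀ S : Finset (Fin N), n₀ ≤ S.card →
      ∑ E ∈ (freeOn k S).filter fun E => ¬ P.Cuttable k S E, wt S E ≤
        (freeOn k S).card * (2 ^ (θ * S.card - psi S.card) / 2))
    {S : Finset (Fin N)} (hS : n₀ / 2 ≤ S.card) :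
    ∑ E ∈ freeOn k S, wt S E ≤ (freeOn k S).card * 2 ^ (θ * S.card - psi S.card) := by
  induction hn : S.card using Nat.strong_induction_on generalizing S with
  | _ n ih =>
    subst hn
    rcases lt_or_ge S.card n₀ with h | h
    · exact hbase S hS h
    have hm := hn₀.trans h
    have h2 := hP.two_le.trans hm
    rw [← Finset.sum_filter_add_sum_filter_not _ (fun E => P.Cuttable k S E)]
    set x := S.card / 2 with hx
    have h7 : (x : ℝ) + ((S.card - x : ℕ) : ℝ) = S.card := by
      rw [← Nat.cast_add]; congr 1; omega
    have h1 := hP.sum_le hm (Finset.filter_subset (fun E => P.Cuttable k S E) (freeOn k S))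
      (fun E hE => (Finset.mem_filter.1 hE).2) (w := wt S) (u := wt) (v := wt) hwt hwt
      (fun E hE => hsub S E h (Finset.mem_filter.1 hE).1 (Finset.mem_filter.1 hE).2)
      (a := (2 : ℝ) ^ (θ * x - psi x) * 2 ^ (θ * (S.card - x : ℕ) - psi (S.card - x)))
      (by positivity) (by
        intro X hX hXc
        have hY : (S \ X).card = S.card - x := by
          rw [Finset.card_sdiff_of_subset hX, hXc]
        have i1 := ih _ (by omega) (S := X) (by omega) rfl
        have i2 := ih _ (by omega) (S := S \ X) (by omega) rfl
        rw [hXc] at i1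
        rw [hY] at i2
        refine (mul_le_mul i1 i2 (Finset.sum_nonneg fun E _ => hwt _ _) (by positivity)).trans
          (le_of_eq ?_)
        ring)
    refine (add_le_add h1 (hnot S h)).trans ?_
    rw [← mul_add]
    refine mul_le_mul_of_nonneg_left ?_ (Nat.cast_nonneg _)
    have h3 : (2 : ℝ) ^ P.e S.card * (2 ^ (θ * x - psi x) *
        2 ^ (θ * (S.card - x : ℕ) - psi (S.card - x))) ≤
        2 ^ (θ * S.card - psi S.card) / 2 := by
      rw [← Real.rpow_natCast, ← Real.rpow_add two_pos, ← Real.rpow_add two_pos,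
        ← Real.rpow_sub_one two_ne_zero]
      refine Real.rpow_le_rpow_of_exponent_le one_le_two ?_
      have h5 := hP.e_le _ hm
      have h6 := psi_split h2
      have h8 : θ * S.card = θ * x + θ * (S.card - x : ℕ) := by rw [← mul_add, h7]
      linarith
    linarith

end Scheme

section LargeLeaves

variable {N : ℕ}

/-- The number of uncut parts of size at least `m`. -/
noncomputable def Scheme.cnt (P : Scheme) (k m : ℕ) (S : Finset (Fin N)) (E : ArcSet N) : ℕ :=
  (P.leaves k S E).countP (m ≤ ·)

theorem Scheme.Valid.cnt_of_lt {P : Scheme} {k m : ℕ} (hP : P.Valid N k) {S : Finset (Fin N)}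
    (E : ArcSet N) (h : S.card < m) : P.cnt k m S E = 0 :=
  Multiset.countP_eq_zero.2 fun _ hl => by
    have := (hP.mem_leaves hl).2
    omega

theorem Scheme.cnt_of_not {P : Scheme} {k m : ℕ} {S : Finset (Fin N)} {E : ArcSet N}
    (hm : P.m₀ ≤ m) (h : m ≤ S.card) (hc : ¬ P.Cuttable k S E) : P.cnt k m S E = 1 := by
  rw [Scheme.cnt, Scheme.leaves_of_not (hm.trans h) hc, ← Multiset.cons_zero,
    Multiset.countP_cons_of_pos _ h, Multiset.countP_zero]

theorem Scheme.Valid.cnt_cut {P : Scheme} {k m : ℕ} (hP : P.Valid N k) {S : Finset (Fin N)}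
    {E : ArcSet N} (h : P.m₀ ≤ S.card) (hc : P.Cuttable k S E) :
    P.cnt k m S E = P.cnt k m (P.cut k S E) (rst E (P.cut k S E)) +
      P.cnt k m (S \ P.cut k S E) (rst E (S \ P.cut k S E)) := by
  rw [Scheme.cnt, hP.leaves_cut h hc, Multiset.countP_add]; rfl

theorem Scheme.Valid.sum_not_le {P : Scheme} {k m : ℕ} (hP : P.Valid N k) (hm : P.m₀ ≤ m)
    {S : Finset (Fin N)} (h : m ≤ S.card) :
    ∑ E ∈ (freeOn k S).filter fun E => ¬ P.Cuttable k S E, (2 : ℝ) ^ (P.g m * P.cnt k m S E) ≤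
      (freeOn k S).card * 2 ^ (-(P.g m : ℝ)) := by
  have h1 : ∀ E ∈ (freeOn k S).filter fun E => ¬ P.Cuttable k S E,
      (2 : ℝ) ^ (P.g m * P.cnt k m S E) = 2 ^ P.g m := fun E hE => by
    rw [Scheme.cnt_of_not hm h (Finset.mem_filter.1 hE).2, mul_one]
  rw [Finset.sum_congr rfl h1, Finset.sum_const, nsmul_eq_mul]
  have h2 := hP.card_not (hm.trans h)
  have h3 : ((freeOn k S).filter fun E => ¬ P.Cuttable k S E).card * 2 ^ (2 * P.g m) ≤
      (freeOn k S).card :=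
    (Nat.mul_le_mul_left _ (Nat.pow_le_pow_right two_pos
      (Nat.mul_le_mul_left _ (hP.g_mono _ _ hm h)))).trans h2
  have h4 : ((((freeOn k S).filter fun E => ¬ P.Cuttable k S E).card : ℕ) : ℝ) *
      2 ^ (2 * P.g m) ≤ (freeOn k S).card := by exact_mod_cast h3
  rw [Real.rpow_neg zero_le_two, Real.rpow_natCast]
  refine le_trans (le_of_eq ?_) (mul_le_mul_of_nonneg_right h4 (by positivity))
  rw [two_mul, pow_add]
  field_simp

/-- Below a power of `m`, uncut parts of size `m` are rare. -/
theorem Scheme.Valid.sum_cnt_small {P : Scheme} {k m R : ℕ} (hP : P.Valid N k) (hm : P.m₀ ≤ m)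
    (hR : ∀ n, m ≤ n → n ≤ 2 * m ^ 16 →
      P.e n + 3 ≤ R ∧ 2 * R * (Nat.clog 2 n + 1) ≤ P.g m)
    {S : Finset (Fin N)} (hS : S.card ≤ 2 * m ^ 16) :
    ∑ E ∈ (freeOn k S).filter fun E => P.cnt k m S E ≠ 0, (2 : ℝ) ^ (P.g m * P.cnt k m S E) ≤
      (freeOn k S).card * 2 ^ ((R : ℝ) * (Nat.clog 2 S.card + 1) - P.g m) := by
  induction hn : S.card using Nat.strong_induction_on generalizing S with
  | _ n ih =>
    subst hn
    rcases lt_or_ge S.card m with h | h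
    · rw [Finset.filter_false_of_mem fun E _ => not_not.2 (hP.cnt_of_lt E h),
        Finset.sum_empty]
      positivity
    have hm' := hm.trans h
    have h2 := hP.two_le.trans hm'
    obtain ⟨hR1, hR2⟩ := hR _ h hS
    set w : Finset (Fin N) → ArcSet N → ℝ := fun S E => 2 ^ (P.g m * P.cnt k m S E) with hw
    set w' : Finset (Fin N) → ArcSet N → ℝ := fun S E =>
      if P.cnt k m S E ≠ 0 then w S E else 0 with hw'
    have hw0 : ∀ S E, 0 ≤ w S E := fun S E => by positivity
    have hw0' : ∀ S E, 0 ≤ w' S E := fun S E => by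
      simp only [hw']
      split_ifs
      · exact hw0 S E
      · exact le_rfl
    set ε : ℝ := 2 ^ ((R : ℝ) * Nat.clog 2 S.card - P.g m) with hε
    have hε0 : 0 < ε := by positivity
    have hclog : ∀ x, x ≤ S.card - S.card / 2 → Nat.clog 2 x + 1 ≤ Nat.clog 2 S.card := by
      intro x hx
      rw [Nat.clog_of_two_le (le_refl 2) h2]
      refine Nat.add_le_add_right (Nat.clog_mono_right 2 (hx.trans ?_)) 1
      omega
    have hsmall : ∀ X : Finset (Fin N), X.card < S.card → X.card ≤ S.card - S.card / 2 →
        ∑ E ∈ freeOn k X, w' X E ≤ (freeOn k X).card * ε := by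
      intro X hX hX'
      simp only [hw']
      rw [← Finset.sum_filter]
      refine (ih _ hX (hX.le.trans hS) rfl).trans ?_
      refine mul_le_mul_of_nonneg_left ?_ (Nat.cast_nonneg _)
      refine Real.rpow_le_rpow_of_exponent_le one_le_two (sub_le_sub_right ?_ _)
      have : ((Nat.clog 2 X.card + 1 : ℕ) : ℝ) ≤ Nat.clog 2 S.card := by
        exact_mod_cast hclog _ hX'
      push_cast at this
      exact mul_le_mul_of_nonneg_left this (Nat.cast_nonneg _)
    have hR2' : 2 * (R : ℝ) * (Nat.clog 2 S.card + 1) ≤ P.g m := by exact_mod_cast hR2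
    have hRn : (0 : ℝ) ≤ R := Nat.cast_nonneg _
    have hε1 : ε ≤ 1 := by
      refine Real.rpow_le_one_of_one_le_of_nonpos one_le_two ?_
      nlinarith [mul_nonneg hRn (Nat.cast_nonneg (α := ℝ) (Nat.clog 2 S.card))]
    have hall : ∀ X : Finset (Fin N), X.card < S.card → X.card ≤ S.card - S.card / 2 →
        ∑ E ∈ freeOn k X, w X E ≤ (freeOn k X).card * 2 := by
      intro X hX hX'
      have h3 : ∀ E ∈ freeOn k X, w X E ≤ 1 + w' X E := by
        intro E _
        simp only [hw']
        split_ifs with h0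
        · linarith
        · simp [hw, not_ne_iff.1 h0]
      refine (Finset.sum_le_sum h3).trans ?_
      rw [Finset.sum_add_distrib, Finset.sum_const, nsmul_eq_mul, mul_one]
      have := hsmall X hX hX'
      have h4 : ((freeOn k X).card : ℝ) * ε ≤ (freeOn k X).card * 1 :=
        mul_le_mul_of_nonneg_left hε1 (Nat.cast_nonneg _)
      linarith
    have hside : ∀ X ⊆ S, X.card = S.card / 2 → X.card < S.card ∧
        X.card ≤ S.card - S.card / 2 ∧ (S \ X).card < S.card ∧
        (S \ X).card ≤ S.card - S.card / 2 := by
      intro X hX hXc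
      rw [Finset.card_sdiff_of_subset hX, hXc]
      omega
    set 𝒢 := (freeOn k S).filter fun E => P.Cuttable k S E with h𝒢
    have h𝒢m : ∀ E ∈ 𝒢, P.Cuttable k S E := fun E hE => (Finset.mem_filter.1 hE).2
    have b1 := hP.sum_le hm' (Finset.filter_subset _ _) h𝒢m hw0' hw0 (fun E _ => le_rfl)
      (a := 2 * ε) (by positivity) (by
        intro X hX hXc
        obtain ⟨c1, c2, c3, c4⟩ := hside X hX hXc
        refine (mul_le_mul (hsmall X c1 c2) (hall _ c3 c4)
          (Finset.sum_nonneg fun E _ => hw0 _ _) (by positivity)).trans (le_of_eq ?_)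
        ring)
    have b2 := hP.sum_le hm' (Finset.filter_subset _ _) h𝒢m hw0 hw0' (fun E _ => le_rfl)
      (a := 2 * ε) (by positivity) (by
        intro X hX hXc
        obtain ⟨c1, c2, c3, c4⟩ := hside X hX hXc
        refine (mul_le_mul (hall X c1 c2) (hsmall _ c3 c4)
          (Finset.sum_nonneg fun E _ => hw0' _ _) (by positivity)).trans (le_of_eq ?_)
        ring)
    have b3 := hP.sum_not_le hm h
    have h5 : ∀ E ∈ 𝒢, w' S E ≤ w' (P.cut k S E) (rst E (P.cut k S E)) *
        w (S \ P.cut k S E) (rst E (S \ P.cut k S E)) + w (P.cut k S E) (rst E (P.cut k S E)) *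
        w' (S \ P.cut k S E) (rst E (S \ P.cut k S E)) := by
      intro E hE
      have e1 := hP.cnt_cut (m := m) hm' (h𝒢m E hE)
      have e2 : w S E = w (P.cut k S E) (rst E (P.cut k S E)) *
        w (S \ P.cut k S E) (rst E (S \ P.cut k S E)) := by
        simp only [hw]
        rw [e1, mul_add, pow_add]
      have p1 := mul_nonneg (hw0' (P.cut k S E) (rst E (P.cut k S E)))
        (hw0 (S \ P.cut k S E) (rst E (S \ P.cut k S E)))
      have p2 := mul_nonneg (hw0 (P.cut k S E) (rst E (P.cut k S E)))
        (hw0' (S \ P.cut k S E) (rst E (S \ P.cut k S E)))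
      by_cases h0 : P.cnt k m S E = 0
      · have : w' S E = 0 := if_neg (not_not.2 h0)
        rw [this]
        exact add_nonneg p1 p2
      · have e3 : w' S E = w S E := if_pos h0
        rw [e3, e2]
        by_cases h6 : P.cnt k m (P.cut k S E) (rst E (P.cut k S E)) = 0
        · have : w' (S \ P.cut k S E) (rst E (S \ P.cut k S E)) =
            w (S \ P.cut k S E) (rst E (S \ P.cut k S E)) := if_pos (by omega)
          rw [this]
          linarith
        · have : w' (P.cut k S E) (rst E (P.cut k S E)) =
            w (P.cut k S E) (rst E (P.cut k S E)) := if_pos h6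
          rw [this]
          linarith
    have h6 : ∑ E ∈ freeOn k S, w' S E ≤ ∑ E ∈ 𝒢, w' S E +
        ∑ E ∈ (freeOn k S).filter fun E => ¬ P.Cuttable k S E, w S E := by
      rw [← Finset.sum_filter_add_sum_filter_not _ (fun E => P.Cuttable k S E)]
      refine add_le_add_right (Finset.sum_le_sum fun E _ => ?_) _
      simp only [hw']
      split_ifs
      · exact le_rfl
      · exact hw0 S E
    have h7 := (Finset.sum_le_sum h5)
    rw [Finset.sum_add_distrib] at h7
    have h8 : ∑ E ∈ (freeOn k S).filter fun E => P.cnt k m S E ≠ 0,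
        (2 : ℝ) ^ (P.g m * P.cnt k m S E) = ∑ E ∈ freeOn k S, w' S E := by
      simp only [hw']
      rw [Finset.sum_filter]
    rw [h8]
    have h9 : (2 : ℝ) ^ P.e S.card * (2 * ε) + 2 ^ P.e S.card * (2 * ε) +
        2 ^ (-(P.g m : ℝ)) ≤ 2 ^ ((R : ℝ) * (Nat.clog 2 S.card + 1) - P.g m) := by
      have e1 : (2 : ℝ) ^ ((R : ℝ) * (Nat.clog 2 S.card + 1) - P.g m) = 2 ^ R * ε := by
        rw [hε, ← Real.rpow_natCast, ← Real.rpow_add two_pos]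
        congr 1
        ring
      have e2 : (2 : ℝ) ^ (-(P.g m : ℝ)) ≤ ε := by
        refine Real.rpow_le_rpow_of_exponent_le one_le_two ?_
        have := mul_nonneg hRn (Nat.cast_nonneg (α := ℝ) (Nat.clog 2 S.card))
        linarith
      have e3 : (2 : ℝ) ^ (P.e S.card + 3) ≤ 2 ^ R := pow_le_pow_right₀ one_le_two hR1
      rw [pow_add] at e3
      have e4 : (1 : ℝ) ≤ 2 ^ P.e S.card := one_le_pow₀ one_le_two
      rw [e1]
      nlinarith [mul_le_mul_of_nonneg_right e3 hε0.le, mul_le_mul_of_nonneg_right e4 hε0.le]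
    calc ∑ E ∈ freeOn k S, w' S E ≤ (freeOn k S).card * (2 ^ P.e S.card * (2 * ε)) +
          (freeOn k S).card * (2 ^ P.e S.card * (2 * ε)) +
          (freeOn k S).card * 2 ^ (-(P.g m : ℝ)) := by linarith
      _ = (freeOn k S).card * ((2 : ℝ) ^ P.e S.card * (2 * ε) + 2 ^ P.e S.card * (2 * ε) +
        2 ^ (-(P.g m : ℝ))) := by ring
      _ ≤ _ := mul_le_mul_of_nonneg_left h9 (Nat.cast_nonneg _)

end LargeLeaves

section LargeLeavesTail

variable {N : ℕ}

theorem natCast_le_two_rpow_psi (n : ℕ) : (n : ℝ) ≤ 2 ^ (2 * psi n) := by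
  rcases n.eq_zero_or_pos with rfl | hn
  · simpa using Real.rpow_nonneg (zero_le_two (α := ℝ)) _
  have h0 := psi_nonneg n
  have h1 : (n : ℝ) ≤ psi n ^ 2 := by
    refine le_of_pow_le_pow_left₀ (n := 2) (by norm_num) (by positivity) ?_
    rw [← pow_mul, psi_pow]
    exact_mod_cast Nat.pow_le_pow_right hn (by norm_num : 2 ≤ 3)
  have h2 : psi n ≤ 2 ^ psi n := by
    calc psi n ≤ ((⌊psi n⌋₊ + 1 : ℕ) : ℝ) := by
          push_cast; exact (Nat.lt_floor_add_one _).le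
      _ ≤ ((2 ^ ⌊psi n⌋₊ : ℕ) : ℝ) := by exact_mod_cast Nat.lt_two_pow_self
      _ = (2 : ℝ) ^ (⌊psi n⌋₊ : ℝ) := by rw [Real.rpow_natCast]; push_cast; rfl
      _ ≤ _ := Real.rpow_le_rpow_of_exponent_le one_le_two (Nat.floor_le h0)
  calc (n : ℝ) ≤ psi n ^ 2 := h1
    _ ≤ ((2 : ℝ) ^ psi n) ^ 2 := pow_le_pow_left₀ h0 h2 2
    _ = _ := by rw [← Real.rpow_natCast, ← Real.rpow_mul zero_le_two]; congr 1; push_cast; ring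

theorem psi_mul_le {a n : ℕ} (h : a ^ 4 ≤ n) : psi n * a ≤ n := by
  refine le_of_pow_le_pow_left₀ (n := 4) (by norm_num) (Nat.cast_nonneg _) ?_
  rw [mul_pow, psi_pow]
  calc (n : ℝ) ^ 3 * (a : ℝ) ^ 4 ≤ (n : ℝ) ^ 3 * n := by
        refine mul_le_mul_of_nonneg_left ?_ (by positivity)
        exact_mod_cast h
    _ = _ := by ring

theorem Scheme.Valid.sum_small {P : Scheme} {k m R : ℕ} (hP : P.Valid N k) (hm : P.m₀ ≤ m)
    (hR : ∀ n, m ≤ n → n ≤ 2 * m ^ 16 →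
      P.e n + 3 ≤ R ∧ 2 * R * (Nat.clog 2 n + 1) ≤ P.g m)
    {S : Finset (Fin N)} (hmS : m ≤ S.card) (hS : S.card ≤ 2 * m ^ 16) :
    ∑ E ∈ (freeOn k S).filter fun E => P.cnt k m S E ≠ 0, (2 : ℝ) ^ (P.g m * P.cnt k m S E) ≤
      (freeOn k S).card := by
  refine (hP.sum_cnt_small hm hR hS).trans ?_
  refine mul_le_of_le_one_right (Nat.cast_nonneg _) ?_
  refine Real.rpow_le_one_of_one_le_of_nonpos one_le_two ?_
  have hR2' : 2 * (R : ℝ) * (Nat.clog 2 S.card + 1) ≤ P.g m := by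
    exact_mod_cast (hR _ hmS hS).2
  nlinarith [mul_nonneg (Nat.cast_nonneg (α := ℝ) R)
    (Nat.cast_nonneg (α := ℝ) (Nat.clog 2 S.card))]

/-- Exponential moments of the number of large uncut parts. -/
theorem Scheme.Valid.sum_cnt_le {P : Scheme} {k m : ℕ} (hP : P.Valid N k) (hm : P.m₀ ≤ m)
    {S : Finset (Fin N)} (hS : m ^ 16 ≤ S.card) :
    ∑ E ∈ freeOn k S, (2 : ℝ) ^ (P.g m * P.cnt k m S E) ≤
      (freeOn k S).card * 2 ^ (4 / (m : ℝ) ^ 4 * S.card - psi S.card) := by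
  obtain ⟨R, hR⟩ := hP.small m hm
  have hm2 := hP.two_le.trans hm
  have hmpos : (0 : ℝ) < m := by exact_mod_cast (by omega : 0 < m)
  have hm16 : m ≤ m ^ 16 := Nat.le_self_pow (by norm_num) m
  have hexp : ∀ n : ℕ, m ^ 16 ≤ n → 1 ≤ 4 / (m : ℝ) ^ 4 * n - psi n := by
    intro n hn
    have h1 : psi n * ((m ^ 4 : ℕ) : ℝ) ≤ n :=
      psi_mul_le (a := m ^ 4) (by rw [← pow_mul]; exact hn)
    push_cast at h1
    have h2 : (m : ℝ) ^ 4 ≤ n := by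
      exact_mod_cast (Nat.pow_le_pow_right (by omega) (by norm_num : 4 ≤ 16)).trans hn
    have h3 : 0 < (m : ℝ) ^ 4 := by positivity
    rw [div_mul_eq_mul_div, le_sub_iff_add_le, le_div_iff₀ h3]
    linarith
  refine hP.sum_wt_le (wt := fun S E => (2 : ℝ) ^ (P.g m * P.cnt k m S E))
    (fun S E => by positivity) (n₀ := 2 * m ^ 16) (by omega) ?_ ?_ ?_ (by omega)
  · intro S E hS _ hc
    rw [hP.cnt_cut (by omega) hc, mul_add, pow_add]
  · intro S hS1 hS2
    have h1 := hP.sum_small hm hR (S := S) (by omega) hS2.le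
    have h3 : ∀ E ∈ freeOn k S, (2 : ℝ) ^ (P.g m * P.cnt k m S E) ≤
        1 + if P.cnt k m S E ≠ 0 then (2 : ℝ) ^ (P.g m * P.cnt k m S E) else 0 := by
      intro E _
      split_ifs with h0
      · linarith
      · simp [not_ne_iff.1 h0]
    refine (Finset.sum_le_sum h3).trans ?_
    rw [Finset.sum_add_distrib, Finset.sum_const, nsmul_eq_mul, mul_one, ← Finset.sum_filter]
    have h4 : (2 : ℝ) ≤ 2 ^ (4 / (m : ℝ) ^ 4 * S.card - psi S.card) := by
      calc (2 : ℝ) = 2 ^ (1 : ℝ) := (Real.rpow_one _).symm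
        _ ≤ _ := Real.rpow_le_rpow_of_exponent_le one_le_two (hexp _ (by omega))
    have h5 := mul_le_mul_of_nonneg_left h4 (Nat.cast_nonneg (α := ℝ) (freeOn k S).card)
    linarith
  · intro S hS
    refine (hP.sum_not_le hm (by omega)).trans ?_
    refine mul_le_mul_of_nonneg_left ?_ (Nat.cast_nonneg _)
    rw [← Real.rpow_sub_one two_ne_zero]
    refine Real.rpow_le_rpow_of_exponent_le one_le_two ?_
    have := hexp S.card (by omega)
    have h0 : (0 : ℝ) ≤ P.g m := Nat.cast_nonneg _
    linarith

/-- Tail bound for the number of large uncut parts. -/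
theorem Scheme.Valid.card_cnt_le {P : Scheme} {k m : ℕ} (hP : P.Valid N k) (hm : P.m₀ ≤ m)
    {S : Finset (Fin N)} (hmS : m ≤ S.card) :
    (((freeOn k S).filter fun E => 8 * S.card < P.cnt k m S E * m ^ 4).card : ℝ) *
      (S.card : ℝ) ^ 2 ≤ (freeOn k S).card := by
  obtain ⟨R, hR⟩ := hP.small m hm
  have hm2 := hP.two_le.trans hm
  have hmpos : (0 : ℝ) < m := by exact_mod_cast (by omega : 0 < m)
  have hm16 : m ≤ m ^ 16 := Nat.le_self_pow (by norm_num) m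
  set ℬ := (freeOn k S).filter fun E => 8 * S.card < P.cnt k m S E * m ^ 4 with hℬ
  have hg1 : 6 * (Nat.clog 2 m + 1) ≤ P.g m := by
    obtain ⟨h1, h2⟩ := hR m le_rfl (by omega)
    refine le_trans ?_ h2
    exact Nat.mul_le_mul_right _ (by omega)
  rcases le_or_gt S.card (2 * m ^ 16) with h | h
  · have h1 := hP.sum_small hm hR hmS h
    obtain ⟨h2, h3⟩ := hR _ hmS h
    have hg : 2 * Nat.clog 2 S.card ≤ P.g m := by
      refine le_trans ?_ h3
      refine Nat.mul_le_mul ?_ (Nat.le_succ _)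
      omega
    have hn : (S.card : ℝ) ^ 2 ≤ 2 ^ P.g m := by
      have : S.card ^ 2 ≤ 2 ^ P.g m := by
        calc S.card ^ 2 ≤ (2 ^ Nat.clog 2 S.card) ^ 2 :=
              Nat.pow_le_pow_left (Nat.le_pow_clog one_lt_two _) 2
          _ = 2 ^ (2 * Nat.clog 2 S.card) := by rw [← pow_mul, mul_comm]
          _ ≤ _ := Nat.pow_le_pow_right two_pos hg
      exact_mod_cast this
    refine le_trans ?_ h1
    rw [← nsmul_eq_mul, ← Finset.sum_const]
    refine le_trans (Finset.sum_le_sum fun E hE => ?_)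
      (Finset.sum_le_sum_of_subset_of_nonneg (f := fun E => (2 : ℝ) ^ (P.g m * P.cnt k m S E))
        (fun E hE => ?_) fun _ _ _ => by positivity)
    · have hE' := (Finset.mem_filter.1 hE).2
      have h0 : P.cnt k m S E ≠ 0 := by
        intro h0
        rw [h0] at hE'
        omega
      refine hn.trans (pow_le_pow_right₀ one_le_two ?_)
      exact Nat.le_mul_of_pos_right _ (Nat.pos_of_ne_zero h0)
    · have hE' := Finset.mem_filter.1 hE
      refine Finset.mem_filter.2 ⟨hE'.1, fun h0 => ?_⟩
      have := hE'.2
      rw [h0] at this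
      omega
  · have h1 := hP.sum_cnt_le hm (S := S) (by omega)
    have hm4 : 0 < (m : ℝ) ^ 4 := by positivity
    have hψ : psi S.card ≤ S.card / (m : ℝ) ^ 4 := by
      rw [le_div_iff₀ hm4]
      have : psi S.card * ((m ^ 4 : ℕ) : ℝ) ≤ S.card :=
        psi_mul_le (a := m ^ 4) (by rw [← pow_mul]; change m ^ 16 ≤ _; omega)
      exact_mod_cast this
    have hn2 : (S.card : ℝ) ^ 2 ≤ 2 ^ (4 / (m : ℝ) ^ 4 * S.card) := by
      calc (S.card : ℝ) ^ 2 ≤ ((2 : ℝ) ^ (2 * psi S.card)) ^ 2 :=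
            pow_le_pow_left₀ (Nat.cast_nonneg _) (natCast_le_two_rpow_psi _) 2
        _ = 2 ^ (4 * psi S.card) := by
            rw [← Real.rpow_natCast, ← Real.rpow_mul zero_le_two]; congr 1; push_cast; ring
        _ ≤ _ := by
            refine Real.rpow_le_rpow_of_exponent_le one_le_two ?_
            rw [div_mul_eq_mul_div, mul_div_assoc]
            linarith
    have h2 : (ℬ.card : ℝ) * 2 ^ (8 / (m : ℝ) ^ 4 * S.card) ≤
        (freeOn k S).card * 2 ^ (4 / (m : ℝ) ^ 4 * S.card) := by
      refine le_trans ?_ (h1.trans (mul_le_mul_of_nonneg_left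
        (Real.rpow_le_rpow_of_exponent_le one_le_two (sub_le_self _ (psi_nonneg _)))
        (Nat.cast_nonneg _)))
      rw [← nsmul_eq_mul, ← Finset.sum_const]
      refine le_trans (Finset.sum_le_sum fun E hE => ?_)
        (Finset.sum_le_sum_of_subset_of_nonneg (f := fun E => (2 : ℝ) ^ (P.g m * P.cnt k m S E))
          (Finset.filter_subset _ _) fun _ _ _ => by positivity)
      have hE' := (Finset.mem_filter.1 hE).2
      rw [← Real.rpow_natCast 2 (P.g m * _)]
      refine Real.rpow_le_rpow_of_exponent_le one_le_two ?_
      have e1 : (8 * S.card : ℝ) ≤ P.cnt k m S E * (m : ℝ) ^ 4 := by exact_mod_cast hE'.le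
      rw [div_mul_eq_mul_div, div_le_iff₀ hm4]
      have e2 : (1 : ℝ) ≤ P.g m := by exact_mod_cast (by omega : 1 ≤ P.g m)
      push_cast
      nlinarith [mul_nonneg (sub_nonneg.2 e2) (mul_nonneg (Nat.cast_nonneg (α := ℝ)
        (P.cnt k m S E)) hm4.le)]
    set Z : ℝ := 2 ^ (4 / (m : ℝ) ^ 4 * S.card) with hZ
    have hZ0 : 0 < Z := by positivity
    have h3 : (2 : ℝ) ^ (8 / (m : ℝ) ^ 4 * S.card) = Z * Z := by
      rw [hZ, ← Real.rpow_add two_pos]; congr 1; ring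
    rw [h3, ← mul_assoc] at h2
    have h4 := le_of_mul_le_mul_right h2 hZ0
    exact (mul_le_mul_of_nonneg_left hn2 (Nat.cast_nonneg _)).trans h4

theorem Multiset.sum_sq_le_dyadic {m n : ℕ} (hm : 1 ≤ m) (s : Multiset ℕ)
    (hs : ∀ l ∈ s, m ≤ l ∧ l ≤ n) : (s.map fun l : ℕ => (l : ℝ) ^ 2).sum ≤
      ∑ i ∈ Finset.range n, 4 * ((m * 2 ^ i : ℕ) : ℝ) ^ 2 * (s.countP (m * 2 ^ i ≤ ·) : ℕ) := by
  induction s using Multiset.induction with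
  | empty => simp
  | cons a s ih =>
    have h1 := ih fun l hl => hs l (Multiset.mem_cons_of_mem hl)
    obtain ⟨h2, h3⟩ := hs a (Multiset.mem_cons_self a s)
    rw [Multiset.map_cons, Multiset.sum_cons]
    set i := Nat.log 2 (a / m) with hi
    have ha : a / m ≠ 0 := (Nat.div_pos h2 hm).ne'
    have h4 : m * 2 ^ i ≤ a := by
      rw [mul_comm]
      exact (Nat.le_div_iff_mul_le (by omega)).1 (Nat.pow_log_le_self 2 ha)
    have h5 : a < m * 2 ^ i * 2 := by
      have := Nat.lt_pow_succ_log_self one_lt_two (a / m)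
      rw [Nat.div_lt_iff_lt_mul (by omega)] at this
      rw [pow_succ] at this
      linarith
    have hin : i < n := by
      have : i < 2 ^ i := Nat.lt_two_pow_self
      have h6 : 2 ^ i ≤ m * 2 ^ i := Nat.le_mul_of_pos_left _ (by omega)
      omega
    have h7 : (a : ℝ) ^ 2 ≤ ∑ j ∈ Finset.range n,
        4 * ((m * 2 ^ j : ℕ) : ℝ) ^ 2 * ((if m * 2 ^ j ≤ a then 1 else 0 : ℕ) : ℝ) := by
      refine le_trans ?_ (Finset.single_le_sum (f := fun j => 4 * ((m * 2 ^ j : ℕ) : ℝ) ^ 2 *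
        ((if m * 2 ^ j ≤ a then 1 else 0 : ℕ) : ℝ)) (fun j _ => by positivity)
        (Finset.mem_range.2 hin))
      simp only [if_pos h4]
      have : (a : ℝ) ≤ ((m * 2 ^ i : ℕ) : ℝ) * 2 := by exact_mod_cast h5.le
      have h8 : (0 : ℝ) ≤ a := Nat.cast_nonneg _
      push_cast at this ⊢
      nlinarith
    refine (add_le_add h7 h1).trans (le_of_eq ?_)
    rw [← Finset.sum_add_distrib]
    refine Finset.sum_congr rfl fun j _ => ?_
    rw [Multiset.countP_cons, ← mul_add, add_comm, Nat.cast_add]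

/-- Almost all digraphs have few and small uncut parts. -/
theorem Scheme.Valid.card_sum_sq_le {P : Scheme} {k : ℕ} (hP : P.Valid N k) (hm : 14 ≤ P.m₀)
    (S : Finset (Fin N)) :
    (((freeOn k S).filter fun E =>
      (S.card : ℝ) / 4 < ((P.leaves k S E).map fun l : ℕ => (l : ℝ) ^ 2).sum).card : ℝ) *
      S.card ≤ (freeOn k S).card := by
  set n := S.card with hn
  set B : ℕ → Finset (ArcSet N) := fun i =>
    (freeOn k S).filter fun E => 8 * n < P.cnt k (P.m₀ * 2 ^ i) S E * (P.m₀ * 2 ^ i) ^ 4 with hB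
  have hmi : ∀ i, P.m₀ ≤ P.m₀ * 2 ^ i := fun i => Nat.le_mul_of_pos_right _ (by positivity)
  have hBi : ∀ i, ((B i).card : ℝ) * (n : ℝ) ^ 2 ≤ (freeOn k S).card := by
    intro i
    rcases le_or_gt (P.m₀ * 2 ^ i) n with h | h
    · exact hP.card_cnt_le (hmi i) h
    · have : B i = ∅ := by
        refine Finset.filter_false_of_mem fun E _ => ?_
        rw [hP.cnt_of_lt E h]
        omega
      rw [this]
      simp
  have hsub : ((freeOn k S).filter fun E =>
      (n : ℝ) / 4 < ((P.leaves k S E).map fun l : ℕ => (l : ℝ) ^ 2).sum) ⊆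
      (Finset.range n).biUnion B := by
    intro E hE
    have hE' := Finset.mem_filter.1 hE
    by_contra hcon
    rw [Finset.mem_biUnion] at hcon
    push Not at hcon
    have h1 : ∀ i ∈ Finset.range n, P.cnt k (P.m₀ * 2 ^ i) S E * (P.m₀ * 2 ^ i) ^ 4 ≤ 8 * n := by
      intro i hi
      by_contra hlt
      exact hcon i hi (Finset.mem_filter.2 ⟨hE'.1, not_le.1 hlt⟩)
    have h2 := Multiset.sum_sq_le_dyadic (by omega) (P.leaves k S E)
      (m := P.m₀) (n := n) fun l hl => hP.mem_leaves hl
    have h3 : ∀ i ∈ Finset.range n, 4 * ((P.m₀ * 2 ^ i : ℕ) : ℝ) ^ 2 *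
        ((P.leaves k S E).countP (P.m₀ * 2 ^ i ≤ ·) : ℕ) ≤ n / 6 * (1 / 4) ^ i := by
      intro i hi
      have h4 : (P.cnt k (P.m₀ * 2 ^ i) S E : ℝ) * ((P.m₀ * 2 ^ i : ℕ) : ℝ) ^ 4 ≤ 8 * n := by
        exact_mod_cast h1 i hi
      change 4 * ((P.m₀ * 2 ^ i : ℕ) : ℝ) ^ 2 * (P.cnt k (P.m₀ * 2 ^ i) S E : ℝ) ≤ _
      set c : ℝ := (P.cnt k (P.m₀ * 2 ^ i) S E : ℝ)
      have h5 : ((P.m₀ * 2 ^ i : ℕ) : ℝ) ^ 2 = (P.m₀ : ℝ) ^ 2 * 4 ^ i := by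
        push_cast
        rw [mul_pow, ← pow_mul, mul_comm i, pow_mul]
        norm_num
      have h6 : ((P.m₀ * 2 ^ i : ℕ) : ℝ) ^ 4 = (((P.m₀ * 2 ^ i : ℕ) : ℝ) ^ 2) ^ 2 := by
        rw [← pow_mul]
      rw [h6] at h4
      set z : ℝ := ((P.m₀ * 2 ^ i : ℕ) : ℝ) ^ 2 with hz
      have h7 : 192 * 4 ^ i ≤ z := by
        rw [h5]
        have : (14 : ℝ) ≤ P.m₀ := by exact_mod_cast hm
        have : (192 : ℝ) ≤ (P.m₀ : ℝ) ^ 2 := by nlinarith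
        exact mul_le_mul_of_nonneg_right this (by positivity)
      have h8 : (0 : ℝ) < 4 ^ i := by positivity
      have hz0 : 0 < z := by linarith
      have h9 : c * z ≤ 8 * n / z := by
        rw [le_div_iff₀ hz0]
        linarith
      have h10 : 8 * (n : ℝ) / z ≤ 8 * n / (192 * 4 ^ i) :=
        div_le_div_of_nonneg_left (by positivity) (by positivity) h7
      have h11 : 8 * (n : ℝ) / (192 * 4 ^ i) = n / 24 * (1 / 4) ^ i := by
        rw [one_div, inv_pow]
        field_simp
        ring
      linarith
    have h4 := h2.trans (Finset.sum_le_sum h3)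
    rw [← Finset.mul_sum] at h4
    have h5 : ∑ i ∈ Finset.range n, (1 / 4 : ℝ) ^ i ≤ 4 / 3 := by
      have := Summable.sum_le_tsum (f := fun i : ℕ => (1 / 4 : ℝ) ^ i) (Finset.range n)
        (fun i _ => by positivity) (summable_geometric_of_lt_one (by norm_num) (by norm_num))
      rw [tsum_geometric_of_lt_one (by norm_num) (by norm_num)] at this
      norm_num at this ⊢
      exact this
    have h6 : (n : ℝ) / 6 * ∑ i ∈ Finset.range n, (1 / 4 : ℝ) ^ i ≤ n / 6 * (4 / 3) :=
      mul_le_mul_of_nonneg_left h5 (by positivity)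
    have h7 := hE'.2
    have h8 : (0 : ℝ) ≤ n := Nat.cast_nonneg _
    linarith
  rcases Nat.eq_zero_or_pos n with h0 | hpos
  · rw [h0]
    simp
  have hn0 : (0 : ℝ) < n := by exact_mod_cast hpos
  refine le_of_mul_le_mul_right ?_ hn0
  have h1 : ((((freeOn k S).filter fun E =>
      (n : ℝ) / 4 < ((P.leaves k S E).map fun l : ℕ => (l : ℝ) ^ 2).sum).card : ℕ) : ℝ) ≤
      ∑ i ∈ Finset.range n, ((B i).card : ℝ) := by
    exact_mod_cast (Finset.card_le_card hsub).trans Finset.card_biUnion_le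
  calc _ = (((freeOn k S).filter fun E =>
      (n : ℝ) / 4 < ((P.leaves k S E).map fun l : ℕ => (l : ℝ) ^ 2).sum).card : ℝ) *
        (n : ℝ) ^ 2 := by ring
    _ ≤ (∑ i ∈ Finset.range n, ((B i).card : ℝ)) * (n : ℝ) ^ 2 :=
        mul_le_mul_of_nonneg_right h1 (by positivity)
    _ = ∑ i ∈ Finset.range n, ((B i).card : ℝ) * (n : ℝ) ^ 2 := Finset.sum_mul _ _ _
    _ ≤ ∑ i ∈ Finset.range n, ((freeOn k S).card : ℝ) := Finset.sum_le_sum fun i _ => hBi i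
    _ = _ := by rw [Finset.sum_const, Finset.card_range, nsmul_eq_mul, mul_comm]

end LargeLeavesTail

section Acyclic

variable {N : ℕ}

/-- The pairs of vertices of `S` that occupy a common selected block of two positions. -/
noncomputable def blockPairs (S : Finset (Fin N)) (pos : Fin N → ℕ) {h : ℕ}
    (c : Fin h → Fin 8) : ArcSet N :=
  S.offDiag.filter fun e => pos e.1 / 2 = pos e.2 / 2 ∧ ∃ i : Fin h, pos e.1 / 2 = 8 * i + c i

theorem mem_blockPairs {S : Finset (Fin N)} {pos : Fin N → ℕ} {h : ℕ} {c : Fin h → Fin 8}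
    {a b : Fin N} : (a, b) ∈ blockPairs S pos c ↔ (a ∈ S ∧ b ∈ S ∧ a ≠ b) ∧
      pos a / 2 = pos b / 2 ∧ ∃ i : Fin h, pos a / 2 = 8 * i + c i := by
  simp [blockPairs, Finset.mem_offDiag]

theorem blockPairs_symm {S : Finset (Fin N)} {pos : Fin N → ℕ} {h : ℕ} {c : Fin h → Fin 8}
    {a b : Fin N} (hab : (a, b) ∈ blockPairs S pos c) : (b, a) ∈ blockPairs S pos c := by
  rw [mem_blockPairs] at hab ⊢
  obtain ⟨⟨ha, hb, hne⟩, h1, i, h2⟩ := hab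
  exact ⟨⟨hb, ha, hne.symm⟩, h1.symm, i, h1 ▸ h2⟩

theorem card_blockPairs_le {S : Finset (Fin N)} {pos : Fin N → ℕ} (hpos : Set.InjOn pos S)
    {h : ℕ} (c : Fin h → Fin 8) : (blockPairs S pos c).card ≤ 2 * h := by
  have himg : ∀ e ∈ blockPairs S pos c, pos e.1 ∈
      (Finset.univ : Finset (Fin h × Fin 2)).image
        fun x => 2 * (8 * (x.1 : ℕ) + c x.1) + x.2 := by
    rintro ⟨a, b⟩ he
    obtain ⟨-, -, i, hi⟩ := mem_blockPairs.1 he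
    refine Finset.mem_image.2 ⟨(i, ⟨pos a % 2, Nat.mod_lt _ two_pos⟩), Finset.mem_univ _, ?_⟩
    dsimp only
    omega
  refine (Finset.card_le_card_of_injOn (fun e : Fin N × Fin N => pos e.1) (fun e he =>
    Finset.mem_coe.2 (himg e (Finset.mem_coe.1 he))) ?_).trans (Finset.card_image_le.trans ?_)
  · rintro ⟨a, b⟩ he ⟨a', b'⟩ he' (hee : pos a = pos a')
    obtain ⟨⟨ha, hb, hne⟩, h1, -⟩ := mem_blockPairs.1 (Finset.mem_coe.1 he)
    obtain ⟨⟨ha', hb', hne'⟩, h1', -⟩ := mem_blockPairs.1 (Finset.mem_coe.1 he')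
    obtain rfl := hpos ha ha' hee
    have h2 : pos a ≠ pos b := fun h => hne (hpos ha hb h)
    have h2' : pos a ≠ pos b' := fun h => hne' (hpos ha hb' h)
    obtain rfl := hpos hb hb' (by omega)
    rfl
  · simp [Nat.mul_comm]

theorem blockPairs_inj {S : Finset (Fin N)} {pos : Fin N → ℕ} {h : ℕ}
    (hsurj : ∀ p < 16 * h, ∃ a ∈ S, pos a = p) {c c' : Fin h → Fin 8}
    (hc : blockPairs S pos c = blockPairs S pos c') : c = c' := by
  funext i
  have hi := i.2
  have hci := (c i).2
  obtain ⟨a, ha, hpa⟩ := hsurj (2 * (8 * i + c i)) (by omega)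
  obtain ⟨b, hb, hpb⟩ := hsurj (2 * (8 * i + c i) + 1) (by omega)
  have hab : (a, b) ∈ blockPairs S pos c :=
    mem_blockPairs.2 ⟨⟨ha, hb, by rintro rfl; omega⟩, by omega, i, by omega⟩
  rw [hc] at hab
  obtain ⟨-, -, i', hi'⟩ := mem_blockPairs.1 hab
  have hci' := (c' i').2
  obtain rfl : i = i' := Fin.ext (by omega)
  exact Fin.ext (by omega)

/-- Doubling the pairs in disjoint blocks of an acyclic digraph creates no long cycle. -/
theorem ckFree_union_blockPairs {k : ℕ} (hk : 3 ≤ k) {S : Finset (Fin N)} {E : ArcSet N}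
    {pos : Fin N → ℕ} (hpos : Set.InjOn pos S) (hE : ∀ a b, (a, b) ∈ E → pos a < pos b)
    (hES : E ⊆ S.offDiag) {h : ℕ} (c : Fin h → Fin 8) : CkFree k (E ∪ blockPairs S pos c) := by
  rintro ⟨f, hf, harc⟩
  have : NeZero k := ⟨by omega⟩
  have hle : ∀ i, pos (f i) / 2 ≤ pos (f (i + 1)) / 2 := by
    intro i
    rcases Finset.mem_union.1 (harc i) with h1 | h1
    · exact Nat.div_le_div_right (hE _ _ h1).le
    · exact (mem_blockPairs.1 h1).2.1.le
  have hmem : ∀ i, f i ∈ S := by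
    intro i
    rcases Finset.mem_union.1 (harc i) with h1 | h1
    · exact (Finset.mem_offDiag.1 (hES h1)).1
    · exact (mem_blockPairs.1 h1).1.1
  have hsum : ∑ i, pos (f i) / 2 = ∑ i, pos (f (i + 1)) / 2 :=
    (Equiv.sum_comp (Equiv.addRight (1 : ZMod k)) fun i => pos (f i) / 2).symm
  have heq := (Finset.sum_eq_sum_iff_of_le fun i _ => hle i).1 hsum
  have h01 := heq 0 (Finset.mem_univ _)
  have h12 := heq (0 + 1) (Finset.mem_univ _)
  have hne1 : (0 : ZMod k) + 1 ≠ 0 := by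
    rw [zero_add]
    intro h0
    have h1 : ((1 : ℕ) : ZMod k) = 0 := by simpa using h0
    have := Nat.le_of_dvd one_pos ((ZMod.natCast_eq_zero_iff 1 k).1 h1)
    omega
  have hne2 : (0 : ZMod k) + 1 + 1 ≠ 0 := by
    rw [zero_add]
    intro h0
    have h1 : ((2 : ℕ) : ZMod k) = 0 := by
      rw [← h0]; norm_num
    have := Nat.le_of_dvd two_pos ((ZMod.natCast_eq_zero_iff 2 k).1 h1)
    omega
  have hne3 : (0 : ZMod k) + 1 + 1 ≠ 0 + 1 := fun h0 =>
    hne1 (by rw [zero_add] at h0 ⊢; simpa using h0)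
  have hp : ∀ i i', i ≠ i' → pos (f i) ≠ pos (f i') := fun i i' hi hpe =>
    hi (hf (hpos (hmem i) (hmem i') hpe))
  have h1 := hp _ _ hne1
  have h2 := hp _ _ hne2
  have h3 := hp _ _ hne3
  omega

/-- Acyclic digraphs are rare among the `C_k`-free ones. -/
theorem card_acyclic_le {k : ℕ} (hk : 3 ≤ k) (S : Finset (Fin N)) :
    ((freeOn k S).filter fun E => bb E S = 0).card * 2 ^ (S.card / 16) ≤
      (freeOn k S).card := by
  choose pos hopt using fun E : ArcSet N => exists_opt E S
  set h := S.card / 16 with hh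
  set 𝒜 := (freeOn k S).filter fun E => bb E S = 0 with h𝒜
  have hA : ∀ E ∈ 𝒜, E ∈ freeOn k S ∧ ∀ a b, (a, b) ∈ E → pos E a < pos E b := by
    intro E hE
    obtain ⟨hEf, hE0⟩ := Finset.mem_filter.1 hE
    refine ⟨hEf, fun a b hab => ?_⟩
    by_contra hlt
    obtain ⟨ha, hb, -⟩ := freeOn_ne_of_mem hEf hab
    have h0 := (hopt E).card
    rw [hE0, Finset.card_eq_zero] at h0
    have : (a, b) ∈ backs E S (pos E) := mem_backs.2 ⟨hab, ha, hb, not_lt.1 hlt⟩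
    rw [h0] at this
    exact Finset.notMem_empty _ this
  have hsurj : ∀ E, ∀ p < 16 * h, ∃ a ∈ S, pos E a = p := by
    intro E p hp
    have himg : S.image (pos E) = Finset.range S.card := by
      refine Finset.eq_of_subset_of_card_le ?_ ?_
      · intro x hx
        obtain ⟨a, ha, rfl⟩ := Finset.mem_image.1 hx
        exact Finset.mem_range.2 ((hopt E).lt a ha)
      · rw [Finset.card_image_of_injOn (hopt E).inj, Finset.card_range]
    have hp' : p ∈ S.image (pos E) := by
      rw [himg, Finset.mem_range]; omega
    obtain ⟨a, ha, rfl⟩ := Finset.mem_image.1 hp'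
    exact ⟨a, ha, rfl⟩
  have hdbl : ∀ x ∈ 𝒜 ×ˢ (Finset.univ : Finset (Fin h → Fin 8)),
      (x.1 ∪ blockPairs S (pos x.1) x.2).filter
        (fun e => e.swap ∈ x.1 ∪ blockPairs S (pos x.1) x.2) = blockPairs S (pos x.1) x.2 := by
    rintro ⟨E, c⟩ hx
    have hE := (hA E (Finset.mem_product.1 hx).1).2
    ext ⟨a, b⟩
    constructor
    · intro hab
      obtain ⟨h1, h2⟩ := Finset.mem_filter.1 hab
      rcases Finset.mem_union.1 h1 with h1 | h1
      · rcases Finset.mem_union.1 h2 with h2 | h2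
        · exact absurd (hE _ _ h1) (hE _ _ h2).asymm
        · exact blockPairs_symm h2
      · exact h1
    · exact fun hab => Finset.mem_filter.2 ⟨Finset.mem_union_right _ hab,
        Finset.mem_union_right _ (blockPairs_symm hab)⟩
  have key := Finset.card_le_mul_card_image_of_maps_to
    (s := 𝒜 ×ˢ (Finset.univ : Finset (Fin h → Fin 8))) (t := freeOn k S)
    (f := fun x => x.1 ∪ blockPairs S (pos x.1) x.2) ?_ (4 ^ h) ?_
  · rw [Finset.card_product, Finset.card_univ, Fintype.card_fun, Fintype.card_fin,
      Fintype.card_fin, show 8 ^ h = 2 ^ h * 4 ^ h by rw [← mul_pow]; norm_num, ← mul_assoc,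
      mul_comm (4 ^ h)] at key
    exact Nat.le_of_mul_le_mul_right key (by positivity)
  · rintro ⟨E, c⟩ hx
    obtain ⟨hEf, hE⟩ := hA E (Finset.mem_product.1 hx).1
    have hsub := (mem_freeOn.1 hEf).1
    exact mem_freeOn.2 ⟨Finset.union_subset hsub (Finset.filter_subset _ _),
      ckFree_union_blockPairs hk (hopt E).inj hE hsub c⟩
  · intro E' _
    set D := E'.filter fun e => e.swap ∈ E' with hD
    have hfib : ∀ x ∈ (𝒜 ×ˢ (Finset.univ : Finset (Fin h → Fin 8))).filter
        (fun x => x.1 ∪ blockPairs S (pos x.1) x.2 = E'),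
        blockPairs S (pos x.1) x.2 = D ∧ x.1 = E' \ (D \ x.1) := by
      intro x hx
      obtain ⟨hx, hxE⟩ := Finset.mem_filter.1 hx
      have h1 := hdbl x hx
      rw [hxE] at h1
      refine ⟨h1.symm, ?_⟩
      have h2 : blockPairs S (pos x.1) x.2 = D := h1.symm
      rw [h2] at hxE
      ext e
      simp only [← hxE, Finset.mem_sdiff, Finset.mem_union]
      tauto
    by_cases hne : ((𝒜 ×ˢ (Finset.univ : Finset (Fin h → Fin 8))).filter
        (fun x => x.1 ∪ blockPairs S (pos x.1) x.2 = E')).Nonempty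
    · obtain ⟨x, hx⟩ := hne
      have hDc : D.card ≤ 2 * h := by
        rw [← (hfib x hx).1]
        exact card_blockPairs_le (hopt _).inj _
      calc _ ≤ D.powerset.card := by
            refine Finset.card_le_card_of_injOn (fun x => D \ x.1)
              (fun x _ => Finset.mem_coe.2 (Finset.mem_powerset.2 Finset.sdiff_subset)) ?_
            rintro ⟨E, c⟩ h1 ⟨F, d⟩ h2 (h3 : D \ E = D \ F)
            have h1 := hfib _ (Finset.mem_coe.1 h1)
            have h2 := hfib _ (Finset.mem_coe.1 h2)
            obtain rfl : E = F := h1.2.trans ((congrArg (E' \ ·) h3).trans h2.2.symm)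
            obtain rfl := blockPairs_inj (hsurj E) (h1.1.trans h2.1.symm)
            rfl
        _ ≤ 2 ^ (2 * h) := by
            rw [Finset.card_powerset]
            exact Nat.pow_le_pow_right two_pos hDc
        _ = 4 ^ h := by rw [pow_mul]; norm_num
    · rw [Finset.not_nonempty_iff_eq_empty] at hne
      exact (Finset.card_eq_zero.2 hne).trans_le (Nat.zero_le _)

end Acyclic

section Lower

variable {N : ℕ}

/-- The weight that penalises backward arcs and uncut parts. -/
noncomputable def Scheme.wgt (P : Scheme) (k : ℕ) (S : Finset (Fin N)) (E : ArcSet N) : ℝ :=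
  2 ^ (-(P.m₀ * (bb E S : ℝ) + 1 / 40 * ((P.leaves k S E).sum : ℕ)))

theorem Scheme.Valid.wgt_le_mul {P : Scheme} {k : ℕ} (hP : P.Valid N k) {S : Finset (Fin N)}
    {E : ArcSet N} (hS : P.m₀ ≤ S.card) (hc : P.Cuttable k S E) :
    P.wgt k S E ≤ P.wgt k (P.cut k S E) (rst E (P.cut k S E)) *
      P.wgt k (S \ P.cut k S E) (rst E (S \ P.cut k S E)) := by
  have h1 := bb_add_le (E := E) hc.goodCut.subset
  have h1' : (bb E (P.cut k S E) : ℝ) + bb E (S \ P.cut k S E) ≤ bb E S := by exact_mod_cast h1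
  rw [Scheme.wgt, Scheme.wgt, Scheme.wgt, ← Real.rpow_add two_pos,
    bb_rst (Finset.Subset.refl _), bb_rst (Finset.Subset.refl _), hP.leaves_cut hS hc,
    Multiset.sum_add]
  refine Real.rpow_le_rpow_of_exponent_le one_le_two ?_
  push_cast
  nlinarith [mul_le_mul_of_nonneg_left h1' (Nat.cast_nonneg (α := ℝ) P.m₀)]

theorem psi_le_div {n : ℕ} (h : 160 ^ 4 ≤ n) : psi n ≤ n / 160 := by
  have := psi_mul_le h
  push_cast at this
  linarith

theorem Scheme.Valid.sum_wgt_le {P : Scheme} {k : ℕ} (hP : P.Valid N k) (hk : 3 ≤ k)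
    (hm : 2 * 160 ^ 4 ≤ P.m₀) {S : Finset (Fin N)} (hS : P.m₀ / 2 ≤ S.card) :
    ∑ E ∈ freeOn k S, P.wgt k S E ≤ (freeOn k S).card * 2 ^ (-(S.card : ℝ) / 80) := by
  have hbase : ∀ S : Finset (Fin N), P.m₀ / 2 ≤ S.card → S.card < P.m₀ →
      ∑ E ∈ freeOn k S, P.wgt k S E ≤
        (freeOn k S).card * 2 ^ (-1 / 80 * (S.card : ℝ) - psi S.card) := by
    intro S h1 h2
    have hn : 160 ^ 4 ≤ S.card := by omega
    have hpsi := psi_le_div hn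
    have hnR : (160 : ℝ) ^ 4 ≤ S.card := by exact_mod_cast hn
    have hA : (((freeOn k S).filter fun E => bb E S = 0).card : ℝ) ≤
        (freeOn k S).card * 2 ^ (-((S.card / 16 : ℕ) : ℝ)) := by
      rw [Real.rpow_neg two_pos.le, Real.rpow_natCast, ← div_eq_mul_inv,
        le_div_iff₀ (by positivity)]
      exact_mod_cast card_acyclic_le hk S
    have hdiv : (S.card : ℝ) / 16 - 1 ≤ ((S.card / 16 : ℕ) : ℝ) := by
      have : S.card < (S.card / 16 + 1) * 16 := by omega
      have : (S.card : ℝ) < (((S.card / 16 : ℕ) : ℝ) + 1) * 16 := by exact_mod_cast this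
      linarith
    have hwt : ∀ E ∈ freeOn k S, P.wgt k S E ≤
        (if bb E S = 0 then 1 else 0) + 2 ^ (-(S.card : ℝ)) := by
      intro E _
      rw [Scheme.wgt, P.leaves_of_lt E h2]
      have hp : (0 : ℝ) < 2 ^ (-(S.card : ℝ)) := by positivity
      split_ifs with h0
      · simp [h0]
      · rw [zero_add]
        refine Real.rpow_le_rpow_of_exponent_le one_le_two ?_
        have h3 : (1 : ℝ) ≤ bb E S := by exact_mod_cast Nat.one_le_iff_ne_zero.2 h0
        have h4 : (S.card : ℝ) ≤ P.m₀ := by exact_mod_cast h2.le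
        simp only [Multiset.sum_zero, Nat.cast_zero, mul_zero, add_zero]
        nlinarith
    calc ∑ E ∈ freeOn k S, P.wgt k S E ≤
        ∑ E ∈ freeOn k S, ((if bb E S = 0 then 1 else 0) + 2 ^ (-(S.card : ℝ))) :=
          Finset.sum_le_sum hwt
      _ = ((freeOn k S).filter fun E => bb E S = 0).card +
          (freeOn k S).card * 2 ^ (-(S.card : ℝ)) := by
        rw [Finset.sum_add_distrib, Finset.sum_boole, Finset.sum_const, nsmul_eq_mul]
      _ ≤ (freeOn k S).card * 2 ^ (-1 / 80 * (S.card : ℝ) - psi S.card - 1) +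
          (freeOn k S).card * 2 ^ (-1 / 80 * (S.card : ℝ) - psi S.card - 1) := by
        refine add_le_add (hA.trans ?_) ?_
        all_goals
          refine mul_le_mul_of_nonneg_left
            (Real.rpow_le_rpow_of_exponent_le one_le_two ?_) (Nat.cast_nonneg _)
          linarith
      _ = _ := by
        rw [Real.rpow_sub_one two_ne_zero]; ring
  have hmain := hP.sum_wt_le (wt := P.wgt k) (n₀ := P.m₀) (θ := -1 / 80)
    (fun S E => (Real.rpow_pos_of_pos two_pos _).le) le_rfl
    (fun S E h1 _ hc => hP.wgt_le_mul h1 hc) hbase ?_ hS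
  · refine hmain.trans (mul_le_mul_of_nonneg_left
      (Real.rpow_le_rpow_of_exponent_le one_le_two ?_) (Nat.cast_nonneg _))
    linarith [psi_nonneg S.card]
  · intro S h1
    have hn : 160 ^ 4 ≤ S.card := by omega
    have hpsi := psi_le_div hn
    have hnR : (160 : ℝ) ^ 4 ≤ S.card := by exact_mod_cast hn
    have hwt : ∀ E ∈ (freeOn k S).filter fun E => ¬ P.Cuttable k S E,
        P.wgt k S E ≤ 2 ^ (-1 / 80 * (S.card : ℝ) - psi S.card - 1) := by
      intro E hE
      rw [Scheme.wgt, P.leaves_of_not h1 (Finset.mem_filter.1 hE).2]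
      refine Real.rpow_le_rpow_of_exponent_le one_le_two ?_
      have h3 : (0 : ℝ) ≤ P.m₀ * (bb E S : ℝ) := by positivity
      rw [Multiset.sum_singleton]
      linarith
    rw [← Real.rpow_sub_one two_ne_zero]
    refine (Finset.sum_le_card_nsmul _ _ _ hwt).trans ?_
    rw [nsmul_eq_mul]
    refine mul_le_mul_of_nonneg_right ?_ (by positivity)
    exact_mod_cast Finset.card_filter_le _ _

/-- Few digraphs with small uncut parts have few backward arcs. -/
theorem Scheme.Valid.card_bb_lt_le {P : Scheme} {k : ℕ} (hP : P.Valid N k) (hk : 3 ≤ k)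
    (hm : 2 * 160 ^ 4 ≤ P.m₀) {S : Finset (Fin N)} (hS : P.m₀ / 2 ≤ S.card) :
    (((freeOn k S).filter fun E =>
      ((P.leaves k S E).map fun l : ℕ => (l : ℝ) ^ 2).sum ≤ (S.card : ℝ) / 4 ∧
        (bb E S : ℝ) < S.card / (320 * P.m₀)).card : ℝ) * 2 ^ ((S.card : ℝ) / 320) ≤
      (freeOn k S).card := by
  set 𝒢 := (freeOn k S).filter fun E =>
      ((P.leaves k S E).map fun l : ℕ => (l : ℝ) ^ 2).sum ≤ (S.card : ℝ) / 4 ∧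
        (bb E S : ℝ) < S.card / (320 * P.m₀) with h𝒢
  have hm0 : (0 : ℝ) < P.m₀ := by exact_mod_cast (by omega : 0 < P.m₀)
  have hwt : ∀ E ∈ 𝒢, 2 ^ (-(S.card : ℝ) * (3 / 320)) ≤ P.wgt k S E := by
    intro E hE
    obtain ⟨-, h1, h2⟩ := Finset.mem_filter.1 hE
    rw [lt_div_iff₀ (by positivity)] at h2
    have h3 : (((P.leaves k S E).sum : ℕ) : ℝ) ≤
        ((P.leaves k S E).map fun l : ℕ => (l : ℝ) ^ 2).sum := by
      rw [Nat.cast_multiset_sum]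
      refine Multiset.sum_map_le_sum_map _ _ fun l hl => ?_
      have := (hP.mem_leaves hl).1
      have hl1 : (1 : ℝ) ≤ l := by exact_mod_cast (by omega : 1 ≤ l)
      nlinarith
    rw [Scheme.wgt]
    refine Real.rpow_le_rpow_of_exponent_le one_le_two ?_
    linarith
  have h1 : (𝒢.card : ℝ) * 2 ^ (-(S.card : ℝ) * (3 / 320)) ≤
      (freeOn k S).card * 2 ^ (-(S.card : ℝ) / 80) := by
    rw [← nsmul_eq_mul]
    refine (Finset.card_nsmul_le_sum _ _ _ hwt).trans
      ((Finset.sum_le_sum_of_subset_of_nonneg (Finset.filter_subset _ _) ?_).trans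
        (hP.sum_wgt_le hk hm hS))
    exact fun E _ _ => (Real.rpow_pos_of_pos two_pos _).le
  have h2 := mul_le_mul_of_nonneg_right h1
    (Real.rpow_nonneg (two_pos (α := ℝ)).le ((S.card : ℝ) / 80))
  rw [mul_assoc, mul_assoc, ← Real.rpow_add two_pos, ← Real.rpow_add two_pos] at h2
  rwa [show -(S.card : ℝ) * (3 / 320) + S.card / 80 = S.card / 320 by ring,
    show -(S.card : ℝ) / 80 + S.card / 80 = 0 by ring, Real.rpow_zero, mul_one] at h2

end Lower

section Parameters

/-- The exponent of the number of choices of a cut, for polylogarithmic parameters. -/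
theorem choice_exponent_le {L a k h K : ℕ} (ha : 100 ≤ a) (hL : 96 ≤ L)
    (hk : k * (2 * k + 1) * 2 * (4 * (k + 40) + 2) ≤ L) (hk' : 4 * (k + 40) + 2 ≤ L)
    (hh : 2 * h ≤ L) (hK : K ≤ L) :
    L * (L * (4 * (k + 40) + 2) * L ^ (a + 2)) + L * (4 * (k + 40) * L ^ (a + 32)) +
      (L * (k * (2 * k + 1) * (2 * L ^ (a + 15))) * (L * (4 * (k + 40) + 2) * L ^ (a + 2)) +
        L * ((2 * h * L ^ 50 + (4 * (k + 40) * L ^ (a + 32) / L ^ 50 + 1)) *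
          (4 * (k + 40) * L ^ (a + 32)))) + K * L ^ 2 ≤ L ^ (2 * a + 21) := by
  have hL1 : 1 ≤ L := by omega
  have hpw : ∀ {i j : ℕ}, i ≤ j → L ^ i ≤ L ^ j := fun h => Nat.pow_le_pow_right hL1 h
  have hq : 4 * (k + 40) * L ^ (a + 32) ≤ L ^ (a + 33) := by
    calc 4 * (k + 40) * L ^ (a + 32) ≤ L * L ^ (a + 32) := Nat.mul_le_mul_right _ (by omega)
      _ = L ^ (a + 33) := by ring
  have h1 : L * (L * (4 * (k + 40) + 2) * L ^ (a + 2)) ≤ L ^ (2 * a + 20) := by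
    calc _ ≤ L * (L * L * L ^ (a + 2)) := by gcongr
      _ = L ^ (a + 5) := by ring
      _ ≤ _ := hpw (by omega)
  have h2 : L * (4 * (k + 40) * L ^ (a + 32)) ≤ L ^ (2 * a + 20) := by
    calc _ ≤ L * L ^ (a + 33) := by gcongr
      _ = L ^ (a + 34) := by ring
      _ ≤ _ := hpw (by omega)
  have h3 : L * (k * (2 * k + 1) * (2 * L ^ (a + 15))) *
      (L * (4 * (k + 40) + 2) * L ^ (a + 2)) ≤ L ^ (2 * a + 20) := by
    calc _ = (k * (2 * k + 1) * 2 * (4 * (k + 40) + 2)) * L ^ (2 * a + 19) := by ring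
      _ ≤ L * L ^ (2 * a + 19) := by gcongr
      _ = _ := by ring
  have h4 : L * ((2 * h * L ^ 50 + (4 * (k + 40) * L ^ (a + 32) / L ^ 50 + 1)) *
      (4 * (k + 40) * L ^ (a + 32))) ≤ L ^ (2 * a + 20) := by
    obtain ⟨b, rfl⟩ := Nat.exists_eq_add_of_le' (show 17 ≤ a by omega)
    have hd : 4 * (k + 40) * L ^ (b + 17 + 32) / L ^ 50 ≤ L ^ b := by
      refine Nat.div_le_of_le_mul (hq.trans_eq ?_)
      ring
    have hm : 2 * h * L ^ 50 ≤ L ^ b := by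
      calc 2 * h * L ^ 50 ≤ L * L ^ 50 := by gcongr
        _ = L ^ 51 := by ring
        _ ≤ _ := hpw (by omega)
    have h0 : 1 ≤ L ^ b := Nat.one_le_pow _ _ hL1
    calc _ ≤ L * (L * L ^ b * L ^ (b + 17 + 33)) := by
          refine Nat.mul_le_mul_left _ (Nat.mul_le_mul ?_ hq)
          nlinarith
      _ = L ^ (2 * b + 52) := by ring
      _ ≤ _ := hpw (by omega)
  have h5 : K * L ^ 2 ≤ L ^ (2 * a + 20) := by
    calc K * L ^ 2 ≤ L * L ^ 2 := by gcongr
      _ = L ^ 3 := by ring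
      _ ≤ _ := hpw (by omega)
  calc _ ≤ 5 * L ^ (2 * a + 20) := by omega
    _ ≤ L * L ^ (2 * a + 20) := by gcongr; omega
    _ = _ := by ring

theorem choices_le {n L a k h K : ℕ} (ha : 100 ≤ a) (hL : 96 ≤ L) (hn : n + 1 ≤ 2 ^ L)
    (hq : (4 * (k + 40) * L ^ (a + 32)) ^ 2 + 1 ≤ 2 ^ L)
    (hk : k * (2 * k + 1) * 2 * (4 * (k + 40) + 2) ≤ L) (hk' : 4 * (k + 40) + 2 ≤ L)
    (hh : 2 * h ≤ L) (hK : K ≤ L) :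
    (n + 1) ^ (L * (4 * (k + 40) + 2) * L ^ (a + 2)) * (n + 1) ^ (4 * (k + 40) * L ^ (a + 32)) *
      ((2 ^ (L * (k * (2 * k + 1) * (2 * L ^ (a + 15))))) ^
          (L * (4 * (k + 40) + 2) * L ^ (a + 2)) *
        ((4 * (k + 40) * L ^ (a + 32)) ^ 2 + 1) ^
          ((2 * h * L ^ 50 + (4 * (k + 40) * L ^ (a + 32) / L ^ 50 + 1)) *
            (4 * (k + 40) * L ^ (a + 32)))) * 2 ^ (K * L ^ 2) ≤ 2 ^ (L ^ (2 * a + 21)) := by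
  refine le_trans ?_ (Nat.pow_le_pow_right two_pos (choice_exponent_le ha hL hk hk' hh hK))
  generalize L * (4 * (k + 40) + 2) * L ^ (a + 2) = t
  generalize 4 * (k + 40) * L ^ (a + 32) = q at *
  generalize L * (k * (2 * k + 1) * (2 * L ^ (a + 15))) = M
  generalize (2 * h * L ^ 50 + (q / L ^ 50 + 1)) * q = x
  rw [pow_add, pow_add, pow_add, pow_add, pow_mul 2 L t, pow_mul 2 L q, pow_mul 2 L x,
    pow_mul 2 M t]
  gcongr

/-- The parameters of the recovery of the arcs between the central vertices. -/
theorem recovery_le {L a k h : ℕ} (hL : 1 ≤ L) (hh : 2 * h ≤ L) (ha : 51 * h + 19 ≤ a) :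
    2 * h * (4 * (k + 40) * L ^ (a + 32)) ≤
        2 * h * L ^ 50 * (4 * (k + 40) * L ^ (a + 32) / L ^ 50 + 1) ∧
      2 * h * (2 * h * L ^ 50) ^ h ≤ 4 * (k + 40) * L ^ (a + 32) / L ^ 50 + 1 := by
  have hL50 : 0 < L ^ 50 := Nat.pow_pos hL
  constructor
  · generalize 4 * (k + 40) * L ^ (a + 32) = q
    generalize L ^ 50 = x at *
    rw [mul_assoc (2 * h) x]
    exact Nat.mul_le_mul_left _ (Nat.lt_mul_div_succ q hL50).le
  · refine Nat.le_succ_of_le ((Nat.le_div_iff_mul_le hL50).2 ?_)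
    have h1 : 2 * h * (2 * h * L ^ 50) ^ h * L ^ 50 ≤ L * (L * L ^ 50) ^ h * L ^ 50 := by
      gcongr
    have h2 : L * (L * L ^ 50) ^ h * L ^ 50 = L ^ (51 * h + 51) := by
      rw [← pow_succ', ← pow_mul, ← pow_succ', ← pow_add]
    exact h1.trans (h2.trans_le ((Nat.pow_le_pow_right hL (by omega)).trans
      (Nat.le_mul_of_pos_left _ (by omega))))

/-- An upper bound for the binary logarithm of `n + 2`. -/
def lg (n : ℕ) : ℕ := Nat.log 2 n + 2

theorem lg_mono {m n : ℕ} (h : m ≤ n) : lg m ≤ lg n :=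
  Nat.add_le_add_right (Nat.log_mono_right h) 2

theorem add_two_le_two_pow_lg (n : ℕ) : n + 2 ≤ 2 ^ lg n := by
  have h := Nat.lt_pow_succ_log_self one_lt_two n
  rw [lg, show Nat.log 2 n + 2 = (Nat.log 2 n).succ + 1 from rfl, pow_succ]
  have : 1 ≤ 2 ^ (Nat.log 2 n).succ := Nat.one_le_two_pow
  omega

theorem lg_le_of_le {m n : ℕ} (h : n ≤ 2 * m ^ 16) : lg n ≤ 16 * lg m := by
  have h1 : Nat.log 2 n < 16 * (Nat.log 2 m + 1) + 1 := by
    refine Nat.log_lt_of_lt_pow' (by omega) (h.trans_lt ?_)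
    have h2 := Nat.pow_lt_pow_left (Nat.lt_pow_succ_log_self one_lt_two m) (n := 16) (by omega)
    rw [← pow_mul] at h2
    rw [pow_succ 2 (16 * _), mul_comm (_ ^ _) 2, mul_comm 16]
    exact Nat.mul_lt_mul_of_pos_left h2 two_pos
  rw [lg, lg]
  omega

theorem clog_add_one_le_lg (n : ℕ) : Nat.clog 2 n + 1 ≤ lg n := by
  have : Nat.clog 2 n ≤ Nat.log 2 n + 1 :=
    Nat.clog_le_of_le_pow (Nat.lt_pow_succ_log_self one_lt_two n).le
  rw [lg]; omega

/-- Powers of logarithms are eventually small. -/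
theorem exists_lg_pow_le (C B : ℕ) : ∃ m₀, C ≤ m₀ ∧ ∀ n, m₀ ≤ n → C ≤ lg n ∧ lg n ^ B ≤ n := by
  have h : ∀ᶠ l : ℕ in Filter.atTop, (l + 2) ^ B ≤ 2 ^ l := by
    have h1 := (tendsto_pow_const_div_const_pow_of_one_lt B (one_lt_two (α := ℝ))).comp
      (Filter.tendsto_add_atTop_nat 2)
    have h2 := h1.eventually (ge_mem_nhds (by norm_num : (0 : ℝ) < 1 / 4))
    filter_upwards [h2] with l hl
    rw [Function.comp_apply, div_le_iff₀ (by positivity), pow_add] at hl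
    have : ((l + 2 : ℕ) : ℝ) ^ B ≤ 2 ^ l := by linarith
    exact_mod_cast this
  obtain ⟨l₀, hl₀⟩ := Filter.eventually_atTop.1 h
  refine ⟨2 ^ (max l₀ C), (le_max_right _ _).trans Nat.lt_two_pow_self.le, fun n hn => ?_⟩
  have hn0 : n ≠ 0 := by
    rintro rfl
    simp at hn
  have h1 : max l₀ C ≤ Nat.log 2 n := (Nat.le_log_iff_pow_le one_lt_two hn0).2 hn
  refine ⟨(le_max_right l₀ C).trans (h1.trans (Nat.le_add_right _ _)), ?_⟩
  exact (hl₀ _ ((le_max_left _ _).trans h1)).trans (Nat.pow_log_le_self 2 hn0)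

end Parameters

section Validity

/-- The cutting scheme with polylogarithmic parameters. -/
def polylogScheme (k a m₀ : ℕ) : Scheme where
  t n := lg n * (4 * (k + 40) + 2) * lg n ^ (a + 2)
  q n := 4 * (k + 40) * lg n ^ (a + 32)
  r n := (4 * (k + 40) * lg n ^ (a + 32)) ^ 2 +
    lg n * (4 * (k + 40) + 2) * lg n ^ (a + 2) *
      (8 * k * (lg n ^ (a + 32) * (Nat.sqrt n + 1)))
  M n := 2 ^ (lg n * (k * (2 * k + 1) * (2 * lg n ^ (a + 15))))
  e n := lg n ^ (2 * a + 21)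
  g n := lg n ^ (2 * a + 25)
  m₀ := m₀

theorem card_not_cuttable_le {N k a m₀ K : ℕ} (hk : 4 ≤ k)
    (hK : ∀ (L : ℕ) (S : Finset (Fin N)) (t : ℕ), S.card + 2 ≤ 2 ^ L → 1 ≤ t →
      ∑ E ∈ freeOn k S, kap k S E ^ t ≤ (freeOn k S).card * 2 ^ (K * t ^ 2 * L ^ 2))
    {S : Finset (Fin N)} (ha : 1 ≤ a) (hL : 40 * (k + 40) * (6000000 * k) + 1 ≤ lg S.card)
    (hLK : 64 * (K + 3) ≤ lg S.card) :
    ((freeOn k S).filter fun E => ¬ (polylogScheme k a m₀).Cuttable k S E).card *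
      2 ^ (2 * (polylogScheme k a m₀).g S.card) ≤ (freeOn k S).card := by
  have hn := add_two_le_two_pow_lg S.card
  set L := lg S.card with hLdef
  have hkL : 6000000 * k ≤ L := by nlinarith
  have hL1 : 1 ≤ L := by omega
  have hpw : ∀ {i j : ℕ}, i ≤ j → L ^ i ≤ L ^ j := fun h => Nat.pow_le_pow_right hL1 h
  have hpos : ∀ i : ℕ, 1 ≤ L ^ i := fun i => Nat.one_le_pow _ _ hL1
  have hm : 32 * (2 * L ^ (2 * a + 25) + 1) ≤ L ^ (2 * a + 26) := by
    have := hpos (2 * a + 25)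
    calc _ ≤ 96 * L ^ (2 * a + 25) := by omega
      _ ≤ L * L ^ (2 * a + 25) := by gcongr; omega
      _ = _ := by ring
  have h1 := card_not_typ_le hk (fun S t => hK L S t) hn (j := L ^ (a + 2)) (s := L ^ (a + 30))
    (m := 2 * L ^ (2 * a + 25) + 1)
    (by
      calc 64 * L ≤ L * L := by gcongr; omega
        _ = L ^ 2 := by ring
        _ ≤ _ := hpw (by omega))
    (by
      calc 64 * (K + 3) * L ^ (a + 2) * L ^ 2 ≤ L * L ^ (a + 2) * L ^ 2 := by gcongr
        _ = L ^ (a + 5) := by ring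
        _ ≤ _ := hpw (by omega))
    (by
      rw [← pow_add]
      exact hm.trans (hpw (by omega)))
  have h2 := card_not_typ_le hk (fun S t => hK L S t) hn (j := L ^ (a + 12)) (s := L ^ (a + 15))
    (m := 2 * L ^ (2 * a + 25) + 1)
    (by
      calc 64 * L ≤ L * L := by gcongr; omega
        _ = L ^ 2 := by ring
        _ ≤ _ := hpw (by omega))
    (by
      calc 64 * (K + 3) * L ^ (a + 12) * L ^ 2 ≤ L * L ^ (a + 12) * L ^ 2 := by gcongr
        _ = L ^ (a + 15) := by ring)
    (by
      rw [← pow_add]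
      exact hm.trans (hpw (by omega)))
  have hsub : ((freeOn k S).filter fun E => ¬ (polylogScheme k a m₀).Cuttable k S E) ⊆
      ((freeOn k S).filter fun E => ¬ Typ (L ^ (a + 2)) (L ^ (a + 30)) S E) ∪
        ((freeOn k S).filter fun E => ¬ Typ (L ^ (a + 12)) (L ^ (a + 15)) S E) := by
    intro E hE
    obtain ⟨hEf, hc⟩ := Finset.mem_filter.1 hE
    by_contra hcon
    rw [Finset.mem_union, not_or] at hcon
    have hT : Typ (L ^ (a + 2)) (L ^ (a + 30)) S E := by
      by_contra h
      exact hcon.1 (Finset.mem_filter.2 ⟨hEf, h⟩)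
    have hT' : Typ (L ^ (a + 12)) (L ^ (a + 15)) S E := by
      by_contra h
      exact hcon.2 (Finset.mem_filter.2 ⟨hEf, h⟩)
    have hLs : L ≤ L ^ (a + 30) := by simpa using hpw (show 1 ≤ a + 30 by omega)
    have hjy : 2 * L ^ (a + 2) ≤ L ^ (a + 32) := by
      calc 2 * L ^ (a + 2) ≤ L * L ^ (a + 2) := by gcongr; omega
        _ = L ^ (a + 3) := by ring
        _ ≤ _ := hpw (by omega)
    have hz0 : L ^ (a + 32) ≤ L ^ (a + 32) * (Nat.sqrt S.card + 1) :=
      Nat.le_mul_of_pos_right _ (Nat.succ_pos _)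
    refine hc (exists_goodCut hk hEf hT hT' (hpw (by omega)) (by omega) (hpw (by omega))
      (hpos _) hn (y := L ^ (a + 32)) (z := L ^ (a + 32) * (Nat.sqrt S.card + 1))
      (hpw (by omega)) hjy ?_ ((hpw (by omega)).trans hz0) (hjy.trans hz0) ?_)
    · calc 40 * (k + 40) * (6000000 * k * L * L ^ (a + 30)) =
          (40 * (k + 40) * (6000000 * k)) * L ^ (a + 31) := by ring
        _ < L * L ^ (a + 31) := Nat.mul_lt_mul_of_pos_right (by omega) (hpos _)
        _ = _ := by ring
    · have hs := Nat.sqrt_lt'.1 (Nat.lt_succ_self (Nat.sqrt S.card))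
      rw [Nat.succ_eq_add_one] at hs
      have h8 : 8 * (6000000 * k) ≤ L := by nlinarith
      calc 8 * (6000000 * k * L * L ^ (a + 30) * S.card) =
          (8 * (6000000 * k)) * L ^ (a + 31) * S.card := by ring
        _ ≤ L * L ^ (a + 31) * S.card := by gcongr
        _ = L ^ (a + 32) * S.card := by ring
        _ < L ^ (a + 32) * (Nat.sqrt S.card + 1) ^ 2 := Nat.mul_lt_mul_of_pos_left hs (hpos _)
        _ ≤ L ^ (a + 32) * (L ^ (a + 32) * (Nat.sqrt S.card + 1) ^ 2) :=
          Nat.le_mul_of_pos_left _ (hpos _)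
        _ = _ := by ring
  have h3 := (Finset.card_le_card hsub).trans (Finset.card_union_le _ _)
  change _ * 2 ^ (2 * L ^ (2 * a + 25)) ≤ _
  rw [pow_succ 2 (2 * _)] at h1 h2
  have h4 := Nat.mul_le_mul_right (2 ^ (2 * L ^ (2 * a + 25))) h3
  rw [add_mul] at h4
  rw [← mul_assoc] at h1 h2
  exact h4.trans (by omega)

theorem pow_le_psi {x n : ℕ} (h : x ^ 4 ≤ n) : (x : ℝ) * Nat.sqrt n ≤ psi n := by
  refine le_of_pow_le_pow_left₀ (n := 4) (by norm_num) (psi_nonneg _) ?_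
  rw [psi_pow, mul_pow]
  have h1 : (x : ℝ) ^ 4 ≤ n := by exact_mod_cast h
  have h2 : (Nat.sqrt n : ℝ) ^ 2 ≤ n := by exact_mod_cast Nat.sqrt_le' n
  calc (x : ℝ) ^ 4 * (Nat.sqrt n : ℝ) ^ 4 = (x : ℝ) ^ 4 * ((Nat.sqrt n : ℝ) ^ 2) ^ 2 := by ring
    _ ≤ n * (n : ℝ) ^ 2 := by gcongr
    _ = _ := by ring

theorem natCast_le_psi_div {x y n : ℕ} (h : x ^ 4 ≤ n) (hy : 10 * y ≤ x * Nat.sqrt n) :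
    (y : ℝ) ≤ psi n / 10 := by
  have h1 := pow_le_psi h
  have h2 : (10 : ℝ) * y ≤ x * Nat.sqrt n := by exact_mod_cast hy
  linarith

/-- Polylogarithmic parameters are valid. -/
theorem polylogScheme_valid {N k h m₀ K C : ℕ} (hk : 4 ≤ k) (hh : k = 2 * h)
    (hK : ∀ (L : ℕ) (S : Finset (Fin N)) (t : ℕ), S.card + 2 ≤ 2 ^ L → 1 ≤ t →
      ∑ E ∈ freeOn k S, kap k S E ^ t ≤ (freeOn k S).card * 2 ^ (K * t ^ 2 * L ^ 2))
    (hC1 : 40 * (k + 40) * (6000000 * k) + 1 ≤ C) (hC2 : 64 * (K + 3) ≤ C)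
    (hC3 : k * (2 * k + 1) * 2 * (4 * (k + 40) + 2) ≤ C)
    (hC4 : 64 * 16 ^ (2 * (128 * h) + 21) ≤ C) (hCm : C ≤ m₀)
    (hm₀ : ∀ n, m₀ ≤ n → C ≤ lg n ∧ lg n ^ (4 * (2 * (128 * h) + 70)) ≤ n) :
    (polylogScheme k (128 * h) m₀).Valid N k := by
  have hkC : 100 * k ≤ C ∧ 4 * (k + 40) + 2 ≤ C ∧ 100 ≤ C := by
    refine ⟨?_, ?_, ?_⟩ <;> nlinarith
  obtain ⟨hC5, hC6, hC7⟩ := hkC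
  have ha : 100 ≤ 128 * h := by omega
  generalize haa : 128 * h = a at *
  have hsq : ∀ n, m₀ ≤ n → 1 ≤ Nat.sqrt n := fun n hn =>
    Nat.sqrt_pos.2 (by omega)
  have hq2 : ∀ n, m₀ ≤ n → (4 * (k + 40) * lg n ^ (a + 32)) ^ 2 ≤ lg n ^ (2 * a + 66) := by
    intro n hn
    obtain ⟨hL, -⟩ := hm₀ n hn
    calc (4 * (k + 40) * lg n ^ (a + 32)) ^ 2 ≤ (lg n * lg n ^ (a + 32)) ^ 2 := by
          gcongr; omega
      _ = _ := by ring
  have hpw : ∀ n, m₀ ≤ n → ∀ {i j : ℕ}, i ≤ j → lg n ^ i ≤ lg n ^ j := fun n hn _ _ hij =>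
    Nat.pow_le_pow_right (by have := (hm₀ n hn).1; omega) hij
  have hbig : ∀ n, m₀ ≤ n → (lg n ^ (2 * a + 70)) ^ 4 ≤ n := fun n hn => by
    rw [← pow_mul, mul_comm]; exact (hm₀ n hn).2
  refine ⟨by change 2 ≤ m₀; omega, ?_, ?_, ?_, ?_, ?_, ?_⟩
  · intro S hS 𝒢 h𝒢 hcut w u v hu hv hw b hb0 hb
    change m₀ ≤ S.card at hS
    have hn := add_two_le_two_pow_lg S.card
    obtain ⟨hL, -⟩ := hm₀ _ hS
    set L := lg S.card with hLdef
    have hL1 : 1 ≤ L := by omega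
    have hqL : (4 * (k + 40) * L ^ (a + 32)) ^ 2 + 1 ≤ 2 ^ L := by
      have h1 := hbig _ hS
      rw [← pow_mul] at h1
      have h2 := hpw _ hS (show 2 * a + 66 ≤ (2 * a + 70) * 4 by omega)
      have h3 := hq2 _ hS
      rw [← hLdef] at h1 h2 h3
      omega
    have hch := choices_le (K := K) (h := h) ha (by omega) (by omega : S.card + 1 ≤ 2 ^ L) hqL
      (hC3.trans hL) (by omega) (by omega) (by omega)
    obtain ⟨hmd, hd⟩ := recovery_le (L := L) (k := k) hL1 (by omega : 2 * h ≤ L)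
      (by omega : 51 * h + 19 ≤ a)
    have hmain := sum_goodCut_le hk hh (fun S t => hK L S t) hn (m := 2 * h * L ^ 50)
      (Nat.mul_pos (by omega) (Nat.pow_pos hL1)) hmd hd h𝒢
      (fun E hE => (hcut E hE).goodCut) hu hv hw hb0 hb
    refine hmain.trans (mul_le_mul_of_nonneg_left (mul_le_mul_of_nonneg_right ?_ hb0)
      (Nat.cast_nonneg _))
    have := (Nat.cast_le (α := ℝ)).2 hch
    rw [Nat.cast_pow 2, Nat.cast_ofNat] at this
    exact this
  · intro S hS
    obtain ⟨hL, -⟩ := hm₀ _ hS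
    exact card_not_cuttable_le hk hK (by omega) (hC1.trans hL) (hC2.trans hL)
  · intro n hn
    change m₀ ≤ n at hn
    have := natCast_le_psi_div (y := lg n ^ (2 * a + 21) + 1) (hbig n hn) ?_
    · exact_mod_cast this
    · obtain ⟨hL, -⟩ := hm₀ n hn
      have h0 : 1 ≤ lg n ^ (2 * a + 21) := Nat.one_le_pow _ _ (by omega)
      calc 10 * (lg n ^ (2 * a + 21) + 1) ≤ 20 * lg n ^ (2 * a + 21) := by omega
        _ ≤ lg n * lg n ^ (2 * a + 21) := by gcongr; omega
        _ = lg n ^ (2 * a + 22) := by ring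
        _ ≤ lg n ^ (2 * a + 70) := hpw n hn (by omega)
        _ ≤ _ := Nat.le_mul_of_pos_right _ (hsq n hn)
  · intro n hn
    change m₀ ≤ n at hn
    refine natCast_le_psi_div (hbig n hn) ?_
    obtain ⟨hL, -⟩ := hm₀ n hn
    have hs := hsq n hn
    have h1 : (4 * (k + 40) * lg n ^ (a + 32)) ^ 2 ≤ lg n ^ (2 * a + 68) * Nat.sqrt n :=
      (hq2 n hn).trans ((hpw n hn (by omega)).trans (Nat.le_mul_of_pos_right _ hs))
    have h2 : lg n * (4 * (k + 40) + 2) * lg n ^ (a + 2) *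
        (8 * k * (lg n ^ (a + 32) * (Nat.sqrt n + 1))) ≤ lg n ^ (2 * a + 68) * Nat.sqrt n := by
      calc _ ≤ lg n * lg n * lg n ^ (a + 2) * (lg n * (lg n ^ (a + 32) *
            (lg n * Nat.sqrt n))) := by
            gcongr
            · omega
            · omega
            · nlinarith
        _ = lg n ^ (2 * a + 38) * Nat.sqrt n := by ring
        _ ≤ _ := Nat.mul_le_mul_right _ (hpw n hn (by omega))
    calc 10 * (polylogScheme k a m₀).r n ≤ 10 * (2 * (lg n ^ (2 * a + 68) * Nat.sqrt n)) := by
          change 10 * (_ + _) ≤ _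
          omega
      _ = 20 * (lg n ^ (2 * a + 68) * Nat.sqrt n) := by ring
      _ ≤ lg n * (lg n ^ (2 * a + 68) * Nat.sqrt n) := by gcongr; omega
      _ = lg n ^ (2 * a + 69) * Nat.sqrt n := by ring
      _ ≤ _ := Nat.mul_le_mul_right _ (hpw n hn (by omega))
  · exact fun m n _ hmn => Nat.pow_le_pow_left (lg_mono hmn) _
  · intro m hm
    change m₀ ≤ m at hm
    obtain ⟨hL, -⟩ := hm₀ m hm
    refine ⟨(16 * lg m) ^ (2 * a + 21) + 3, fun n _ hn => ⟨?_, ?_⟩⟩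
    · exact Nat.add_le_add_right (Nat.pow_le_pow_left (lg_le_of_le hn) _) 3
    · change _ ≤ lg m ^ (2 * a + 25)
      have h0 : 1 ≤ lg m ^ (2 * a + 21) := Nat.one_le_pow _ _ (by omega)
      have h1 : (16 * lg m) ^ (2 * a + 21) + 3 ≤ lg m ^ (2 * a + 22) := by
        have h16 : 1 ≤ 16 ^ (2 * a + 21) := Nat.one_le_pow _ _ (by omega)
        calc _ = 16 ^ (2 * a + 21) * lg m ^ (2 * a + 21) + 3 := by rw [mul_pow]
          _ ≤ (64 * 16 ^ (2 * a + 21)) * lg m ^ (2 * a + 21) := by nlinarith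
          _ ≤ lg m * lg m ^ (2 * a + 21) := by gcongr; omega
          _ = _ := by ring
      calc 2 * ((16 * lg m) ^ (2 * a + 21) + 3) * (Nat.clog 2 n + 1) ≤
          2 * lg m ^ (2 * a + 22) * (16 * lg m) := by
            gcongr
            exact (clog_add_one_le_lg n).trans (lg_le_of_le hn)
        _ = 32 * lg m ^ (2 * a + 23) := by ring
        _ ≤ lg m * lg m ^ (2 * a + 23) := by gcongr; omega
        _ = lg m ^ (2 * a + 24) := by ring
        _ ≤ _ := hpw m hm (by omega)

/-- Valid schemes exist, with arbitrarily large threshold. -/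
theorem exists_valid {k : ℕ} (hk : 4 ≤ k) (hke : Even k) (m : ℕ) :
    ∃ P : Scheme, m ≤ P.m₀ ∧ ∀ N, P.Valid N k := by
  obtain ⟨K, hK⟩ := exists_moment_bound hk hke
  obtain ⟨h, hh⟩ := hke
  obtain ⟨m₀, hm, hm₀⟩ := exists_lg_pow_le
    (m + (40 * (k + 40) * (6000000 * k) + 1) + 64 * (K + 3) +
      k * (2 * k + 1) * 2 * (4 * (k + 40) + 2) + 64 * 16 ^ (2 * (128 * h) + 21))
    (4 * (2 * (128 * h) + 70))
  refine ⟨polylogScheme k (128 * h) m₀, ?_, fun N => polylogScheme_valid hk (by omega)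
    (hK N) ?_ ?_ ?_ ?_ hm hm₀⟩
  · change m ≤ m₀
    generalize 16 ^ (2 * (128 * h) + 21) = x at *
    generalize k * (2 * k + 1) * 2 * (4 * (k + 40) + 2) = y at *
    generalize 40 * (k + 40) * (6000000 * k) = z at *
    omega
  all_goals
    generalize 16 ^ (2 * (128 * h) + 21) = x at *
    generalize k * (2 * k + 1) * 2 * (4 * (k + 40) + 2) = y at *
    generalize 40 * (k + 40) * (6000000 * k) = z at *
    omega

end Validity

theorem mem_freeOn_univ {n k : ℕ} {E : ArcSet n} :
    E ∈ freeOn k Finset.univ ↔ IsLoopless E ∧ CkFree k E := by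
  rw [mem_freeOn]
  refine and_congr_left fun _ => ⟨fun h v hv => ?_, fun h => ?_⟩
  · exact (Finset.mem_offDiag.1 (h hv)).2.2 rfl
  · rintro ⟨a, b⟩ hab
    refine Finset.mem_offDiag.2 ⟨Finset.mem_univ _, Finset.mem_univ _, ?_⟩
    rintro (rfl : a = b)
    exact h a hab

theorem bMin_eq_bb {n : ℕ} {E : ArcSet n} (hE : IsLoopless E) : bMin E = bb E Finset.univ := by
  refine le_antisymm ?_ ?_
  · obtain ⟨pos, hinj, hlt, hcard⟩ := exists_opt E Finset.univ
    have hlt' : ∀ z, pos z < n := fun z => by simpa using hlt z (Finset.mem_univ z)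
    let p : Fin n → Fin n := fun z => ⟨pos z, hlt' z⟩
    have hp : Function.Injective p := fun x y hxy =>
      hinj (Finset.mem_coe.2 (Finset.mem_univ x)) (Finset.mem_coe.2 (Finset.mem_univ y))
        (Fin.mk.inj_iff.1 hxy)
    let σ : Equiv.Perm (Fin n) := Equiv.ofBijective p (Finite.injective_iff_bijective.1 hp)
    refine (Finset.inf'_le _ (Finset.mem_univ σ)).trans (le_of_le_of_eq ?_ hcard)
    refine Finset.card_le_card ?_
    rintro ⟨a, b⟩ hab
    obtain ⟨h1, h2⟩ := Finset.mem_filter.1 hab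
    have h3 : pos b < pos a := h2
    exact mem_backs.2 ⟨h1, Finset.mem_univ _, Finset.mem_univ _, h3.le⟩
  · refine Finset.le_inf' _ _ fun σ _ => ?_
    refine (bb_le E Finset.univ fun z => (σ z : ℕ)).trans (Finset.card_le_card ?_)
    rintro ⟨a, b⟩ hab
    obtain ⟨h1, -, -, h2⟩ := mem_backs.1 hab
    refine Finset.mem_filter.2 ⟨h1, lt_of_le_of_ne h2 fun h => ?_⟩
    obtain rfl : b = a := σ.injective h
    exact hE _ h1

theorem card_linear_backwards_ge {n k : ℕ} (hk : 4 ≤ k) {P : Scheme} (hP : P.Valid n k)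
    (hm : 2 * 160 ^ 4 ≤ P.m₀) (hn : P.m₀ ≤ n) :
    1 - (1 / (n : ℝ) + (2 ^ ((n : ℝ) / 320))⁻¹) ≤
      ((Finset.univ.filter fun E : ArcSet n => IsLoopless E ∧ CkFree k E ∧
        1 / (320 * P.m₀) * n ≤ (bMin E : ℝ) ∧ (bMin E : ℝ) ≤ (P.m₀ + 2) * n).card : ℝ) /
        fnkD n k := by
  have hF : fnkD n k = (freeOn k (Finset.univ : Finset (Fin n))).card := by
    refine congrArg Finset.card (Finset.ext fun E => ?_)
    rw [mem_freeOn_univ, Finset.mem_filter]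
    simp
  have hF0 : (0 : ℝ) < fnkD n k := by
    rw [hF]; exact_mod_cast one_le_card_freeOn _
  have hn0 : (0 : ℝ) < n := by exact_mod_cast (by omega : 0 < n)
  have hcu : (Finset.univ : Finset (Fin n)).card = n := by simp
  have h1 := hP.card_sum_sq_le (by omega) Finset.univ
  have h2 := hP.card_bb_lt_le (by omega : 3 ≤ k) hm (S := Finset.univ) (by omega)
  rw [hcu, ← hF] at h1 h2
  set B₁ := (freeOn k (Finset.univ : Finset (Fin n))).filter fun E => (n : ℝ) / 4 <
    ((P.leaves k Finset.univ E).map fun l : ℕ => (l : ℝ) ^ 2).sum with hB₁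
  set B₂ := (freeOn k (Finset.univ : Finset (Fin n))).filter fun E =>
    ((P.leaves k Finset.univ E).map fun l : ℕ => (l : ℝ) ^ 2).sum ≤ (n : ℝ) / 4 ∧
      (bb E Finset.univ : ℝ) < n / (320 * P.m₀) with hB₂
  set G := Finset.univ.filter fun E : ArcSet n => IsLoopless E ∧ CkFree k E ∧
        1 / (320 * P.m₀) * n ≤ (bMin E : ℝ) ∧ (bMin E : ℝ) ≤ (P.m₀ + 2) * n with hG
  have hsub : freeOn k (Finset.univ : Finset (Fin n)) ⊆ G ∪ (B₁ ∪ B₂) := by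
    intro E hE
    obtain ⟨hl, hc⟩ := mem_freeOn_univ.1 hE
    rw [Finset.mem_union, Finset.mem_union]
    by_cases hs : (n : ℝ) / 4 < ((P.leaves k Finset.univ E).map fun l : ℕ => (l : ℝ) ^ 2).sum
    · exact Or.inr (Or.inl (Finset.mem_filter.2 ⟨hE, hs⟩))
    rw [not_lt] at hs
    by_cases hb : (bb E Finset.univ : ℝ) < n / (320 * P.m₀)
    · exact Or.inr (Or.inr (Finset.mem_filter.2 ⟨hE, hs, hb⟩))
    refine Or.inl (Finset.mem_filter.2 ⟨Finset.mem_univ _, hl, hc, ?_, ?_⟩)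
    · rw [bMin_eq_bb hl, one_div_mul_eq_div]
      exact not_lt.1 hb
    · have h3 := hP.bb_le Finset.univ E
      rw [hcu] at h3
      rw [bMin_eq_bb hl]
      linarith [psi_nonneg n]
  have hcard : (fnkD n k : ℝ) ≤ G.card + (B₁.card + B₂.card) := by
    rw [hF]
    exact_mod_cast (Finset.card_le_card hsub).trans ((Finset.card_union_le _ _).trans
      (Nat.add_le_add_left (Finset.card_union_le _ _) _))
  have h1' : (B₁.card : ℝ) ≤ fnkD n k * (1 / n) := by
    rw [mul_one_div, le_div_iff₀ hn0]; exact h1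
  have h2' : (B₂.card : ℝ) ≤ fnkD n k * (2 ^ ((n : ℝ) / 320))⁻¹ := by
    rw [← div_eq_mul_inv, le_div_iff₀ (by positivity)]; exact h2
  rw [le_div_iff₀ hF0]
  linarith

/-- For every even `k ≥ 4` there are constants `c₁, c₂ > 0` such
that almost every `C_k`-free digraph `G` on `[n]` satisfies `c₁ n ≤ b(G) ≤ c₂ n`. -/
theorem almost_all_Ck_free_digraph_linear_backwards (k : ℕ) (hk : 4 ≤ k)
    (hke : Even k) :
    ∃ c₁ c₂ : ℝ, 0 < c₁ ∧ 0 < c₂ ∧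
      Filter.Tendsto
        (fun n : ℕ =>
          (((Finset.univ.filter fun E : ArcSet n =>
              IsLoopless E ∧ CkFree k E ∧
                c₁ * n ≤ (bMin E : ℝ) ∧ (bMin E : ℝ) ≤ c₂ * n).card : ℝ) /
            (fnkD n k : ℝ)))
        Filter.atTop (nhds 1) := by
  obtain ⟨P, hm, hP⟩ := exists_valid hk hke (2 * 160 ^ 4)
  have hm0 : (0 : ℝ) < P.m₀ := by exact_mod_cast (by omega : 0 < P.m₀)
  refine ⟨1 / (320 * P.m₀), P.m₀ + 2, by positivity, by positivity, ?_⟩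
  have hlim : Filter.Tendsto (fun n : ℕ => 1 - (1 / (n : ℝ) + (2 ^ ((n : ℝ) / 320))⁻¹))
      Filter.atTop (nhds 1) := by
    have h1 : Filter.Tendsto (fun n : ℕ => 1 / (n : ℝ)) Filter.atTop (nhds 0) :=
      tendsto_one_div_atTop_nhds_zero_nat
    have h2 : Filter.Tendsto (fun n : ℕ => ((2 : ℝ) ^ ((n : ℝ) / 320))⁻¹) Filter.atTop
        (nhds 0) :=
      ((tendsto_rpow_atTop_of_base_gt_one 2 one_lt_two).comp
        (tendsto_natCast_atTop_atTop.atTop_div_const (by norm_num))).inv_tendsto_atTop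
    simpa using (tendsto_const_nhds (x := (1 : ℝ))).sub (h1.add h2)
  refine tendsto_of_tendsto_of_tendsto_of_le_of_le' hlim tendsto_const_nhds ?_ ?_
  · filter_upwards [Filter.eventually_ge_atTop P.m₀] with n hn
    exact card_linear_backwards_ge hk (hP n) hm hn
  · refine Filter.Eventually.of_forall fun n => div_le_one_of_le₀ ?_ (Nat.cast_nonneg _)
    refine Nat.cast_le.2 (Finset.card_le_card fun E hE => ?_)
    obtain ⟨h1, h2, h3, -⟩ := Finset.mem_filter.1 hE
    exact Finset.mem_filter.2 ⟨h1, h2, h3⟩
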